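/- Fix an integer d ≥ 3, a finite set M, μ ∈ I_d(M) and an integer r ≥ 1. Then lim_{ε→0} liminf_{n→∞} Σ_n(μ,r,ε) = lim_{ε→0} limsup_{n→∞} Σ_n(μ,r,ε) = Σ_r(μ); that is, the combinatorial annealed entropy converges to Σ_r(μ) = H(X_{S_r}) − (d/2) H(X_{E_r}). -/

import Mathlib

open MeasureTheory Filter Topology
open scoped ENNReal Classical

noncomputable section

namespace TreeEntropy

@[ext]
structure RCG (M : Type*) where
  col : List ℕ → Option M
  adj : List ℕ × List ℕ → Bool

variable {M : Type*}

def resS (r : ℕ) (g : RCG M) : RCG M where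
  col l := if l.length ≤ r then g.col l else none
  adj p := if p.1.length ≤ r ∧ p.2.length ≤ r then g.adj p else false

def rcgDist (g g' : RCG M) : ℝ :=
  ∑' r : ℕ, if resS r g = resS r g' then 0 else (2:ℝ)⁻¹ ^ r

private lemma rcg_summable (a b : RCG M) : Summable
    (fun r : ℕ => if resS r a = resS r b then (0:ℝ) else (2:ℝ)⁻¹ ^ r) := by
  refine Summable.of_nonneg_of_le (fun r => ?_) (fun r => ?_)
    (summable_geometric_of_lt_one (by norm_num) (by norm_num : (2:ℝ)⁻¹ < 1))
  · split
    · exact le_rfl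
    · positivity
  · split
    · positivity
    · exact le_rfl

private lemma rcg_nonneg (a b : RCG M) (r : ℕ) :
    (0:ℝ) ≤ if resS r a = resS r b then (0:ℝ) else (2:ℝ)⁻¹ ^ r := by
  split
  · exact le_rfl
  · positivity

private lemma rcgDist_self (g : RCG M) : rcgDist g g = 0 := by simp [rcgDist]

private lemma rcgDist_comm (g g' : RCG M) : rcgDist g g' = rcgDist g' g :=
  tsum_congr fun r => if_congr eq_comm rfl rfl

private lemma rcgDist_triangle (g₁ g₂ g₃ : RCG M) :
    rcgDist g₁ g₃ ≤ rcgDist g₁ g₂ + rcgDist g₂ g₃ := by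
  unfold rcgDist
  rw [← Summable.tsum_add (rcg_summable _ _) (rcg_summable _ _)]
  refine Summable.tsum_le_tsum (fun r => ?_) (rcg_summable _ _)
    ((rcg_summable _ _).add (rcg_summable _ _))
  have hx : (0:ℝ) ≤ (2:ℝ)⁻¹ ^ r := by positivity
  by_cases h12 : resS r g₁ = resS r g₂
  · by_cases h23 : resS r g₂ = resS r g₃
    · rw [if_pos h12, if_pos h23, if_pos (h12.trans h23)]; linarith
    · rw [if_pos h12, if_neg h23, zero_add]
      split_ifs <;> linarith
  · by_cases h23 : resS r g₂ = resS r g₃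
    · rw [if_neg h12, if_pos h23, add_zero]
      split_ifs <;> linarith
    · rw [if_neg h12, if_neg h23]
      split_ifs <;> linarith

private lemma rcgDist_eq_zero (g g' : RCG M) (h : rcgDist g g' = 0) : g = g' := by
  unfold rcgDist at h
  have hr : ∀ r : ℕ, resS r g = resS r g' := by
    intro r
    by_contra hne
    have hpos : (0:ℝ) <
        ∑' r : ℕ, if resS r g = resS r g' then (0:ℝ) else (2:ℝ)⁻¹ ^ r :=
      Summable.tsum_pos (rcg_summable g g') (rcg_nonneg g g') r
        (by rw [if_neg hne]; positivity)
    exact absurd h hpos.ne'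
  have hc : g.col = g'.col := by
    funext l
    have h1 := congrFun (congrArg RCG.col (hr l.length)) l
    simpa [resS] using h1
  have ha : g.adj = g'.adj := by
    funext p
    have h1 := congrFun (congrArg RCG.adj (hr (max p.1.length p.2.length))) p
    simpa [resS, le_max_left, le_max_right] using h1
  exact RCG.ext hc ha

instance : MetricSpace (RCG M) where
  dist := rcgDist
  dist_self := rcgDist_self
  dist_comm := rcgDist_comm
  dist_triangle := rcgDist_triangle
  eq_of_dist_eq_zero := rcgDist_eq_zero _ _

instance : MeasurableSpace (RCG M) := borel _
instance : BorelSpace (RCG M) := ⟨rfl⟩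


/-! ### The `d`-regular tree `T_d` -/

/-- A list `l = [i_k, …, i_1]` (deepest step first) is the breadth-first-search label of a
vertex of the `d`-regular tree `T_d` iff its first (root-side) step lies in `{1, …, d}` and all
subsequent steps lie in `{1, …, d-1}`. -/
def ValidTd (d : ℕ) (l : List ℕ) : Prop :=
  (∀ i ∈ l.dropLast, 1 ≤ i ∧ i ≤ d - 1) ∧ (∀ i ∈ l.getLast?, 1 ≤ i ∧ i ≤ d)

/-- The vertex set of the `d`-regular tree `T_d`. -/
def TdVertex (d : ℕ) : Type := {l : List ℕ // ValidTd d l}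

/-- The root `o` of `T_d`. -/
def rootTd (d : ℕ) : TdVertex d := ⟨[], by constructor <;> simp [List.getLast?]⟩

/-- The first neighbor `1` of the root of `T_d` (defined as the root for the degenerate case
`d = 0`, which never occurs below). -/
def node1 (d : ℕ) : TdVertex d :=
  if h : 1 ≤ d then ⟨[1], by constructor <;> simp [List.getLast?, h]⟩ else rootTd d

/-- The graph structure of the `d`-regular tree: two vertices are adjacent iff one is obtained
from the other by adding one step. -/
def TdGraph (d : ℕ) : SimpleGraph (TdVertex d) where
  Adj v w := (∃ i, w.1 = i :: v.1) ∨ (∃ i, v.1 = i :: w.1)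
  symm := by constructor; intro v w h; tauto
  loopless := by
    constructor
    rintro v (⟨i, h⟩ | ⟨i, h⟩) <;>
      · have := congrArg List.length h
        simp at this

/-- Graph distance between two vertices of a tree encoded by their BFS labels: the nearest
common ancestor corresponds to the longest common suffix. -/
def treeDist (u w : List ℕ) : ℕ :=
  ((u.reverse.zip w.reverse).takeWhile (fun p => p.1 = p.2)).length |> fun c =>
    (u.length - c) + (w.length - c)

/-- The ball `S_r = B_r(o)` of radius `r` around the root of `T_d`. -/
def SrSet (d r : ℕ) : Set (TdVertex d) := {v | v.1.length ≤ r}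

/-- The set `E_r = B_{r-1}({o,1})` of vertices at distance at most `r-1` from the edge `{o,1}`
of `T_d` (for `r ≥ 1`). -/
def ErSet (d r : ℕ) : Set (TdVertex d) :=
  {v | v.1.length + 1 ≤ r ∨ (v.1.getLast? = some 1 ∧ v.1.length ≤ r)}

lemma ErSet_subset_SrSet (d r : ℕ) : ErSet d r ⊆ SrSet d r := by
  rintro v (h | ⟨-, h⟩) <;> simp only [SrSet, Set.mem_setOf_eq] <;> omega

/-! ### Invariant processes on `T_d` and their entropies -/

variable (d : ℕ) (M : Type*)

/-- `I_d(M)`: the set of probability measures on `M^{T_d}` invariant under all automorphisms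
of the tree `T_d`. -/
def InvMeas [MeasurableSpace M] : Set (Measure (TdVertex d → M)) :=
  {μ | IsProbabilityMeasure μ ∧
    ∀ φ : TdGraph d ≃g TdGraph d, μ.map (fun x => fun v => x (φ v)) = μ}

variable {d M}

/-- The Shannon entropy of (the distribution of) a random variable with law `μ`, a measure
with countable support on a discrete space. -/
def shannon {α : Type*} [MeasurableSpace α] (μ : Measure α) : ℝ :=
  ∑' a : α, Real.negMulLog (μ {a}).toReal

/-- The restriction `X_S` of a process `X` on `T_d` to a subset `S` of the vertices:
the pushforward of its law. -/
def restrictTo [MeasurableSpace M] (S : Set (TdVertex d))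
    (μ : Measure (TdVertex d → M)) : Measure (↥S → M) :=
  μ.map (fun x => fun v => x v.1)

/-- The annealed entropy `Σ_r(μ) = H(X_{S_r}) - (d/2) H(X_{E_r})`. -/
def SigmaR [MeasurableSpace M] (d : ℕ) (r : ℕ) (μ : Measure (TdVertex d → M)) : ℝ :=
  shannon (restrictTo (SrSet d r) μ) - (d / 2 : ℝ) * shannon (restrictTo (ErSet d r) μ)

/-- The annealed entropy `Σ(μ) = lim_r Σ_r(μ)`: the limit of the non-increasing sequence
`r ↦ Σ_r(μ)` (`r ≥ 1`), as an extended real (the limit may be `-∞`). -/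
def SigmaInf [MeasurableSpace M] (d : ℕ) (μ : Measure (TdVertex d → M)) : EReal :=
  ⨅ r : ℕ, ((SigmaR d (r + 1) μ : ℝ) : EReal)

/-- `Σ_e(X) = (d/2) H(X_{E_1}) - (d-1) H(X_o)`. -/
def SigmaE [MeasurableSpace M] (d : ℕ) (μ : Measure (TdVertex d → M)) : ℝ :=
  (d / 2 : ℝ) * shannon (restrictTo (ErSet d 1) μ)
    - ((d : ℝ) - 1) * shannon (restrictTo ({rootTd d} : Set (TdVertex d)) μ)

/-! ### Markov processes on `T_d` -/

/-- The elementary cylinder event: the coloring takes the values prescribed by `y` on `S`. -/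
def cylEvent (S : Set (TdVertex d)) (y : TdVertex d → M) : Set (TdVertex d → M) :=
  {x | ∀ v ∈ S, x v = y v}

/-- The side of the edge `{u,w}` containing `u`, in the tree `T_d`. -/
def sideOf (u w : TdVertex d) : Set (TdVertex d) :=
  {v | treeDist v.1 u.1 < treeDist v.1 w.1}

/-- `B_{r-1}({u,w})`: the set of vertices at distance at most `r-1` from the edge `{u,w}`. -/
def edgeBall (r : ℕ) (u w : TdVertex d) : Set (TdVertex d) :=
  {v | treeDist v.1 u.1 + 1 ≤ r ∨ treeDist v.1 w.1 + 1 ≤ r}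

/-- A probability measure on `M^{T_d}` is `r`-Markov on a subset `A` of `T_d` if, for every
edge `{u,w}` of `A`, conditioned on the value on the `(r-1)`-neighborhood of the edge
(within `A`), the processes on the two sides of the edge (within `A`) are independent;
equivalently, the corresponding products of cylinder probabilities agree.  For `A` the whole
tree and `r = 1` this is the edge-Markov property. -/
def rMarkovOn [MeasurableSpace M] (r : ℕ) (A : Set (TdVertex d))
    (μ : Measure (TdVertex d → M)) : Prop :=
  ∀ u w : TdVertex d, u ∈ A → w ∈ A → (TdGraph d).Adj u w →
    ∀ F₁ F₂ : Finset (TdVertex d), ↑F₁ ⊆ sideOf u w ∩ A → ↑F₂ ⊆ sideOf w u ∩ A →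
      ∀ y : TdVertex d → M,
        μ (cylEvent (↑F₁ ∪ ↑F₂ ∪ (edgeBall r u w ∩ A)) y)
            * μ (cylEvent (edgeBall r u w ∩ A) y)
          = μ (cylEvent (↑F₁ ∪ (edgeBall r u w ∩ A)) y)
            * μ (cylEvent (↑F₂ ∪ (edgeBall r u w ∩ A)) y)

/-- A probability measure on `M^{T_d}` is `r`-Markov if, conditioned on the value on the
`(r-1)`-neighborhood of any edge, the processes on the two sides of the edge are
independent. -/
def rMarkov [MeasurableSpace M] (r : ℕ) (μ : Measure (TdVertex d → M)) : Prop :=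
  rMarkovOn r Set.univ μ

/-- A probability measure on `M^{T_d}` is vertex-Markov if, conditioned on the value at a
vertex, the processes on the pending subtrees of that vertex are independent. -/
def vertexMarkov [MeasurableSpace M] (μ : Measure (TdVertex d → M)) : Prop :=
  ∀ v : TdVertex d, ∀ k : ℕ, ∀ u : Fin k → TdVertex d,
    Function.Injective u → (∀ i, (TdGraph d).Adj v (u i)) →
    ∀ F : Fin k → Finset (TdVertex d), (∀ i, ↑(F i) ⊆ sideOf (u i) v) →
      ∀ y : TdVertex d → M,
        μ (cylEvent ((⋃ i, ↑(F i)) ∪ {v}) y) * (μ (cylEvent {v} y)) ^ (k - 1)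
          = ∏ i : Fin k, μ (cylEvent (↑(F i) ∪ {v}) y)

/-- `X_{S_1}` is a vertex-Markov process on `S_1`: the values at the `d` neighbors of the
root are conditionally independent given the value at the root. -/
def vertexMarkovOnS1 [MeasurableSpace M] (d : ℕ) (μ : Measure (TdVertex d → M)) : Prop :=
  ∀ y : TdVertex d → M,
    μ (cylEvent (SrSet d 1) y) * (μ (cylEvent ({rootTd d} : Set (TdVertex d)) y)) ^ (d - 1)
      = ∏ i ∈ Finset.Icc 1 d,
          μ (cylEvent {v : TdVertex d | v = rootTd d ∨ v.1 = [i]} y)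


/-! ### The randomly labeled rooted colored graph associated to a finite colored graph

Given a finite colored graph `(G,f)` and a vertex `v`, the associated randomly labeled rooted
colored graph is obtained by a breadth-first search exploration of the connected component of
`v` started at `v`, ties between vertices being broken uniformly at random.  We implement the
uniformly random tie-breaking by a uniformly random priority permutation `σ`. -/

variable {M : Type*} {n : ℕ}

/-- The `k`-th layer of the breadth-first search of `G` started at `v`, ordered according to
the position of the parents in the previous layer, ties being broken by the priority `σ`. -/
def bfsLayer (G : SimpleGraph (Fin n)) (v : Fin n) (σ : Equiv.Perm (Fin n)) :
    ℕ → List (Fin n)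
  | 0 => [v]
  | (k + 1) =>
    let prev := bfsLayer G v σ k
    let key : Fin n → ℕ := fun w =>
      (prev.idxOf (((prev.find? (fun u => decide (G.Adj u w))).getD v))) * n + (σ w : ℕ)
    ((List.finRange n).filter
        (fun w => decide (G.Reachable v w ∧ G.dist v w = k + 1))).mergeSort
      (fun a b => key a ≤ key b)

/-- The breadth-first-search label of the vertex `w` lying in layer `k` of the exploration of
`G` started at `v` with tie-breaking priority `σ`. -/
def bfsPathAux (G : SimpleGraph (Fin n)) (v : Fin n) (σ : Equiv.Perm (Fin n)) :
    ℕ → Fin n → Option (List ℕ)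
  | 0, w => if w = v then some [] else none
  | (k + 1), w =>
    match (bfsLayer G v σ k).find? (fun u => decide (G.Adj u w)) with
    | none => none
    | some p =>
      let L := bfsLayer G v σ (k + 1)
      let j := 1 + ((L.takeWhile (fun w' => w' ≠ w)).filter
        (fun w' => (bfsLayer G v σ k).find? (fun u => decide (G.Adj u w')) = some p)).length
      (bfsPathAux G v σ k p).map (fun pl => j :: pl)

/-- The breadth-first-search label of the vertex `w` in the exploration of the connected
component of `v` in `G`, with tie-breaking priority `σ` (`none` if `w` is not in the component
of `v`). -/
def bfsPath (G : SimpleGraph (Fin n)) (v : Fin n) (σ : Equiv.Perm (Fin n)) (w : Fin n) :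
    Option (List ℕ) :=
  if G.Reachable v w then bfsPathAux G v σ (G.dist v w) w else none

/-- The rooted colored graph obtained from the colored graph `(G,f)` by the breadth-first
search exploration of the connected component of `v` rooted at `v`, with tie-breaking
priority `σ`. -/
def bfsRCG (G : SimpleGraph (Fin n)) (f : Fin n → M) (v : Fin n) (σ : Equiv.Perm (Fin n)) :
    RCG M where
  col l := if h : ∃ w, bfsPath G v σ w = some l then some (f h.choose) else none
  adj p :=
    if (∃ w₁ w₂, bfsPath G v σ w₁ = some p.1 ∧ bfsPath G v σ w₂ = some p.2 ∧ G.Adj w₁ w₂)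
    then true else false

/-- `distr_{G,v}(f)`: the law of the randomly labeled rooted colored graph obtained from the
connected component of `v` in the colored graph `(G,f)`, rooted at `v`. -/
def distrAt (G : SimpleGraph (Fin n)) (f : Fin n → M) (v : Fin n) : Measure (RCG M) :=
  ((Nat.factorial n : ℝ≥0∞))⁻¹ •
    ∑ σ : Equiv.Perm (Fin n), Measure.dirac (bfsRCG G f v σ)

/-- `distr_G(f) = (1/|V|) ∑_{v ∈ V} distr_{G,v}(f)`. -/
def distrG (G : SimpleGraph (Fin n)) (f : Fin n → M) : Measure (RCG M) :=
  ((n : ℝ≥0∞))⁻¹ • ∑ v : Fin n, distrAt G f v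

/-! ### Random regular graphs -/

/-- The set `𝓖_n(d)` of simple `d`-regular graphs on the vertex set `{1, …, n}`. -/
def regularGraphs (d n : ℕ) : Set (SimpleGraph (Fin n)) :=
  {G | ∀ v, (G.neighborSet v).ncard = d}

/-- The probability that a uniformly distributed random `d`-regular graph `G_n` on `n`
vertices belongs to `A`. -/
def PrG (d n : ℕ) (A : Set (SimpleGraph (Fin n))) : ℝ :=
  ((regularGraphs d n ∩ A).ncard : ℝ) / ((regularGraphs d n).ncard : ℝ)

/-- The expectation of `F(G_n)` for a uniformly distributed random `d`-regular graph `G_n`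
on `n` vertices. -/
def ExG (d n : ℕ) (F : SimpleGraph (Fin n) → ℝ) : ℝ :=
  (∑ᶠ G ∈ regularGraphs d n, F G) / ((regularGraphs d n).ncard : ℝ)

/-- The integers `n` for which the set of simple `d`-regular graphs on `n` vertices is
non-empty: `n ≥ d + 1` and `nd` even.  Limits `n → ∞` are taken along this set. -/
def goodN (d : ℕ) : Set ℕ := {n | d + 1 ≤ n ∧ Even (n * d)}

/-- The filter `n → ∞` along `{n : n ≥ d+1, nd even}`. -/
def goodFilter (d : ℕ) : Filter ℕ := Filter.atTop ⊓ Filter.principal (goodN d)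

/-! ### The embedding of invariant processes into rooted colored graphs -/

/-- The rooted colored graph `(T_d, x, o)` associated to a coloring `x` of `T_d` (the
canonical labeling of `T_d` is a breadth-first-search labeling; for an invariant process the
resulting law is that of the randomly labeled rooted colored graph). -/
def iotaTd (d : ℕ) (x : TdVertex d → M) : RCG M where
  col l := if h : ValidTd d l then some (x ⟨l, h⟩) else none
  adj p :=
    if (ValidTd d p.1 ∧ ValidTd d p.2 ∧ ((∃ i, p.2 = i :: p.1) ∨ (∃ i, p.1 = i :: p.2)))
    then true else false

/-- The law, as a probability measure on rooted colored graphs, of the randomly labeled rooted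
colored tree `(T_d, X, o)` where `X` has law `μ`. -/
def lawTd (d : ℕ) [MeasurableSpace M] (μ : Measure (TdVertex d → M)) : Measure (RCG M) :=
  μ.map (iotaTd d)

/-! ### Micro-state (sofic) entropy -/

/-- `𝓕_G(μ,r,ε)`: the set of colorings `f` of `G` whose radius-`r` local statistics are
`ε`-close (in the Lévy-Prokhorov distance, which generates the weak topology) to the
radius-`r` restriction of `μ`. -/
def FSet (d : ℕ) [MeasurableSpace M] (μ : Measure (TdVertex d → M)) (r : ℕ) (ε : ℝ)
    (G : SimpleGraph (Fin n)) : Set (Fin n → M) :=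
  {f | levyProkhorovDist ((distrG G f).map (resS r)) ((lawTd d μ).map (resS r)) ≤ ε}

/-- `H_{G}(μ,r,ε) = (1/n) log |𝓕_G(μ,r,ε)| ∈ {-∞} ∪ [0,∞)`. -/
def HG (d : ℕ) [MeasurableSpace M] (μ : Measure (TdVertex d → M)) (r : ℕ) (ε : ℝ)
    (G : SimpleGraph (Fin n)) : EReal :=
  if FSet d μ r ε G = ∅ then ⊥
  else ((Real.log ((FSet d μ r ε G).ncard) / n : ℝ) : EReal)

/-- `h_n(μ,r,ε,α)`: the `α`-quantile
`sup { h ∈ {-∞} ∪ [0,∞) : ℙ(H_{G_n}(μ,r,ε) ≥ h) ≥ α }`. -/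
def hquant (d : ℕ) [MeasurableSpace M] (μ : Measure (TdVertex d → M)) (r : ℕ) (ε : ℝ)
    (α : ℝ) (n : ℕ) : EReal :=
  sSup {h : EReal | (h = ⊥ ∨ 0 ≤ h) ∧
    α ≤ PrG d n {G : SimpleGraph (Fin n) | h ≤ HG d μ r ε G}}

/-- The upper entropy `h̄(μ,r,α) = lim_{ε → 0} limsup_n h_n(μ,r,ε,α)` (the limit over `ε`
of a quantity non-decreasing in `ε`, i.e. the infimum over `ε > 0`). -/
def hbarA (d : ℕ) [MeasurableSpace M] (μ : Measure (TdVertex d → M)) (r : ℕ) (α : ℝ) :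
    EReal :=
  ⨅ ε : {e : ℝ // 0 < e}, (goodFilter d).limsup (fun n => hquant d μ r ε.1 α n)

/-- The lower entropy `h̲(μ,r,α) = lim_{ε → 0} liminf_n h_n(μ,r,ε,α)`. -/
def hlowA (d : ℕ) [MeasurableSpace M] (μ : Measure (TdVertex d → M)) (r : ℕ) (α : ℝ) :
    EReal :=
  ⨅ ε : {e : ℝ // 0 < e}, (goodFilter d).liminf (fun n => hquant d μ r ε.1 α n)

/-- `h̄(μ,r)`: the common value of `h̄(μ,r,α)`, `0 < α < 1`. -/
def hbarR (d : ℕ) [MeasurableSpace M] (μ : Measure (TdVertex d → M)) (r : ℕ) : EReal :=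
  hbarA d μ r (1 / 2)

/-- `h̲(μ,r)`: the common value of `h̲(μ,r,α)`, `0 < α < 1`. -/
def hlowR (d : ℕ) [MeasurableSpace M] (μ : Measure (TdVertex d → M)) (r : ℕ) : EReal :=
  hlowA d μ r (1 / 2)

/-- The upper sofic entropy `h̄(μ) = lim_{r → ∞} h̄(μ,r)` (the limit of a non-increasing
sequence, i.e. the infimum over `r`). -/
def hbar (d : ℕ) [MeasurableSpace M] (μ : Measure (TdVertex d → M)) : EReal :=
  ⨅ r : ℕ, hbarR d μ r

/-- The lower sofic entropy `h̲(μ) = lim_{r → ∞} h̲(μ,r)`. -/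
def hlow (d : ℕ) [MeasurableSpace M] (μ : Measure (TdVertex d → M)) : EReal :=
  ⨅ r : ℕ, hlowR d μ r

/-! ### Typical processes -/

/-- The probability that the random `d`-regular graph `G_n` admits a coloring whose local
statistics are `ε`-close to `μ`. -/
def typicalPr (d : ℕ) [MeasurableSpace M] (μ : Measure (TdVertex d → M)) (ε : ℝ) (n : ℕ) :
    ℝ :=
  PrG d n {G : SimpleGraph (Fin n) |
    ∃ f : Fin n → M, levyProkhorovDist (distrG G f) (lawTd d μ) ≤ ε}

/-- `μ ∈ I_d(M)` is weakly typical if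
`lim_{ε → 0} limsup_{n → ∞} ℙ(∃ f : d(distr_{G_n}(f), μ) ≤ ε) = 1`. -/
def WeaklyTypical (d : ℕ) [MeasurableSpace M] (μ : Measure (TdVertex d → M)) : Prop :=
  Tendsto (fun ε => (goodFilter d).limsup (fun n => typicalPr d μ ε n))
    (nhdsWithin 0 (Set.Ioi 0)) (nhds 1)

/-- `μ ∈ I_d(M)` is strongly typical if
`lim_{ε → 0} lim_{n → ∞} ℙ(∃ f : d(distr_{G_n}(f), μ) ≤ ε) = 1` (in particular the inner
limits along `n → ∞` exist). -/
def StronglyTypical (d : ℕ) [MeasurableSpace M] (μ : Measure (TdVertex d → M)) : Prop :=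
  ∃ L : ℝ → ℝ,
    (∀ ε : ℝ, 0 < ε → Tendsto (fun n => typicalPr d μ ε n) (goodFilter d) (nhds (L ε))) ∧
    Tendsto L (nhdsWithin 0 (Set.Ioi 0)) (nhds 1)


/-! ### Processes on balls of `T_d` and the sets `I_{d,r}(M)`, `I_e(M)` -/

/-- The ball `S_r` of `T_d` as an induced subgraph. -/
def SrGraph (d r : ℕ) : SimpleGraph ↥(SrSet d r) := (TdGraph d).induce (SrSet d r)

/-- The set `E_r` of `T_d` as an induced subgraph. -/
def ErGraph (d r : ℕ) : SimpleGraph ↥(ErSet d r) := (TdGraph d).induce (ErSet d r)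

lemma root_mem_Er (d r : ℕ) (hr : 1 ≤ r) : rootTd d ∈ ErSet d r := by
  left; simpa [rootTd] using hr

lemma node1_mem_Er (d r : ℕ) (hr : 1 ≤ r) : node1 d ∈ ErSet d r := by
  by_cases h : 1 ≤ d
  · right
    constructor <;> simp [node1, h, List.getLast?, hr]
  · simpa [node1, h] using root_mem_Er d r hr

variable {M : Type*}

/-- The restriction to `E_r ⊆ S_r` of a probability measure on `M^{S_r}`. -/
def restrictErOfSr [MeasurableSpace M] (d r : ℕ) (p : Measure (↥(SrSet d r) → M)) :
    Measure (↥(ErSet d r) → M) :=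
  p.map (fun x => fun v : ↥(ErSet d r) => x ⟨v.1, ErSet_subset_SrSet d r v.2⟩)

/-- `I_{d,r}(M)`: the set of probability measures on `M^{S_r}` which are invariant under the
automorphisms of `S_r` and whose restriction to `E_r` is invariant under switching the two
sides of the edge `{o,1}`. -/
def IdrMeas (d r : ℕ) (M : Type*) [MeasurableSpace M] :
    Set (Measure (↥(SrSet d r) → M)) :=
  {p | IsProbabilityMeasure p ∧
    (∀ φ : SrGraph d r ≃g SrGraph d r, p.map (fun x => fun v => x (φ v)) = p) ∧
    (∀ ψ : ErGraph d r ≃g ErGraph d r,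
      (∀ hv : rootTd d ∈ ErSet d r, ((ψ ⟨rootTd d, hv⟩ : ↥(ErSet d r)) : TdVertex d) = node1 d) →
      (restrictErOfSr d r p).map (fun x => fun v => x (ψ v)) = restrictErOfSr d r p)}

/-- The annealed entropy `Σ(p) = H(X_{S_r}) - (d/2) H(X_{E_r})` of `p ∈ I_{d,r}(M)`. -/
def SigmaP [MeasurableSpace M] (d r : ℕ) (p : Measure (↥(SrSet d r) → M)) : ℝ :=
  shannon p - (d / 2 : ℝ) * shannon (restrictErOfSr d r p)

/-- The involution of `E_1 = {o, 1}` switching the two sides of the edge `{o,1}`. -/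
def swapE1 (d : ℕ) : ↥(ErSet d 1) → ↥(ErSet d 1) := fun v =>
  if (v : TdVertex d) = rootTd d then ⟨node1 d, node1_mem_Er d 1 le_rfl⟩
  else ⟨rootTd d, root_mem_Er d 1 le_rfl⟩

/-- `I_e(M)`: the set of probability measures on `M^{E_1}` invariant under switching the two
sides of the edge `{o,1}`. -/
def IeMeas (d : ℕ) (M : Type*) [MeasurableSpace M] : Set (Measure (↥(ErSet d 1) → M)) :=
  {p | IsProbabilityMeasure p ∧ p.map (fun x => fun v => x (swapE1 d v)) = p}

/-- The annealed entropy `Σ(p) = (d/2) H(X_{E_1}) - (d-1) H(X_o)` of `p ∈ I_e(M)`. -/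
def SigmaPe [MeasurableSpace M] (d : ℕ) (p : Measure (↥(ErSet d 1) → M)) : ℝ :=
  (d / 2 : ℝ) * shannon p
    - ((d : ℝ) - 1) * shannon (p.map (fun x => x ⟨rootTd d, root_mem_Er d 1 le_rfl⟩))

/-! ### Factor graphs: functions of rooted unlabeled colored graphs of radius `r` -/

/-- The vertex set of a rooted colored graph. -/
def vertsOf (g : RCG M) : Set (List ℕ) := {l | g.col l ≠ none}

/-- An isomorphism of rooted colored graphs (a color- and adjacency-preserving bijection of
the vertex sets mapping root to root). -/
def RCGRootedIso (g g' : RCG M) : Prop :=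
  ∃ e : ↥(vertsOf g) ≃ ↥(vertsOf g'),
    (∀ v, g'.col ((e v) : List ℕ) = g.col (v : List ℕ)) ∧
    (∀ v w, g'.adj (((e v) : List ℕ), ((e w) : List ℕ)) = g.adj ((v : List ℕ), (w : List ℕ))) ∧
    (∀ h : [] ∈ vertsOf g, ∀ _ : [] ∈ vertsOf g', ((e ⟨[], h⟩) : List ℕ) = [])

/-- A function on rooted unlabeled colored graphs of radius `r`: a function of rooted colored
graphs which only depends on the isomorphism class of the ball of radius `r` around the
root. -/
def IsRadiusRFn (r : ℕ) (ψ : RCG M → ℝ) : Prop :=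
  ∀ g g' : RCG M, RCGRootedIso (resS r g) (resS r g') → ψ g = ψ g'

/-- The value `ψ((G,f,v)_r)` of `ψ` at the rooted unlabeled colored graph given by the ball of
radius `r` around `v` in `(G,f)` (computed as the average over the random labelings, which is
the constant value of `ψ` on them when `ψ` is a function of the unlabeled graph). -/
def psiAt {n : ℕ} (G : SimpleGraph (Fin n)) (f : Fin n → M) (v : Fin n) (ψ : RCG M → ℝ) :
    ℝ :=
  ∫ g, ψ g ∂(distrAt G f v)

/-- The partition function `Z_G = ∑_f ∏_v exp(ψ((G,f,v)_r))` of the factor model `ψ`. -/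
def ZG {n : ℕ} [Fintype M] (G : SimpleGraph (Fin n)) (ψ : RCG M → ℝ) : ℝ :=
  ∑ f : Fin n → M, Real.exp (∑ v : Fin n, psiAt G f v ψ)

/-- The ground-state energy `L_G = max_f ∑_v ψ((G,f,v)_r)`. -/
def LG {n : ℕ} (G : SimpleGraph (Fin n)) (ψ : RCG M → ℝ) : ℝ :=
  sSup {x : ℝ | ∃ f : Fin n → M, x = ∑ v : Fin n, psiAt G f v ψ}

/-- The canonical rooted colored graph associated to a coloring of the ball `S_r` of `T_d`. -/
def iotaSr (d r : ℕ) (x : ↥(SrSet d r) → M) : RCG M where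
  col l := if h : ValidTd d l ∧ l.length ≤ r then some (x ⟨⟨l, h.1⟩, h.2⟩) else none
  adj p := if (ValidTd d p.1 ∧ ValidTd d p.2 ∧ p.1.length ≤ r ∧ p.2.length ≤ r ∧
      ((∃ i, p.2 = i :: p.1) ∨ (∃ i, p.1 = i :: p.2))) then true else false

/-- `⟨p, ψ⟩ = E[ψ(X)]` where `X` has law `p ∈ I_{d,r}(M)`. -/
def pairing [MeasurableSpace M] (d r : ℕ) (p : Measure (↥(SrSet d r) → M))
    (ψ : RCG M → ℝ) : ℝ :=
  ∫ x, ψ (iotaSr d r x) ∂p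

/-! ### Annealed quantities for random regular graphs -/

/-- `log` with the convention `log 0 = -∞`, with values in the extended reals. -/
def elog (x : ℝ) : EReal := if x ≤ 0 then ⊥ else ((Real.log x : ℝ) : EReal)

/-- The set `𝓖_n(μ,r,ε)` of pairs `(G,f)` of a `d`-regular graph together with a coloring
whose radius-`r` local statistics are `ε`-close to `μ_r`. -/
def GnPairs (d : ℕ) [MeasurableSpace M] (μ : Measure (TdVertex d → M)) (r : ℕ) (ε : ℝ)
    (n : ℕ) : Set (SimpleGraph (Fin n) × (Fin n → M)) :=
  {Gf | Gf.1 ∈ regularGraphs d n ∧ Gf.2 ∈ FSet d μ r ε Gf.1}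

/-- The annealed entropy
`Σ_n(μ,r,ε) = (1/n) (log |𝓖_n(μ,r,ε)| - log |𝓖_n(d)|) = (1/n) log E |𝓕_{G_n}(μ,r,ε)|`. -/
def SigmaN (d : ℕ) [MeasurableSpace M] (μ : Measure (TdVertex d → M)) (r : ℕ) (ε : ℝ)
    (n : ℕ) : EReal :=
  (((n : ℝ)⁻¹ : ℝ) : EReal) *
    elog (((GnPairs d μ r ε n).ncard : ℝ) / ((regularGraphs d n).ncard : ℝ))

/-- The relaxed partition function `Z_G(β) = ∑_f exp(-nβ d(distr_G(f)_r, μ_r))`. -/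
def ZGbeta (d : ℕ) [MeasurableSpace M] {n : ℕ} [Fintype M] (μ : Measure (TdVertex d → M))
    (r : ℕ) (β : ℝ) (G : SimpleGraph (Fin n)) : ℝ :=
  ∑ f : Fin n → M, Real.exp (-(n : ℝ) * β *
    levyProkhorovDist ((distrG G f).map (resS r)) ((lawTd d μ).map (resS r)))


/-! ### Processes on unimodular Galton-Watson trees

A colored rooted tree `(T, X, o)` with `T` a subtree of the label set, rooted at `[]` and
with the children of a vertex `v` labeled `1 :: v, …, N_v :: v`, is encoded as a rooted
colored graph in `RCG M`. -/

/-- `g` is a canonically labeled colored rooted tree. -/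
def IsCanonTree (g : RCG M) : Prop :=
  g.col [] ≠ none ∧
  (∀ l : List ℕ, g.col l ≠ none → g.col l.tail ≠ none) ∧
  (∀ (v : List ℕ) (i : ℕ), 1 ≤ i → g.col ((i + 1) :: v) ≠ none → g.col (i :: v) ≠ none) ∧
  (∀ v : List ℕ, g.col (0 :: v) = none) ∧
  (∀ p : List ℕ × List ℕ, g.adj p = true ↔
    (g.col p.1 ≠ none ∧ g.col p.2 ≠ none ∧
      ((∃ i, p.2 = i :: p.1) ∨ (∃ i, p.1 = i :: p.2))))

/-- A finite canonically labeled tree. -/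
def IsFinTree (t : Finset (List ℕ)) : Prop :=
  [] ∈ t ∧ (∀ l ∈ t, l.tail ∈ t) ∧
  (∀ (v : List ℕ) (i : ℕ), 1 ≤ i → ((i + 1) :: v) ∈ t → (i :: v) ∈ t) ∧
  (∀ v : List ℕ, (0 :: v) ∉ t)

/-- The number of children of the vertex `v` in the finite tree `t`. -/
def childCountF (t : Finset (List ℕ)) (v : List ℕ) : ℕ :=
  (t.filter (fun w => w ≠ [] ∧ w.tail = v)).card

/-- The size-biased version `π̂(k) = (k+1) π(k+1) / d` of the offspring distribution `π`. -/
def sizeBiased (π : ℕ → ℝ) (dd : ℝ) (k : ℕ) : ℝ := (k + 1 : ℝ) * π (k + 1) / dd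

/-- The probability that the unimodular Galton-Watson tree with degree distribution `π`,
truncated at depth `k`, equals the finite tree `t`. -/
def treeWeight (π : ℕ → ℝ) (dd : ℝ) (k : ℕ) (t : Finset (List ℕ)) : ℝ :=
  π (childCountF t []) *
    ∏ v ∈ t.filter (fun v => v ≠ [] ∧ v.length < k), sizeBiased π dd (childCountF t v)

/-- The law of the underlying tree is the unimodular Galton-Watson law `UGW(π)`:
all finite-depth truncations have the prescribed distribution. -/
def IsUGWTreeLaw (π : ℕ → ℝ) (dd : ℝ) (μ : Measure (RCG M)) : Prop :=
  ∀ (k : ℕ) (t : Finset (List ℕ)), IsFinTree t → (∀ v ∈ t, v.length ≤ k) →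
    (μ {g | ∀ l : List ℕ, l.length ≤ k → (g.col l ≠ none ↔ l ∈ t)}).toReal
      = treeWeight π dd k t

/-- `e` realizes an isomorphism (not necessarily root-preserving) of the colored graphs `g`
and `g'`. -/
def IsIsoVia (g g' : RCG M) (e : List ℕ → List ℕ) : Prop :=
  Set.BijOn e (vertsOf g) (vertsOf g') ∧
  (∀ l ∈ vertsOf g, g'.col (e l) = g.col l) ∧
  (∀ l ∈ vertsOf g, ∀ l' ∈ vertsOf g, g'.adj (e l, e l') = g.adj (l, l'))

/-- A function on doubly rooted colored graphs, invariant under isomorphisms. -/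
def PairInvariant (F : RCG M → List ℕ → List ℕ → ℝ≥0∞) : Prop :=
  ∀ g g' e, IsIsoVia g g' e → ∀ u ∈ vertsOf g, ∀ v ∈ vertsOf g, F g' (e u) (e v) = F g u v

/-- Unimodularity (the mass-transport principle):
`E ∑_v F(G,o,v) = E ∑_v F(G,v,o)` for all isomorphism-invariant `F ≥ 0`. -/
def Unimodular (μ : Measure (RCG M)) : Prop :=
  ∀ F : RCG M → List ℕ → List ℕ → ℝ≥0∞, PairInvariant F →
    ∫⁻ g, (∑' v : ↥(vertsOf g), F g [] (v : List ℕ)) ∂μ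
      = ∫⁻ g, (∑' v : ↥(vertsOf g), F g (v : List ℕ) []) ∂μ

/-- `I_π(M)`: the laws of invariant (unimodular) processes `(T,X)` with colors in `M` over
the unimodular Galton-Watson tree with degree distribution `π` (of mean `dd`). -/
def IPiMeas (π : ℕ → ℝ) (dd : ℝ) (M : Type*) [MeasurableSpace M] :
    Set (Measure (RCG M)) :=
  {μ | IsProbabilityMeasure μ ∧ μ {g | IsCanonTree g} = 1 ∧ Unimodular μ ∧
    IsUGWTreeLaw π dd μ}

/-- The root degree `deg(o)` of a canonically labeled tree (the number of children of the
root). -/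
def rootDeg (g : RCG M) : ℕ := {i : ℕ | g.col [i] ≠ none}.ncard

/-- The edge-biased law `→μ(⬝) = (1/d) E[deg(o) 1{(T,X,(o,1)) ∈ ⬝}]` on colored edge-rooted
trees (the root edge being `([], [1])`). -/
def vecLaw (dd : ℝ) [MeasurableSpace M] (μ : Measure (RCG M)) : Measure (RCG M) :=
  (ENNReal.ofReal dd)⁻¹ • μ.withDensity (fun g => (rootDeg g : ℝ≥0∞))

/-- Membership in `E_r = B_{r-1}({o,1})` for a vertex of a canonically labeled tree. -/
def inErL (r : ℕ) (l : List ℕ) : Prop :=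
  l.length + 1 ≤ r ∨ (l.getLast? = some 1 ∧ l.length ≤ r)

/-- The restriction of a colored edge-rooted tree to `E_r = B_{r-1}({o,1})`. -/
def resE (r : ℕ) (g : RCG M) : RCG M where
  col l := if inErL r l then g.col l else none
  adj p := if inErL r p.1 ∧ inErL r p.2 then g.adj p else false

/-- The Shannon entropy `H(π)` of the probability mass function `π`. -/
def Hpmf (π : ℕ → ℝ) : ℝ := ∑' k : ℕ, Real.negMulLog (π k)

/-- The annealed entropy `Σ_r(μ) = H(X_{S_r}) - (d/2) H(→X_{E_r}) - H(π)` of an invariant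
process over the unimodular Galton-Watson tree. -/
def SigmaUGW (π : ℕ → ℝ) (dd : ℝ) [MeasurableSpace M] (r : ℕ) (μ : Measure (RCG M)) : ℝ :=
  shannon (μ.map (resS r)) - (dd / 2) * shannon ((vecLaw dd μ).map (resE r)) - Hpmf π

/-- `Σ(μ) = lim_{r → ∞} Σ_r(μ)` (the limit of a non-increasing sequence). -/
def SigmaUGWInf (π : ℕ → ℝ) (dd : ℝ) [MeasurableSpace M] (μ : Measure (RCG M)) : EReal :=
  ⨅ r : ℕ, ((SigmaUGW π dd (r + 1) μ : ℝ) : EReal)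

/-- `Σ_e(X) = (d/2) H(→X_{E_1}) - d H(→X_o) + H(X_o) - H(π)`. -/
def SigmaEUGW (π : ℕ → ℝ) (dd : ℝ) [MeasurableSpace M] (μ : Measure (RCG M)) : ℝ :=
  (dd / 2) * shannon ((vecLaw dd μ).map (resE 1))
    - dd * shannon ((vecLaw dd μ).map (resS 0))
    + shannon (μ.map (resS 0)) - Hpmf π

/-! ### Markov processes on random trees -/

/-- The side of the (potential) edge `{u,w}` containing `u`, among the labels. -/
def sideL (u w : List ℕ) : Set (List ℕ) := {v | treeDist v u < treeDist v w}

/-- `B_{r-1}({u,w})` among the labels. -/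
def edgeBallL (r : ℕ) (u w : List ℕ) : Set (List ℕ) :=
  {v | treeDist v u + 1 ≤ r ∨ treeDist v w + 1 ≤ r}

/-- The event that the tree structure agrees with that of `y` on `S` and that the colored
tree agrees with `y` on `B`. -/
def treeCylEvent (S B : Set (List ℕ)) (y : RCG M) : Set (RCG M) :=
  {g | (∀ l ∈ S, (g.col l ≠ none ↔ y.col l ≠ none)) ∧ (∀ l ∈ B, g.col l = y.col l)}

/-- A random colored tree is `r`-Markov on the ambient set `A` if, conditioned on the tree
and on the value on the `(r-1)`-neighborhood of an edge, the processes on the two sides of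
the edge are independent (conditioning on the tree is expressed through arbitrary finite
windows `S`). -/
def rMarkovTreeOn [MeasurableSpace M] (r : ℕ) (A : Set (List ℕ)) (μ : Measure (RCG M)) :
    Prop :=
  ∀ (u : List ℕ) (i : ℕ), 1 ≤ i → u ∈ A → (i :: u) ∈ A →
    ∀ F₁ F₂ : Finset (List ℕ), ↑F₁ ⊆ sideL u (i :: u) ∩ A → ↑F₂ ⊆ sideL (i :: u) u ∩ A →
    ∀ S : Finset (List ℕ), ↑S ⊆ A → ∀ y : RCG M,
      μ (treeCylEvent ↑S (edgeBallL r u (i :: u) ∩ A) y ∩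
          treeCylEvent ∅ ↑F₁ y ∩ treeCylEvent ∅ ↑F₂ y)
        * μ (treeCylEvent ↑S (edgeBallL r u (i :: u) ∩ A) y)
      = μ (treeCylEvent ↑S (edgeBallL r u (i :: u) ∩ A) y ∩ treeCylEvent ∅ ↑F₁ y)
        * μ (treeCylEvent ↑S (edgeBallL r u (i :: u) ∩ A) y ∩ treeCylEvent ∅ ↑F₂ y)

/-- A random colored tree is `r`-Markov if the above holds with ambient set everything. -/
def rMarkovTree [MeasurableSpace M] (r : ℕ) (μ : Measure (RCG M)) : Prop :=
  rMarkovTreeOn r Set.univ μ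

/-- A random colored tree is vertex-Markov on the ambient set `A` if, conditioned on the tree
and on the value at a vertex, the processes on the pending subtrees of that vertex are
independent. -/
def vertexMarkovTreeOn [MeasurableSpace M] (A : Set (List ℕ)) (μ : Measure (RCG M)) :
    Prop :=
  ∀ v ∈ A, ∀ (k : ℕ) (u : Fin k → List ℕ), Function.Injective u →
    (∀ j, u j ∈ A ∧ ((∃ i, 1 ≤ i ∧ u j = i :: v) ∨ (v ≠ [] ∧ u j = v.tail))) →
    ∀ F : Fin k → Finset (List ℕ), (∀ j, ↑(F j) ⊆ sideL (u j) v ∩ A) →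
    ∀ S : Finset (List ℕ), ↑S ⊆ A → ∀ y : RCG M,
      μ (treeCylEvent ↑S {v} y ∩ ⋂ j, treeCylEvent ∅ ↑(F j) y)
          * (μ (treeCylEvent ↑S {v} y)) ^ (k - 1)
        = ∏ j : Fin k, μ (treeCylEvent ↑S {v} y ∩ treeCylEvent ∅ ↑(F j) y)

/-- A random colored tree is vertex-Markov if the above holds with ambient set everything. -/
def vertexMarkovTree [MeasurableSpace M] (μ : Measure (RCG M)) : Prop :=
  vertexMarkovTreeOn Set.univ μ

/-! ### Random graphs with given degree sequences -/

/-- The set of simple graphs on `{1,…,n}` with degree sequence `dn`. -/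
def degSeqGraphs (n : ℕ) (dn : Fin n → ℕ) : Set (SimpleGraph (Fin n)) :=
  {G | ∀ v, (G.neighborSet v).ncard = dn v}

/-- The probability that a uniform random graph with degree sequence `dn` lies in `A`. -/
def PrD (n : ℕ) (dn : Fin n → ℕ) (A : Set (SimpleGraph (Fin n))) : ℝ :=
  ((degSeqGraphs n dn ∩ A).ncard : ℝ) / ((degSeqGraphs n dn).ncard : ℝ)

/-- `𝓕_G(μ,r,ε)` for a process `μ` over a unimodular Galton-Watson tree. -/
def FSetD [MeasurableSpace M] (μ : Measure (RCG M)) (r : ℕ) (ε : ℝ) {n : ℕ}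
    (G : SimpleGraph (Fin n)) : Set (Fin n → M) :=
  {f | levyProkhorovDist ((distrG G f).map (resS r)) (μ.map (resS r)) ≤ ε}

/-- `H_G(μ,r,ε) = (1/n) log |𝓕_G(μ,r,ε)|`. -/
def HGD [MeasurableSpace M] (μ : Measure (RCG M)) (r : ℕ) (ε : ℝ) {n : ℕ}
    (G : SimpleGraph (Fin n)) : EReal :=
  if FSetD μ r ε G = ∅ then ⊥
  else ((Real.log ((FSetD μ r ε G).ncard) / n : ℝ) : EReal)

/-- The `α`-quantile of `H_{G_n}(μ,r,ε)` for the uniform random graph with degree sequence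
`DN n`. -/
def hquantD [MeasurableSpace M] (DN : (n : ℕ) → Fin n → ℕ) (μ : Measure (RCG M)) (r : ℕ)
    (ε : ℝ) (α : ℝ) (n : ℕ) : EReal :=
  sSup {h : EReal | (h = ⊥ ∨ 0 ≤ h) ∧
    α ≤ PrD n (DN n) {G : SimpleGraph (Fin n) | h ≤ HGD μ r ε G}}

/-- `h̄(μ,r,α)` for the degree-sequence ensemble. -/
def hbarAD [MeasurableSpace M] (DN : (n : ℕ) → Fin n → ℕ) (μ : Measure (RCG M)) (r : ℕ)
    (α : ℝ) : EReal :=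
  ⨅ ε : {e : ℝ // 0 < e}, Filter.atTop.limsup (fun n => hquantD DN μ r ε.1 α n)

/-- `h̲(μ,r,α)` for the degree-sequence ensemble. -/
def hlowAD [MeasurableSpace M] (DN : (n : ℕ) → Fin n → ℕ) (μ : Measure (RCG M)) (r : ℕ)
    (α : ℝ) : EReal :=
  ⨅ ε : {e : ℝ // 0 < e}, Filter.atTop.liminf (fun n => hquantD DN μ r ε.1 α n)

/-- `h̄(μ,r)`: the common value of `h̄(μ,r,α)`, `0 < α < 1`. -/
def hbarRD [MeasurableSpace M] (DN : (n : ℕ) → Fin n → ℕ) (μ : Measure (RCG M)) (r : ℕ) :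
    EReal :=
  hbarAD DN μ r (1 / 2)

/-- `h̲(μ,r)`. -/
def hlowRD [MeasurableSpace M] (DN : (n : ℕ) → Fin n → ℕ) (μ : Measure (RCG M)) (r : ℕ) :
    EReal :=
  hlowAD DN μ r (1 / 2)

/-- The upper sofic entropy `h̄(μ) = lim_{r → ∞} h̄(μ,r)`. -/
def hbarD [MeasurableSpace M] (DN : (n : ℕ) → Fin n → ℕ) (μ : Measure (RCG M)) : EReal :=
  ⨅ r : ℕ, hbarRD DN μ r

/-- The lower sofic entropy `h̲(μ) = lim_{r → ∞} h̲(μ,r)`. -/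
def hlowD [MeasurableSpace M] (DN : (n : ℕ) → Fin n → ℕ) (μ : Measure (RCG M)) : EReal :=
  ⨅ r : ℕ, hlowRD DN μ r

/-- The hypotheses on the degree sequences: uniformly bounded by `Δ`, even sums, and
empirical distributions converging (weakly) to `π`. -/
def GoodDegSeq (π : ℕ → ℝ) (Δ : ℝ) (DN : (n : ℕ) → Fin n → ℕ) : Prop :=
  (∀ n v, (DN n v : ℝ) ≤ Δ) ∧ (∀ n, Even (∑ v : Fin n, DN n v)) ∧
  (∀ k : ℕ, Tendsto (fun n => (((Finset.univ.filter (fun v : Fin n => DN n v = k)).card : ℝ) / n))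
    atTop (nhds (π k)))

/-- The hypotheses on the degree distribution `π`: a probability mass function supported in
`{0,…,Δ}` with mean `dd > 0`. -/
def GoodPmf (π : ℕ → ℝ) (Δ : ℝ) (dd : ℝ) : Prop :=
  (∀ k, 0 ≤ π k) ∧ (∑' k : ℕ, π k) = 1 ∧ (∀ k : ℕ, (Δ : ℝ) < k → π k = 0) ∧
  (∑' k : ℕ, (k : ℝ) * π k) = dd ∧ 0 < dd


/-! ### Couplings -/

/-- `ν ∈ I_d(M × M)` is an invariant coupling of `μ` with itself: both coordinate marginal
processes of `ν` have law `μ`. -/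
def IsInvCoupling (d : ℕ) {M : Type*} [MeasurableSpace M] (μ : Measure (TdVertex d → M))
    (ν : Measure (TdVertex d → M × M)) : Prop :=
  ν ∈ InvMeas d (M × M) ∧ ν.map (fun x => fun v => (x v).1) = μ ∧
    ν.map (fun x => fun v => (x v).2) = μ

/-- The first coordinate marginal of a colored graph with colors in a product set. -/
def rcgFst {M₁ M₂ : Type*} (g : RCG (M₁ × M₂)) : RCG M₁ :=
  ⟨fun l => (g.col l).map Prod.fst, g.adj⟩

/-- The second coordinate marginal of a colored graph with colors in a product set. -/
def rcgSnd {M₁ M₂ : Type*} (g : RCG (M₁ × M₂)) : RCG M₂ :=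
  ⟨fun l => (g.col l).map Prod.snd, g.adj⟩

/-- `ν ∈ I_π(M × M)` is an invariant coupling of `μ ∈ I_π(M)` with itself. -/
def IsInvCouplingUGW (π : ℕ → ℝ) (dd : ℝ) {M : Type*} [MeasurableSpace M]
    (μ : Measure (RCG M)) (ν : Measure (RCG (M × M))) : Prop :=
  ν ∈ IPiMeas π dd (M × M) ∧ ν.map rcgFst = μ ∧ ν.map rcgSnd = μ


/-! ### Labelled and unlabelled branches -/

section Branches

/-- Colored rooted `D`-ary trees of depth `k`. -/
def Br (M : Type) (D : ℕ) : ℕ → Type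
  | 0 => M
  | k + 1 => M × (Fin D → Br M D k)

/-- The finite type structure on `Br M D k`. -/
@[reducible] def Br.fintypeAux (M : Type) [Fintype M] (D : ℕ) : ∀ k, Fintype (Br M D k)
  | 0 => inferInstanceAs (Fintype M)
  | k + 1 =>
    haveI := Br.fintypeAux M D k
    inferInstanceAs (Fintype (M × (Fin D → Br M D k)))

instance (M : Type) [Fintype M] (D k : ℕ) : Fintype (Br M D k) := Br.fintypeAux M D k

variable {M : Type} {D : ℕ}

/-- The branch of depth `k` read off a coloring of the lists. -/
def br (D : ℕ) : ∀ k : ℕ, (List ℕ → M) → Br M D k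
  | 0, Y => Y []
  | k + 1, Y => (Y [], fun i => br D k (fun w => Y (w ++ [i.1 + 1])))

/-- Equality of branches up to permutations of the children of every node. -/
def Eqv : ∀ k : ℕ, Br M D k → Br M D k → Prop
  | 0, b, b' => b = b'
  | k + 1, b, b' => b.1 = b'.1 ∧ ∃ s : Equiv.Perm (Fin D), ∀ i, Eqv k (b.2 i) (b'.2 (s i))

lemma Eqv.refl : ∀ {k : ℕ} (b : Br M D k), Eqv k b b
  | 0, _ => rfl
  | _ + 1, b => ⟨rfl, 1, fun i => Eqv.refl (b.2 i)⟩

lemma Eqv.symm : ∀ {k : ℕ} {b b' : Br M D k}, Eqv k b b' → Eqv k b' b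
  | 0, _, _, h => Eq.symm h
  | _ + 1, _, _, ⟨h, s, hs⟩ => ⟨h.symm, s⁻¹, fun i => by
      have := Eqv.symm (hs (s⁻¹ i))
      simpa using this⟩

lemma Eqv.trans : ∀ {k : ℕ} {a b c : Br M D k}, Eqv k a b → Eqv k b c → Eqv k a c
  | 0, _, _, _, h, h' => Eq.trans h h'
  | _ + 1, _, _, _, ⟨h, s, hs⟩, ⟨h', s', hs'⟩ => ⟨h.trans h', s.trans s', fun i =>
      Eqv.trans (hs i) (hs' (s i))⟩

/-- The setoid of branches up to reordering. -/
def brSetoid (M : Type) (D k : ℕ) : Setoid (Br M D k) :=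
  ⟨Eqv k, fun b => Eqv.refl b, Eqv.symm, Eqv.trans⟩

/-- Branches up to reordering. -/
def UBr (M : Type) (D k : ℕ) : Type := Quotient (brSetoid M D k)

/-- The class of a branch. -/
def ucl {k : ℕ} (b : Br M D k) : UBr M D k := Quotient.mk (brSetoid M D k) b

/-- A representative of a class of branches. -/
def urep {k : ℕ} (u : UBr M D k) : Br M D k := Quotient.out (s := brSetoid M D k) u

@[simp] lemma ucl_urep {k : ℕ} (u : UBr M D k) : ucl (urep u) = u :=
  Quotient.out_eq (s := brSetoid M D k) u

lemma ucl_eq {k : ℕ} {b b' : Br M D k} : ucl b = ucl b' ↔ Eqv k b b' :=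
  Quotient.eq (r := brSetoid M D k)

lemma urep_ucl {k : ℕ} (b : Br M D k) : Eqv k (urep (ucl b)) b :=
  ucl_eq.1 (ucl_urep _)

instance [Fintype M] {k : ℕ} : Fintype (UBr M D k) :=
  Fintype.ofSurjective (ucl : Br M D k → UBr M D k) (fun u => ⟨urep u, ucl_urep u⟩)

/-- The color of the root of a branch. -/
def rootCol : ∀ {k : ℕ}, Br M D k → M
  | 0, b => b
  | _ + 1, b => b.1

/-- Truncation of a branch of depth `k` to depth `j` (meaningful for `j ≤ k`). -/
def cut : ∀ j k : ℕ, Br M D k → Br M D j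
  | 0, _, b => rootCol b
  | j + 1, 0, b => (b, fun _ => cut j 0 b)
  | j + 1, k + 1, b => (b.1, fun i => cut j k (b.2 i))

lemma rootCol_cut : ∀ (j k : ℕ) (b : Br M D k), rootCol (cut j k b) = rootCol b
  | 0, _, _ => rfl
  | _ + 1, 0, _ => rfl
  | _ + 1, _ + 1, _ => rfl

lemma cut_self : ∀ (k : ℕ) (b : Br M D k), cut k k b = b
  | 0, _ => rfl
  | k + 1, b => by
    change (b.1, fun i => cut k k (b.2 i)) = b
    simp only [cut_self k]
    rfl

lemma cut_cut : ∀ (i j k : ℕ) (_ : i ≤ j) (b : Br M D k),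
    cut i j (cut j k b) = cut i k b
  | 0, j, k, _, b => rootCol_cut j k b
  | i + 1, 0, _, h, _ => absurd h (by omega)
  | i + 1, j + 1, 0, h, b => by
    change (b, fun _ => cut i j (cut j 0 b)) = ((b, fun _ => cut i 0 b) : M × (Fin D → Br M D i))
    simp only [cut_cut i j 0 (by omega)]
    rfl
  | i + 1, j + 1, k + 1, h, b => by
    change (b.1, fun t => cut i j (cut j k (b.2 t)))
      = ((b.1, fun t => cut i k (b.2 t)) : M × (Fin D → Br M D i))
    simp only [cut_cut i j k (by omega)]

lemma rootCol_eqv : ∀ {k : ℕ} {b b' : Br M D k}, Eqv k b b' → rootCol b = rootCol b'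
  | 0, _, _, h => h
  | _ + 1, _, _, h => h.1

lemma cut_eqv : ∀ (j k : ℕ) {b b' : Br M D k}, Eqv k b b' → Eqv j (cut j k b) (cut j k b')
  | 0, _, _, _, h => rootCol_eqv h
  | j + 1, 0, b, b', h => by
    obtain rfl : b = b' := h
    exact Eqv.refl _
  | j + 1, k + 1, _, _, ⟨h, s, hs⟩ => ⟨h, s, fun i => cut_eqv j k (hs i)⟩

lemma rootCol_br (k : ℕ) (Y : List ℕ → M) : rootCol (br D k Y) = Y [] := by
  cases k <;> rfl

lemma cut_br : ∀ (j k : ℕ) (_ : j ≤ k) (Y : List ℕ → M), cut j k (br D k Y) = br D j Y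
  | 0, k, _, Y => rootCol_br k Y
  | j + 1, 0, h, _ => absurd h (by omega)
  | j + 1, k + 1, h, Y => by
    change (Y [], fun i : Fin D => cut j k (br D k _)) = (Y [], fun i : Fin D => br D j _)
    simp only [cut_br j k (by omega)]

/-- Lists all of whose entries lie in `{1, …, D}`. -/
def DVal (D : ℕ) (w : List ℕ) : Prop := ∀ i ∈ w, 1 ≤ i ∧ i ≤ D

lemma DVal_append {w w' : List ℕ} : DVal D (w ++ w') ↔ DVal D w ∧ DVal D w' := by
  simp only [DVal, List.mem_append]
  constructor
  · exact fun h => ⟨fun i hi => h i (Or.inl hi), fun i hi => h i (Or.inr hi)⟩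
  · rintro ⟨h, h'⟩ i (hi | hi)
    exacts [h i hi, h' i hi]

lemma DVal_single {i : ℕ} : DVal D [i] ↔ 1 ≤ i ∧ i ≤ D := by simp [DVal]

lemma DVal_cons {i : ℕ} {w : List ℕ} : DVal D (i :: w) ↔ (1 ≤ i ∧ i ≤ D) ∧ DVal D w := by
  simp [DVal]

lemma DVal_nil : DVal D [] := by simp [DVal]

lemma validTd_append_single {w : List ℕ} {i : ℕ} :
    ValidTd (D + 1) (w ++ [i]) ↔ DVal D w ∧ 1 ≤ i ∧ i ≤ D + 1 := by
  simp [ValidTd, DVal]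

lemma validTd_nil {d : ℕ} : ValidTd d [] := by simp [ValidTd]

lemma br_inj_iff : ∀ (k : ℕ) (Y Y' : List ℕ → M),
    br D k Y = br D k Y' ↔ ∀ w, DVal D w → w.length ≤ k → Y w = Y' w
  | 0, Y, Y' => by
    constructor
    · intro h w _ hw
      obtain rfl : w = [] := by simpa using hw
      exact h
    · exact fun h => h [] DVal_nil le_rfl
  | k + 1, Y, Y' => by
    have key : br D (k + 1) Y = br D (k + 1) Y' ↔ Y [] = Y' [] ∧ ∀ i : Fin D,
        br D k (fun w => Y (w ++ [i.1 + 1])) = br D k (fun w => Y' (w ++ [i.1 + 1])) := by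
      refine (Prod.mk.injEq _ _ _ _).to_iff.trans (and_congr Iff.rfl funext_iff)
    rw [key]
    constructor
    · rintro ⟨h0, h⟩ w hw hl
      rcases List.eq_nil_or_concat' w with rfl | ⟨w', i, rfl⟩
      · exact h0
      · rw [DVal_append, DVal_single] at hw
        have := (br_inj_iff k _ _).1 (h ⟨i - 1, by omega⟩) w' hw.1
          (by simp at hl; omega)
        simp only at this
        rwa [Nat.sub_add_cancel hw.2.1] at this
    · intro h
      refine ⟨h [] DVal_nil (by simp), fun i => (br_inj_iff k _ _).2 fun w hw hl => h _ ?_ ?_⟩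
      · rw [DVal_append, DVal_single]
        exact ⟨hw, by omega, i.2⟩
      · simpa using hl

/-- The coloring of the ball of radius `k + 1`, organised by the neighbors of the root. -/
def encL (D k : ℕ) (X : List ℕ → M) : M × (Fin (D + 1) → Br M D k) :=
  (X [], fun i => br D k (fun w => X (w ++ [i.1 + 1])))

lemma encL_inj_iff (k : ℕ) (X X' : List ℕ → M) :
    encL D k X = encL D k X' ↔ ∀ w, ValidTd (D + 1) w → w.length ≤ k + 1 → X w = X' w := by
  unfold encL
  rw [Prod.mk.injEq, funext_iff]
  simp only [br_inj_iff]
  constructor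
  · rintro ⟨h0, h⟩ w hw hl
    rcases List.eq_nil_or_concat' w with rfl | ⟨w', i, rfl⟩
    · exact h0
    · rw [validTd_append_single] at hw
      have := h ⟨i - 1, by omega⟩ w' hw.1 (by simp at hl; omega)
      simp only at this
      rwa [Nat.sub_add_cancel hw.2.1] at this
  · intro h
    refine ⟨h [] validTd_nil (by simp), fun i w hw hl => h _ ?_ ?_⟩
    · rw [validTd_append_single]
      exact ⟨hw, by omega, i.2⟩
    · simpa using hl

/-! ### Rooted automorphisms -/

/-- A permutation of the lists acting as a rooted tree automorphism preserving `V`. -/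
structure IsRAut (V : List ℕ → Prop) (e : Equiv.Perm (List ℕ)) : Prop where
  nil : e [] = []
  cons : ∀ i l, ∃ j, e (i :: l) = j :: e l
  valid : ∀ l, V (e l) ↔ V l

lemma IsRAut.length {V : List ℕ → Prop} {e : Equiv.Perm (List ℕ)} (h : IsRAut V e) :
    ∀ l : List ℕ, (e l).length = l.length
  | [] => by rw [h.nil]
  | i :: l => by
    obtain ⟨j, hj⟩ := h.cons i l
    rw [hj, List.length_cons, List.length_cons, h.length l]

/-- Gluing maps acting on the subtrees below the root. -/
def glueFun (s : ℕ → ℕ) (E : ℕ → List ℕ → List ℕ) (w : List ℕ) : List ℕ :=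
  match w.getLast? with
  | none => []
  | some i => E i w.dropLast ++ [s i]

lemma glueFun_append (s : ℕ → ℕ) (E : ℕ → List ℕ → List ℕ) (w : List ℕ) (i : ℕ) :
    glueFun s E (w ++ [i]) = E i w ++ [s i] := by
  simp [glueFun]

/-- Gluing permutations acting on the subtrees below the root. -/
def gluePerm (s : Equiv.Perm ℕ) (E : ℕ → Equiv.Perm (List ℕ)) : Equiv.Perm (List ℕ) where
  toFun := glueFun s (fun i => E i)
  invFun := glueFun s.symm (fun j => (E (s.symm j)).symm)
  left_inv w := by
    rcases List.eq_nil_or_concat' w with rfl | ⟨w', i, rfl⟩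
    · rfl
    · simp [glueFun_append]
  right_inv w := by
    rcases List.eq_nil_or_concat' w with rfl | ⟨w', i, rfl⟩
    · rfl
    · simp [glueFun_append]

lemma gluePerm_append (s : Equiv.Perm ℕ) (E : ℕ → Equiv.Perm (List ℕ)) (w : List ℕ) (i : ℕ) :
    gluePerm s E (w ++ [i]) = E i w ++ [s i] :=
  glueFun_append _ _ _ _

lemma gluePerm_isRAut {V V' : List ℕ → Prop} {N : ℕ}
    (hV : ∀ w i, V (w ++ [i]) ↔ V' w ∧ 1 ≤ i ∧ i ≤ N) (s : Equiv.Perm ℕ)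
    (hs : ∀ i, (1 ≤ s i ∧ s i ≤ N) ↔ (1 ≤ i ∧ i ≤ N)) (E : ℕ → Equiv.Perm (List ℕ))
    (hE : ∀ i, IsRAut V' (E i)) : IsRAut V (gluePerm s E) where
  nil := rfl
  cons i l := by
    rcases List.eq_nil_or_concat' l with rfl | ⟨w, j, rfl⟩
    · refine ⟨s i, ?_⟩
      have := gluePerm_append s E [] i
      rw [(hE i).nil] at this
      exact this
    · obtain ⟨t, ht⟩ := (hE j).cons i w
      refine ⟨t, ?_⟩
      rw [← List.cons_append, gluePerm_append, gluePerm_append, ht, List.cons_append]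
  valid l := by
    rcases List.eq_nil_or_concat' l with rfl | ⟨w, j, rfl⟩
    · exact Iff.rfl
    · rw [gluePerm_append, hV, hV, (hE j).valid, hs]

lemma isRAut_one (V : List ℕ → Prop) : IsRAut V 1 :=
  ⟨rfl, fun i _ => ⟨i, rfl⟩, fun _ => Iff.rfl⟩

/-- The permutation of `{1, …, N}` induced by a permutation of `Fin N`. -/
def shiftPerm {N : ℕ} (t : Equiv.Perm (Fin N)) : Equiv.Perm ℕ where
  toFun j := if h : 1 ≤ j ∧ j ≤ N then (t ⟨j - 1, by omega⟩ : ℕ) + 1 else j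
  invFun j := if h : 1 ≤ j ∧ j ≤ N then (t.symm ⟨j - 1, by omega⟩ : ℕ) + 1 else j
  left_inv j := by
    by_cases h : 1 ≤ j ∧ j ≤ N
    · have h2 := (t ⟨j - 1, by omega⟩).2
      simp only [h, and_self, dif_pos]
      rw [dif_pos (by omega)]
      simp; omega
    · simp [h]
  right_inv j := by
    by_cases h : 1 ≤ j ∧ j ≤ N
    · have h2 := (t.symm ⟨j - 1, by omega⟩).2
      simp only [h, and_self, dif_pos]
      rw [dif_pos (by omega)]
      simp; omega
    · simp [h]

lemma shiftPerm_succ {N : ℕ} (t : Equiv.Perm (Fin N)) (i : Fin N) :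
    shiftPerm t (i.1 + 1) = (t i).1 + 1 := by
  change (if h : 1 ≤ i.1 + 1 ∧ i.1 + 1 ≤ N then _ else _) = _
  rw [dif_pos (by omega)]
  rfl

lemma shiftPerm_mem {N : ℕ} (t : Equiv.Perm (Fin N)) (i : ℕ) :
    (1 ≤ shiftPerm t i ∧ shiftPerm t i ≤ N) ↔ (1 ≤ i ∧ i ≤ N) := by
  by_cases h : 1 ≤ i ∧ i ≤ N
  · have h2 := shiftPerm_succ t ⟨i - 1, by omega⟩
    simp only [Nat.sub_add_cancel h.1] at h2
    rw [h2]
    have := (t ⟨i - 1, by omega⟩).2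
    omega
  · have : shiftPerm t i = i := dif_neg h
    rw [this]

lemma exists_glue {V : List ℕ → Prop} {N k : ℕ}
    (hV : ∀ w i, V (w ++ [i]) ↔ DVal D w ∧ 1 ≤ i ∧ i ≤ N)
    (ih : ∀ b b' : Br M D k, Eqv k b b' →
      ∃ e, IsRAut (DVal D) e ∧ ∀ Y : List ℕ → M, br D k Y = b → br D k (Y ∘ e) = b')
    (g g' : Fin N → Br M D k) (s : Equiv.Perm (Fin N)) (hs : ∀ i, Eqv k (g i) (g' (s i))) :
    ∃ e, IsRAut V e ∧ ∀ Y : List ℕ → M,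
      (∀ i : Fin N, br D k (fun w => Y (w ++ [i.1 + 1])) = g i) →
      ∀ i : Fin N, br D k (fun w => (Y ∘ e) (w ++ [i.1 + 1])) = g' i := by
  have h1 : ∀ i : ℕ, ∃ e, IsRAut (DVal D) e ∧ ∀ hi : i - 1 < N, ∀ Y : List ℕ → M,
      br D k Y = g (s.symm ⟨i - 1, hi⟩) → br D k (Y ∘ e) = g' ⟨i - 1, hi⟩ := by
    intro i
    by_cases hi : i - 1 < N
    · obtain ⟨e, he, h⟩ := ih (g (s.symm ⟨i - 1, hi⟩)) (g' ⟨i - 1, hi⟩)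
        (by simpa using hs (s.symm ⟨i - 1, hi⟩))
      exact ⟨e, he, fun _ => h⟩
    · exact ⟨1, isRAut_one _, fun h => absurd h hi⟩
  choose E hE hE' using h1
  refine ⟨gluePerm (shiftPerm s.symm) E,
    gluePerm_isRAut hV _ (shiftPerm_mem _) E hE, fun Y hY i => ?_⟩
  simp only [Function.comp_apply, gluePerm_append, shiftPerm_succ]
  exact hE' (i.1 + 1) i.2 (fun w => Y (w ++ [(s.symm i).1 + 1])) (hY (s.symm i))

lemma Eqv.exists_aut : ∀ (k : ℕ) (b b' : Br M D k), Eqv k b b' →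
    ∃ e, IsRAut (DVal D) e ∧ ∀ Y : List ℕ → M, br D k Y = b → br D k (Y ∘ e) = b'
  | 0, b, b', h => ⟨1, isRAut_one _, fun Y hY => hY.trans h⟩
  | k + 1, b, b', ⟨h, s, hs⟩ => by
    obtain ⟨e, he, h'⟩ := exists_glue (V := DVal D)
      (fun w i => by rw [DVal_append, DVal_single]) (Eqv.exists_aut k) b.2 b'.2 s hs
    refine ⟨e, he, fun Y hY => ?_⟩
    have hY0 : Y [] = b.1 := congrArg Prod.fst hY
    have hY1 : (fun i : Fin D => br D k (fun w => Y (w ++ [i.1 + 1]))) = b.2 :=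
      congrArg Prod.snd hY
    refine Prod.ext ?_ (funext fun i => h' Y (fun i => congrFun hY1 i) i)
    change Y (e []) = _
    rw [he.nil, hY0, h]

/-- Equality of colored balls up to rooted automorphisms. -/
def REqv (k : ℕ) (y y' : M × (Fin (D + 1) → Br M D k)) : Prop :=
  y.1 = y'.1 ∧ ∃ s : Equiv.Perm (Fin (D + 1)), ∀ i, Eqv k (y.2 i) (y'.2 (s i))

lemma REqv.exists_aut {k : ℕ} {y y' : M × (Fin (D + 1) → Br M D k)} (h : REqv k y y') :
    ∃ e, IsRAut (ValidTd (D + 1)) e ∧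
      ∀ X : List ℕ → M, encL D k X = y → encL D k (X ∘ e) = y' := by
  obtain ⟨h, s, hs⟩ := h
  obtain ⟨e, he, h'⟩ := exists_glue (D := D) (V := ValidTd (D + 1))
      (fun w i => validTd_append_single) (Eqv.exists_aut k) y.2 y'.2 s hs
  refine ⟨e, he, fun Y hY => ?_⟩
  have hY0 : Y [] = y.1 := congrArg Prod.fst hY
  have hY1 : (fun i : Fin (D + 1) => br D k (fun w => Y (w ++ [i.1 + 1]))) = y.2 :=
    congrArg Prod.snd hY
  refine Prod.ext ?_ (funext fun i => h' Y (fun i => congrFun hY1 i) i)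
  change Y (e []) = _
  rw [he.nil, hY0, h]

lemma REqv.symm {k : ℕ} {y y' : M × (Fin (D + 1) → Br M D k)} (h : REqv k y y') :
    REqv k y' y := by
  obtain ⟨h, s, hs⟩ := h
  exact ⟨h.symm, s⁻¹, fun i => by simpa using (hs (s⁻¹ i)).symm⟩

/-! ### The action on processes on the regular tree -/

/-- Extension of a coloring of `T_d` to all lists. -/
def extX {d : ℕ} (x : TdVertex d → M) (l : List ℕ) : M :=
  if h : ValidTd d l then x ⟨l, h⟩ else x (rootTd d)

lemma extX_of_valid {d : ℕ} (x : TdVertex d → M) {l : List ℕ} (h : ValidTd d l) :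
    extX x l = x ⟨l, h⟩ := dif_pos h

/-- The automorphism of `T_d` induced by a rooted automorphism of the lists. -/
def autTd {d : ℕ} (e : Equiv.Perm (List ℕ)) (he : IsRAut (ValidTd d) e) :
    TdGraph d ≃g TdGraph d where
  toFun v := ⟨e v.1, (he.valid _).2 v.2⟩
  invFun v := ⟨e.symm v.1, by
    have := (he.valid (e.symm v.1)).1
    rw [e.apply_symm_apply] at this
    exact this v.2⟩
  left_inv v := Subtype.ext (e.symm_apply_apply _)
  right_inv v := Subtype.ext (e.apply_symm_apply _)
  map_rel_iff' := by
    have key : ∀ l l' : List ℕ, (∃ i, e l' = i :: e l) ↔ ∃ i, l' = i :: l := by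
      intro l l'
      constructor
      · rintro ⟨i, hi⟩
        cases l' with
        | nil => rw [he.nil] at hi; simp at hi
        | cons j t =>
          obtain ⟨j', hj⟩ := he.cons j t
          rw [hj] at hi
          exact ⟨j, by rw [e.injective (List.cons.inj hi).2]⟩
      · rintro ⟨i, rfl⟩
        exact he.cons i l
    intro v w
    exact or_congr (key _ _) (key _ _)

lemma extX_autTd {d : ℕ} (e : Equiv.Perm (List ℕ)) (he : IsRAut (ValidTd d) e)
    (x : TdVertex d → M) :
    extX (fun v => x (autTd e he v)) = extX x ∘ e := by
  funext l
  simp only [extX, Function.comp_apply]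
  by_cases h : ValidTd d l
  · rw [dif_pos h, dif_pos ((he.valid l).2 h)]
    rfl
  · rw [dif_neg h, dif_neg (fun h' => h ((he.valid l).1 h'))]
    congr 1
    exact Subtype.ext he.nil

/-- Exchange of the root and its first neighbor, on labels with the root-side step first. -/
def swapRev : List ℕ → List ℕ
  | [] => [1]
  | i :: t => if i = 1 then (match t with
      | [] => []
      | j :: u => (j + 1) :: u) else 1 :: (i - 1) :: t

lemma validTd_reverse_cons {i : ℕ} {t : List ℕ} :
    ValidTd (D + 1) (i :: t).reverse ↔ (1 ≤ i ∧ i ≤ D + 1) ∧ DVal D t := by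
  rw [List.reverse_cons, validTd_append_single, and_comm]
  simp [DVal]

lemma swapRev_valid (hD : 1 ≤ D) {t : List ℕ} (h : ValidTd (D + 1) t.reverse) :
    ValidTd (D + 1) (swapRev t).reverse := by
  rcases t with _ | ⟨i, t⟩
  · rw [swapRev, validTd_reverse_cons]
    exact ⟨⟨le_rfl, by omega⟩, DVal_nil⟩
  rw [validTd_reverse_cons] at h
  by_cases hi : i = 1
  · rcases t with _ | ⟨j, u⟩
    · simpa [swapRev, hi] using validTd_nil
    · have h2 := DVal_cons.1 h.2
      simp only [swapRev, hi, if_true]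
      rw [validTd_reverse_cons]
      exact ⟨by omega, h2.2⟩
  · simp only [swapRev, hi, if_false]
    rw [validTd_reverse_cons, DVal_cons]
    exact ⟨by omega, by omega, h.2⟩

lemma swapRev_swapRev {t : List ℕ} (h : ValidTd (D + 1) t.reverse) :
    swapRev (swapRev t) = t := by
  rcases t with _ | ⟨i, t⟩
  · simp [swapRev]
  rw [validTd_reverse_cons] at h
  by_cases hi : i = 1
  · rcases t with _ | ⟨j, u⟩
    · simp [swapRev, hi]
    · have h2 := DVal_cons.1 h.2
      have : j ≠ 0 := by omega
      simp [swapRev, hi, this]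
  · simp only [swapRev, hi, if_false, if_true]
    congr 1
    omega

lemma swapRev_adj {t : List ℕ} {i : ℕ} (h : ValidTd (D + 1) (t ++ [i]).reverse) :
    (∃ j, swapRev (t ++ [i]) = swapRev t ++ [j]) ∨ (∃ j, swapRev t = swapRev (t ++ [i]) ++ [j]) := by
  rcases t with _ | ⟨a, t⟩
  · by_cases hi : i = 1
    · exact Or.inr ⟨1, by simp [swapRev, hi]⟩
    · exact Or.inl ⟨i - 1, by simp [swapRev, hi]⟩
  · left
    by_cases ha : a = 1
    · rcases t with _ | ⟨b, u⟩
      · exact ⟨i + 1, by simp [swapRev, ha]⟩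
      · exact ⟨i, by simp [swapRev, ha]⟩
    · exact ⟨i, by simp [swapRev, ha]⟩

/-- The automorphism of `T_d` exchanging the root and its first neighbor. -/
def swapTd (hD : 1 ≤ D) : TdGraph (D + 1) ≃g TdGraph (D + 1) where
  toFun v := ⟨(swapRev v.1.reverse).reverse, swapRev_valid hD (by simpa using v.2)⟩
  invFun v := ⟨(swapRev v.1.reverse).reverse, swapRev_valid hD (by simpa using v.2)⟩
  left_inv v := Subtype.ext (by
    simp only [List.reverse_reverse]
    rw [swapRev_swapRev (D := D) (by simpa using v.2), List.reverse_reverse])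
  right_inv v := Subtype.ext (by
    simp only [List.reverse_reverse]
    rw [swapRev_swapRev (D := D) (by simpa using v.2), List.reverse_reverse])
  map_rel_iff' := by
    have key : ∀ l l' : List ℕ, ValidTd (D + 1) l' → (∃ i, l' = i :: l) →
        (∃ i, (swapRev l'.reverse).reverse = i :: (swapRev l.reverse).reverse) ∨
        (∃ i, (swapRev l.reverse).reverse = i :: (swapRev l'.reverse).reverse) := by
      rintro l l' hl' ⟨i, rfl⟩
      rw [List.reverse_cons]
      rcases swapRev_adj (D := D) (t := l.reverse) (i := i) (by simpa using hl') with
        ⟨j, hj⟩ | ⟨j, hj⟩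
      · exact Or.inl ⟨j, by rw [hj]; simp⟩
      · exact Or.inr ⟨j, by rw [hj]; simp⟩
    have key2 : ∀ l l' : List ℕ, ValidTd (D + 1) l → ValidTd (D + 1) l' →
        ((∃ i, l' = i :: l) ∨ ∃ i, l = i :: l') →
        (∃ i, (swapRev l'.reverse).reverse = i :: (swapRev l.reverse).reverse) ∨
        (∃ i, (swapRev l.reverse).reverse = i :: (swapRev l'.reverse).reverse) := by
      rintro l l' hl hl' (h | h)
      · exact key l l' hl' h
      · exact (key l' l hl h).symm
    intro v w
    refine ⟨fun h => ?_, fun h => key2 _ _ v.2 w.2 h⟩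
    have h2 := key2 _ _ (swapRev_valid hD (by simpa using v.2))
      (swapRev_valid hD (by simpa using w.2)) h
    simp only [List.reverse_reverse] at h2
    rw [swapRev_swapRev (D := D) (t := v.1.reverse) (by simpa using v.2),
      swapRev_swapRev (D := D) (t := w.1.reverse) (by simpa using w.2), List.reverse_reverse,
      List.reverse_reverse] at h2
    exact h2

/-- Increment of the root-side step of a label. -/
def bump (w : List ℕ) : List ℕ := glueFun (· + 1) (fun _ => id) w

lemma bump_nil : bump [] = [] := rfl

lemma bump_append (w : List ℕ) (i : ℕ) : bump (w ++ [i]) = w ++ [i + 1] :=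
  glueFun_append _ _ _ _

lemma bump_valid {w : List ℕ} (h : DVal D w) : ValidTd (D + 1) (bump w) := by
  rcases List.eq_nil_or_concat' w with rfl | ⟨u, i, rfl⟩
  · exact validTd_nil
  · rw [DVal_append, DVal_single] at h
    rw [bump_append, validTd_append_single]
    exact ⟨h.1, by omega⟩

lemma extX_swapTd_one (hD : 1 ≤ D) (x : TdVertex (D + 1) → M) {w : List ℕ} (h : DVal D w) :
    extX (fun v => x (swapTd hD v)) (w ++ [1]) = extX x (bump w) := by
  have hv : ValidTd (D + 1) (w ++ [1]) := validTd_append_single.2 ⟨h, le_rfl, by omega⟩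
  rw [extX_of_valid _ hv, extX_of_valid _ (bump_valid h)]
  congr 1
  refine Subtype.ext ?_
  change (swapRev (w ++ [1]).reverse).reverse = bump w
  rcases List.eq_nil_or_concat' w with rfl | ⟨u, i, rfl⟩
  · simp [swapRev, bump_nil]
  · rw [bump_append]
    simp [swapRev]

lemma extX_swapTd_bump (hD : 1 ≤ D) (x : TdVertex (D + 1) → M) {w : List ℕ} (h : DVal D w) :
    extX (fun v => x (swapTd hD v)) (bump w) = extX x (w ++ [1]) := by
  have := extX_swapTd_one hD (fun v => x (swapTd hD v)) h
  rw [← this]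
  congr 1
  funext v
  exact congrArg x ((swapTd hD).left_inv v)

/-- The two branches seen from the edge between the root and its first neighbor. -/
def encE (D k : ℕ) (X : List ℕ → M) : Br M D k × Br M D k :=
  (br D k (fun w => X (w ++ [1])), br D k (fun w => X (bump w)))

/-- The edge data read off the data at the root. -/
def edgeOf {k : ℕ} (y : M × (Fin (D + 1) → Br M D k)) : Br M D k × Br M D k :=
  (y.2 0, cut k (k + 1) (y.1, fun j => y.2 j.succ))

lemma edgeOf_encL (k : ℕ) (X : List ℕ → M) : edgeOf (encL D k X) = encE D k X := by
  refine Prod.ext rfl ?_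
  change cut k (k + 1) _ = br D k _
  rw [← cut_br k (k + 1) (by omega)]
  congr 1
  change (X [], fun j : Fin D => br D k (fun w => X (w ++ [j.1 + 1 + 1])))
    = (X [], fun j : Fin D => br D k (fun w => X (bump (w ++ [j.1 + 1]))))
  simp only [bump_append]

lemma encE_swapTd (hD : 1 ≤ D) (k : ℕ) (x : TdVertex (D + 1) → M) :
    encE D k (extX (fun v => x (swapTd hD v))) = (encE D k (extX x)).swap := by
  refine Prod.ext ?_ ?_
  · exact (br_inj_iff _ _ _).2 fun w hw _ => extX_swapTd_one hD x hw
  · exact (br_inj_iff _ _ _).2 fun w hw _ => extX_swapTd_bump hD x hw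

lemma encE_inj_iff (k : ℕ) (x x' : TdVertex (D + 1) → M) (hD : 1 ≤ D) :
    encE D k (extX x) = encE D k (extX x') ↔ ∀ v ∈ ErSet (D + 1) (k + 1), x v = x' v := by
  rw [encE, encE, Prod.mk.injEq, br_inj_iff, br_inj_iff]
  constructor
  · rintro ⟨h1, h2⟩ ⟨l, hl⟩ hv
    rcases List.eq_nil_or_concat' l with rfl | ⟨u, i, rfl⟩
    · have := h2 [] DVal_nil (by simp)
      rwa [bump_nil, extX_of_valid _ hl, extX_of_valid _ hl] at this
    · have hl' := hl
      rw [validTd_append_single] at hl'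
      by_cases hi : i = 1
      · subst hi
        have := h1 u hl'.1 (by
          rcases hv with hv | hv <;> simp at hv <;> omega)
        rwa [extX_of_valid _ hl, extX_of_valid _ hl] at this
      · have hlen : (u ++ [i]).length ≤ k := by
          rcases hv with hv | hv
          · simpa using hv
          · simp [hi] at hv
        obtain ⟨j, rfl⟩ : ∃ j, i = j + 1 := ⟨i - 1, by omega⟩
        have := h2 (u ++ [j]) (DVal_append.2 ⟨hl'.1, DVal_single.2 (by omega)⟩) (by simpa using hlen)
        rwa [bump_append, extX_of_valid _ hl, extX_of_valid _ hl] at this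
  · intro h
    constructor
    · intro w hw hl
      have hv : ValidTd (D + 1) (w ++ [1]) := validTd_append_single.2 ⟨hw, le_rfl, by omega⟩
      rw [extX_of_valid _ hv, extX_of_valid _ hv]
      exact h _ (Or.inr ⟨by simp, by simpa using hl⟩)
    · intro w hw hl
      rw [extX_of_valid _ (bump_valid hw), extX_of_valid _ (bump_valid hw)]
      refine h _ (Or.inl ?_)
      change (bump w).length + 1 ≤ k + 1
      rcases List.eq_nil_or_concat' w with rfl | ⟨u, i, rfl⟩
      · simp [bump_nil]
      · rw [bump_append]
        simpa using hl

end Branches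
/-! ### Entropies of finite observables -/

section Entropy

/-- The entropy of a weight function on a finite set. -/
def Hf {α : Type*} [Fintype α] (p : α → ℝ) : ℝ := ∑ a, Real.negMulLog (p a)

/-- Pushforward of a weight function. -/
def push {α β : Type*} [Fintype α] (u : α → β) (p : α → ℝ) (b : β) : ℝ :=
  ∑ a with u a = b, p a

lemma sum_push_mul {α β : Type*} [Fintype α] [Fintype β] (u : α → β) (p : α → ℝ) (F : β → ℝ) :
    ∑ b, push u p b * F b = ∑ a, p a * F (u a) := by
  rw [← Finset.sum_fiberwise Finset.univ u (fun a => p a * F (u a))]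
  refine Finset.sum_congr rfl fun b _ => ?_
  rw [push, Finset.sum_mul]
  refine Finset.sum_congr rfl fun a ha => ?_
  rw [(Finset.mem_filter.1 ha).2]

lemma push_congr_iff {α β γ : Type*} [Fintype α] {u : α → β} {u' : α → γ} (p : α → ℝ) {b : β}
    {c : γ} (h : ∀ a, u a = b ↔ u' a = c) : push u p b = push u' p c := by
  rw [push, push]
  congr 1
  ext a
  simp [h]

lemma push_push {α β γ : Type*} [Fintype α] [Fintype β] (u : α → β) (v : β → γ) (p : α → ℝ) :
    push v (push u p) = push (v ∘ u) p := by
  funext c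
  simp only [push, Finset.sum_filter]
  have h := sum_push_mul u p (fun b => if v b = c then 1 else 0)
  simpa only [mul_ite, mul_one, mul_zero, push, Finset.sum_filter, Function.comp_apply] using h

lemma sum_push {α β : Type*} [Fintype α] [Fintype β] (u : α → β) (p : α → ℝ) :
    ∑ b, push u p b = ∑ a, p a := by
  simpa using sum_push_mul u p (fun _ => 1)

/-- The fibre of `u` through `a`. -/
def fib {α β : Type*} [Fintype α] (u : α → β) (a : α) : Finset α :=
  Finset.univ.filter fun a' => u a' = u a

lemma mem_fib {α β : Type*} [Fintype α] {u : α → β} {a a' : α} : a' ∈ fib u a ↔ u a' = u a := by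
  simp [fib]

lemma Hf_eq_push {α β : Type*} [Fintype α] [Fintype β] (u : α → β) (p : α → ℝ)
    (hp : ∀ a a', u a = u a' → p a = p a') :
    Hf p = Hf (push u p)
      + ∑ a, p a * Real.log ((fib u a).card : ℝ) := by
  unfold Hf fib
  rw [← Finset.sum_fiberwise Finset.univ u, ← Finset.sum_fiberwise Finset.univ u
    (fun a => p a * _), ← Finset.sum_add_distrib]
  refine Finset.sum_congr rfl fun b _ => ?_
  rcases (Finset.univ.filter fun a => u a = b).eq_empty_or_nonempty with h | ⟨a₀, h₀⟩
  · simp [push, h]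
  have hu : u a₀ = b := (Finset.mem_filter.1 h₀).2
  have hc : ∀ a ∈ Finset.univ.filter (fun a => u a = b), p a = p a₀ := fun a ha =>
    hp a a₀ ((Finset.mem_filter.1 ha).2.trans hu.symm)
  set N := (Finset.univ.filter fun a => u a = b).card with hN
  have hNpos : 0 < N := Finset.card_pos.2 ⟨a₀, h₀⟩
  have h1 : ∑ a with u a = b, Real.negMulLog (p a) = N * Real.negMulLog (p a₀) := by
    rw [Finset.sum_congr rfl (fun a ha => by rw [hc a ha]), Finset.sum_const, nsmul_eq_mul]
  have h2 : push u p b = N * p a₀ := by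
    rw [push, Finset.sum_congr rfl hc, Finset.sum_const, nsmul_eq_mul]
  have h3 : ∑ a with u a = b, p a * Real.log
      ((Finset.univ.filter fun a' => u a' = u a).card : ℝ) = N * (p a₀ * Real.log N) := by
    rw [Finset.sum_congr rfl (fun a ha => by rw [hc a ha, (Finset.mem_filter.1 ha).2]),
      Finset.sum_const, nsmul_eq_mul]
  rw [h1, h2, h3]
  have hN' : (N : ℝ) ≠ 0 := by positivity
  by_cases hz : p a₀ = 0
  · simp [hz]
  · rw [Real.negMulLog, Real.negMulLog, Real.log_mul hN' hz]
    ring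

section Observables

variable {Ω : Type*} [MeasurableSpace Ω] (μ : Measure Ω)

/-- The weight function of an observable. -/
def pmass {α : Type*} (φ : Ω → α) (a : α) : ℝ := μ.real (φ ⁻¹' {a})

lemma pmass_nonneg {α : Type*} (φ : Ω → α) (a : α) : 0 ≤ pmass μ φ a := measureReal_nonneg

lemma push_pmass [IsFiniteMeasure μ] {α β : Type*} [Fintype α] (φ : Ω → α)
    (hφ : ∀ a, MeasurableSet (φ ⁻¹' {a})) (g : α → β) :
    push g (pmass μ φ) = pmass μ (g ∘ φ) := by
  funext b
  have : (g ∘ φ) ⁻¹' {b} = ⋃ a ∈ Finset.univ.filter (fun a => g a = b), φ ⁻¹' {a} := by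
    ext x
    simp
  rw [pmass, this, measureReal_biUnion_finset]
  · rfl
  · intro a _ a' _ h
    exact Disjoint.preimage _ (by simpa using h)
  · exact fun a _ => hφ a

lemma sum_pmass [IsProbabilityMeasure μ] {α : Type*} [Fintype α] (φ : Ω → α)
    (hφ : ∀ a, MeasurableSet (φ ⁻¹' {a})) : ∑ a, pmass μ φ a = 1 := by
  have h := congrFun (push_pmass μ φ hφ (fun _ => ())) ()
  have h2 : pmass μ ((fun _ => ()) ∘ φ) () = 1 := by
    have : ((fun _ => ()) ∘ φ) ⁻¹' {()} = (Set.univ : Set Ω) := by ext; simp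
    rw [pmass, this]
    simp
  rw [h2] at h
  simpa [push] using h

lemma support_negMulLog_subset {γ : Type*} (ψ : Ω → γ) :
    Function.support (fun c => Real.negMulLog (μ.real (ψ ⁻¹' {c}))) ⊆ Set.range ψ := by
  intro c hc
  by_contra hcon
  have : ψ ⁻¹' {c} = ∅ := by
    ext x
    simp only [Set.mem_preimage, Set.mem_singleton_iff, Set.mem_empty_iff_false, iff_false]
    exact fun hx => hcon ⟨x, hx⟩
  simp [this] at hc

lemma tsum_negMulLog_eq {α β : Type*} [Fintype β] (ρ : Ω → α) (φ : Ω → β)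
    (h : ∀ x x', ρ x = ρ x' ↔ φ x = φ x') :
    ∑' a, Real.negMulLog (μ.real (ρ ⁻¹' {a})) = Hf (pmass μ φ) := by
  have hmem : ∀ a : Set.range ρ, ρ a.2.choose = a := fun a => a.2.choose_spec
  have hmem' : ∀ b : Set.range φ, φ b.2.choose = b := fun b => b.2.choose_spec
  let e : Set.range ρ ≃ Set.range φ :=
    { toFun := fun a => ⟨φ a.2.choose, _, rfl⟩
      invFun := fun b => ⟨ρ b.2.choose, _, rfl⟩
      left_inv := fun a => Subtype.ext (by
        refine Eq.trans ?_ (hmem a)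
        exact (h _ _).2 (hmem' ⟨φ a.2.choose, _, rfl⟩))
      right_inv := fun b => Subtype.ext (by
        refine Eq.trans ?_ (hmem' b)
        exact (h _ _).1 (hmem ⟨ρ b.2.choose, _, rfl⟩)) }
  rw [← tsum_subtype_eq_of_support_subset (support_negMulLog_subset μ ρ), Hf,
    ← tsum_fintype (L := .unconditional _)]
  unfold pmass
  rw [← tsum_subtype_eq_of_support_subset (support_negMulLog_subset μ φ), ← e.tsum_eq]
  refine tsum_congr fun a => ?_
  congr 2
  ext x
  simp only [Set.mem_preimage, Set.mem_singleton_iff]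
  rw [← hmem a, h]
  rfl

end Observables

section TreeEntropies

variable {M : Type} {D : ℕ}

/-- The colored ball around the root as an observable. -/
def obsL (D k : ℕ) (x : TdVertex (D + 1) → M) : M × (Fin (D + 1) → Br M D k) :=
  encL D k (extX x)

lemma obsL_inj_iff (k : ℕ) (x x' : TdVertex (D + 1) → M) :
    obsL D k x = obsL D k x' ↔ ∀ v ∈ SrSet (D + 1) (k + 1), x v = x' v := by
  rw [obsL, obsL, encL_inj_iff]
  constructor
  · rintro h ⟨l, hl⟩ hv
    have := h l hl hv
    rwa [extX_of_valid _ hl, extX_of_valid _ hl] at this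
  · intro h l hl hlen
    rw [extX_of_valid _ hl, extX_of_valid _ hl]
    exact h ⟨l, hl⟩ hlen

/-- The pair of branches at the edge between the root and its first neighbor. -/
def obsE (D k : ℕ) (x : TdVertex (D + 1) → M) : Br M D k × Br M D k :=
  encE D k (extX x)

variable [MeasurableSpace M] [DiscreteMeasurableSpace M]

/-- An observable depending on countably many coordinates through their joint equality. -/
lemma measurableSet_preimage_of_coords [Countable M] {d : ℕ} {α : Type*}
    (φ : (TdVertex d → M) → α)
    (S : Set (TdVertex d)) (h : ∀ x x', φ x = φ x' ↔ ∀ v ∈ S, x v = x' v) (a : α) :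
    MeasurableSet (φ ⁻¹' {a}) := by
  rcases (φ ⁻¹' {a}).eq_empty_or_nonempty with he | ⟨x₀, hx₀⟩
  · rw [he]
    exact MeasurableSet.empty
  · have : φ ⁻¹' {a} = ⋂ v ∈ S, (fun x : TdVertex d → M => x v) ⁻¹' {x₀ v} := by
      ext x
      simp only [Set.mem_preimage, Set.mem_singleton_iff, Set.mem_iInter] at hx₀ ⊢
      rw [← hx₀, h]
    rw [this]
    have : Countable (TdVertex d) := inferInstanceAs (Countable {l : List ℕ // ValidTd d l})
    exact MeasurableSet.biInter (Set.to_countable S)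
      (fun v _ => measurable_pi_apply v (MeasurableSet.of_discrete))

lemma shannon_restrictTo [Countable M] {d : ℕ} (μ : Measure (TdVertex d → M))
    {α : Type*} [Fintype α] (φ : (TdVertex d → M) → α)
    (S : Set (TdVertex d)) (h : ∀ x x', φ x = φ x' ↔ ∀ v ∈ S, x v = x' v) :
    shannon (restrictTo S μ) = Hf (pmass μ φ) := by
  have : Countable (TdVertex d) := inferInstanceAs (Countable {l : List ℕ // ValidTd d l})
  rw [← tsum_negMulLog_eq μ (fun x => fun v : S => x v.1) φ]
  · unfold shannon restrictTo
    refine tsum_congr fun a => ?_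
    rw [Measure.map_apply (measurable_pi_lambda _ fun v => measurable_pi_apply v.1)
      (measurableSet_singleton a)]
    rfl
  · intro x x'
    rw [h, funext_iff]
    simp

lemma pmass_comp_aut {d : ℕ} {μ : Measure (TdVertex d → M)} (hμ : μ ∈ InvMeas d M)
    {α : Type*} (φ : (TdVertex d → M) → α) (hφ : ∀ a, MeasurableSet (φ ⁻¹' {a}))
    (T : TdGraph d ≃g TdGraph d) :
    pmass μ (fun x => φ (fun v => x (T v))) = pmass μ φ := by
  funext a
  have h := congrArg (fun ν : Measure (TdVertex d → M) => ν.real (φ ⁻¹' {a})) (hμ.2 T)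
  rw [map_measureReal_apply (measurable_pi_lambda _ fun v => measurable_pi_apply (T v)) (hφ a)] at h
  exact h

lemma pmass_le_of_aut {d : ℕ} {μ : Measure (TdVertex d → M)} (hμ : μ ∈ InvMeas d M)
    {α : Type*} (φ : (TdVertex d → M) → α) (hφ : ∀ a, MeasurableSet (φ ⁻¹' {a}))
    (T : TdGraph d ≃g TdGraph d) {a a' : α}
    (h : ∀ x, φ x = a → φ (fun v => x (T v)) = a') : pmass μ φ a ≤ pmass μ φ a' := by
  have := hμ.1
  rw [← congrFun (pmass_comp_aut hμ φ hφ T) a']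
  exact measureReal_mono (fun x hx => h x hx)

variable [Finite M]

lemma measurableSet_obsL (k : ℕ) (y : M × (Fin (D + 1) → Br M D k)) :
    MeasurableSet (obsL D k ⁻¹' {y}) :=
  measurableSet_preimage_of_coords _ _ (obsL_inj_iff k) y

lemma measurableSet_encE (hD : 1 ≤ D) (k : ℕ) (y : Br M D k × Br M D k) :
    MeasurableSet ((obsE D k) ⁻¹' {y}) :=
  measurableSet_preimage_of_coords _ _ (fun x x' => encE_inj_iff k x x' hD) y

lemma pmass_obsL_REqv {μ : Measure (TdVertex (D + 1) → M)} (hμ : μ ∈ InvMeas (D + 1) M)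
    {k : ℕ} {y y' : M × (Fin (D + 1) → Br M D k)} (h : REqv k y y') :
    pmass μ (obsL D k) y = pmass μ (obsL D k) y' := by
  have key : ∀ {y y' : M × (Fin (D + 1) → Br M D k)}, REqv k y y' →
      pmass μ (obsL D k) y ≤ pmass μ (obsL D k) y' := by
    intro y y' h
    obtain ⟨e, he, h'⟩ := h.exists_aut
    refine pmass_le_of_aut hμ _ (measurableSet_obsL k) (autTd e he) fun x hx => ?_
    rw [obsL, extX_autTd]
    exact h' _ hx
  exact le_antisymm (key h) (key h.symm)

lemma pmass_encE_swap (hD : 1 ≤ D) {μ : Measure (TdVertex (D + 1) → M)}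
    (hμ : μ ∈ InvMeas (D + 1) M) {k : ℕ} (y : Br M D k × Br M D k) :
    pmass μ (obsE D k) y.swap = pmass μ (obsE D k) y := by
  have key : ∀ y : Br M D k × Br M D k, pmass μ (obsE D k) y
      ≤ pmass μ (obsE D k) y.swap := fun y =>
    pmass_le_of_aut hμ _ (measurableSet_encE hD k) (swapTd hD) fun x hx => by
      rw [obsE, encE_swapTd]
      exact congrArg Prod.swap hx
  exact le_antisymm (by simpa using key y.swap) (key y)

lemma pmass_encE_fst (hD : 1 ≤ D) {μ : Measure (TdVertex (D + 1) → M)}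
    (hμ : μ ∈ InvMeas (D + 1) M) {k : ℕ} {b b' : Br M D k} (h : Eqv k b b') (c : Br M D k) :
    pmass μ (obsE D k) (b, c) = pmass μ (obsE D k) (b', c) := by
  have key : ∀ {b b' : Br M D k}, Eqv k b b' → pmass μ (obsE D k) (b, c)
      ≤ pmass μ (obsE D k) (b', c) := by
    intro b b' h
    obtain ⟨e, he, h'⟩ := h.exists_aut
    have hE : IsRAut (ValidTd (D + 1)) (gluePerm 1 (fun i => if i = 1 then e else 1)) :=
      gluePerm_isRAut (fun w i => validTd_append_single) 1 (fun i => Iff.rfl) _ (fun i => by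
        by_cases hi : i = 1
        · simpa [hi] using he
        · simpa [hi] using isRAut_one _)
    refine pmass_le_of_aut hμ _ (measurableSet_encE hD k) (autTd _ hE) fun x hx => ?_
    rw [obsE, encE, Prod.mk.injEq] at hx ⊢
    rw [extX_autTd]
    constructor
    · have := h' _ hx.1
      simpa [Function.comp_def, gluePerm_append] using this
    · rw [← hx.2, br_inj_iff]
      intro w hw _
      rcases List.eq_nil_or_concat' w with rfl | ⟨u, i, rfl⟩
      · rw [bump_nil, Function.comp_apply, hE.nil]
      · rw [DVal_append, DVal_single] at hw
        have : i ≠ 0 := by omega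
        rw [bump_append, Function.comp_apply, gluePerm_append]
        simp [this]
  exact le_antisymm (key h) (key h.symm)

lemma pmass_encE_eqv (hD : 1 ≤ D) {μ : Measure (TdVertex (D + 1) → M)}
    (hμ : μ ∈ InvMeas (D + 1) M) {k : ℕ} {b b' c c' : Br M D k} (h : Eqv k b b')
    (h' : Eqv k c c') :
    pmass μ (obsE D k) (b, c) = pmass μ (obsE D k) (b', c') := by
  rw [pmass_encE_fst hD hμ h, ← pmass_encE_swap hD hμ, Prod.swap_prod_mk,
    pmass_encE_fst hD hμ h', ← pmass_encE_swap hD hμ, Prod.swap_prod_mk]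

variable (M D) in
/-- Vertex types: the color of a vertex and the unlabelled branches behind its ports. -/
abbrev VType (k : ℕ) : Type := M × (Fin (D + 1) → UBr M D k)

/-- The vertex type of a colored ball. -/
def toV {k : ℕ} (y : M × (Fin (D + 1) → Br M D k)) : VType M D k := (y.1, fun i => ucl (y.2 i))

/-- The half-edge type of the port `i` of a vertex: the branch behind it and the branch
seen in the opposite direction. -/
def kap {k : ℕ} (i : Fin (D + 1)) (a : VType M D k) : UBr M D k × UBr M D k :=
  (a.2 i, ucl (cut k (k + 1) ((a.1, fun j => urep (a.2 (i.succAbove j))) : M × (Fin D → Br M D k))))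

/-- The permutation of the remaining ports induced by a permutation of the ports. -/
def restPerm (s : Equiv.Perm (Fin (D + 1))) (i : Fin (D + 1)) : Equiv.Perm (Fin D) :=
  (finSuccAboveEquiv i).trans ((s.subtypeEquiv (fun a => by simp)).trans
    (finSuccAboveEquiv (s i)).symm)

lemma succAbove_restPerm (s : Equiv.Perm (Fin (D + 1))) (i : Fin (D + 1)) (j : Fin D) :
    (s i).succAbove (restPerm s i j) = s (i.succAbove j) := by
  have h := (finSuccAboveEquiv (s i)).apply_symm_apply
    ((s.subtypeEquiv (fun a => by simp) : {x // x ≠ i} ≃ {x // x ≠ s i}) (finSuccAboveEquiv i j))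
  exact congrArg Subtype.val h

lemma kap_perm {k : ℕ} (s : Equiv.Perm (Fin (D + 1))) (i : Fin (D + 1)) (a : VType M D k) :
    kap i (a.1, a.2 ∘ s) = kap (s i) a := by
  refine Prod.ext rfl (ucl_eq.2 (cut_eqv _ _ ⟨rfl, restPerm s i, fun j => ?_⟩))
  simp only [Function.comp_apply, succAbove_restPerm]
  exact Eqv.refl _

lemma kap_toV {k : ℕ} (y : M × (Fin (D + 1) → Br M D k)) :
    kap 0 (toV y) = (ucl (edgeOf y).1, ucl (edgeOf y).2) := by
  refine Prod.ext rfl (ucl_eq.2 (cut_eqv _ _ ⟨rfl, 1, fun j => ?_⟩))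
  exact urep_ucl _

lemma push_perm_invariant {α β : Type*} [Fintype α] (p : α → ℝ) (e : Equiv.Perm α)
    (hp : ∀ a, p (e a) = p a) (u : α → β) : push (u ∘ e) p = push u p := by
  funext b
  simp only [push, Finset.sum_filter]
  rw [← Equiv.sum_comp e (fun a => if u a = b then p a else 0)]
  simp only [hp, Function.comp_apply]

/-- Relabelling of the ports of a vertex type. -/
def portPerm {k : ℕ} (s : Equiv.Perm (Fin (D + 1))) : Equiv.Perm (VType M D k) :=
  (Equiv.refl M).prodCongr (s.symm.arrowCongr (Equiv.refl _))

lemma portPerm_apply {k : ℕ} (s : Equiv.Perm (Fin (D + 1))) (a : VType M D k) :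
    portPerm s a = (a.1, a.2 ∘ s) := rfl

/-- The law of the vertex type of the root. -/
def lawV (D k : ℕ) (μ : Measure (TdVertex (D + 1) → M)) : VType M D k → ℝ :=
  pmass μ (toV ∘ obsL D k)

lemma measurableSet_toV (k : ℕ) (a : VType M D k) :
    MeasurableSet ((toV ∘ obsL D k) ⁻¹' {a}) := by
  have := Fintype.ofFinite M
  have : (toV ∘ obsL D k) ⁻¹' {a} = ⋃ y ∈ (toV ⁻¹' {a} : Set _), obsL D k ⁻¹' {y} := by
    ext x
    simp
  rw [this]
  exact MeasurableSet.biUnion (Set.to_countable _) fun y _ => measurableSet_obsL k y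

end TreeEntropies

section TreeEntropyFormula

variable {M : Type} {D : ℕ} [Fintype M] [MeasurableSpace M] [DiscreteMeasurableSpace M]
  {μ : Measure (TdVertex (D + 1) → M)} {k : ℕ}

lemma lawV_nonneg (a : VType M D k) : 0 ≤ lawV D k μ a := pmass_nonneg _ _ _

lemma sum_lawV (hμ : μ ∈ InvMeas (D + 1) M) : ∑ a, lawV D k μ a = 1 := by
  have := hμ.1
  exact sum_pmass μ _ (measurableSet_toV k)

lemma lawV_eq_push (hμ : μ ∈ InvMeas (D + 1) M) :
    lawV D k μ = push toV (pmass μ (obsL D k)) := by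
  have := hμ.1
  exact (push_pmass μ _ (measurableSet_obsL k) _).symm

lemma pmass_obsL_perm (hμ : μ ∈ InvMeas (D + 1) M) (s : Equiv.Perm (Fin (D + 1)))
    (y : M × (Fin (D + 1) → Br M D k)) :
    pmass μ (obsL D k) (y.1, y.2 ∘ s) = pmass μ (obsL D k) y :=
  pmass_obsL_REqv hμ ⟨rfl, s, fun _ => Eqv.refl _⟩

lemma lawV_portPerm (hμ : μ ∈ InvMeas (D + 1) M) (s : Equiv.Perm (Fin (D + 1)))
    (a : VType M D k) : lawV D k μ (portPerm s a) = lawV D k μ a := by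
  rw [lawV_eq_push hμ]
  let e : Equiv.Perm (M × (Fin (D + 1) → Br M D k)) :=
    (Equiv.refl M).prodCongr (s.symm.arrowCongr (Equiv.refl _))
  have he : ∀ y, toV (e y) = portPerm s (toV y) := fun y => rfl
  rw [← congrFun (push_perm_invariant _ e (fun y => pmass_obsL_perm hμ s y) toV) (portPerm s a)]
  exact push_congr_iff _ fun y => by
    rw [Function.comp_apply, he, (portPerm s).apply_eq_iff_eq]

/-- The law of the half-edge types. -/
def lawK (D k : ℕ) (μ : Measure (TdVertex (D + 1) → M)) : UBr M D k × UBr M D k → ℝ :=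
  push (kap 0) (lawV D k μ)

lemma push_kap (hμ : μ ∈ InvMeas (D + 1) M) (i : Fin (D + 1)) :
    push (kap i) (lawV D k μ) = lawK D k μ := by
  rw [lawK, ← push_perm_invariant _ (portPerm (Equiv.swap 0 i)) (lawV_portPerm hμ _) (kap 0)]
  congr 1
  funext a
  rw [Function.comp_apply, portPerm_apply, kap_perm, Equiv.swap_apply_left]

lemma lawK_eq (hD : 1 ≤ D) (hμ : μ ∈ InvMeas (D + 1) M) :
    lawK D k μ = push (fun b : Br M D k × Br M D k => (ucl b.1, ucl b.2)) (pmass μ (obsE D k)) := by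
  have := hμ.1
  rw [lawK, lawV_eq_push hμ, push_push, push_pmass μ _ (measurableSet_obsL k),
    push_pmass μ _ (measurableSet_encE hD k)]
  congr 1
  funext x
  simp only [Function.comp_apply, kap_toV]
  rw [obsE, ← edgeOf_encL]
  rfl

lemma lawK_swap (hD : 1 ≤ D) (hμ : μ ∈ InvMeas (D + 1) M) (t : UBr M D k × UBr M D k) :
    lawK D k μ t.swap = lawK D k μ t := by
  rw [lawK_eq hD hμ]
  have := push_perm_invariant (pmass μ (obsE D k)) (Equiv.prodComm _ _)
    (fun b => pmass_encE_swap hD hμ b) (fun b : Br M D k × Br M D k => (ucl b.1, ucl b.2))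
  rw [← congrFun this t.swap]
  refine push_congr_iff _ fun b => ?_
  simp only [Function.comp_apply, Equiv.prodComm_apply, Prod.fst_swap, Prod.snd_swap,
    Prod.ext_iff, and_comm]

theorem sigmaR_eq (hD : 1 ≤ D) (hμ : μ ∈ InvMeas (D + 1) M) :
    SigmaR (D + 1) (k + 1) μ = Hf (lawV D k μ) - ((D + 1 : ℝ) / 2) * Hf (lawK D k μ) := by
  have := hμ.1
  set s : Br M D k → ℝ := fun b =>
    Real.log ((Finset.univ.filter fun b' : Br M D k => ucl b' = ucl b).card : ℝ) with hs
  have hpos : ∀ b : Br M D k,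
      ((Finset.univ.filter fun b' : Br M D k => ucl b' = ucl b).card : ℝ) ≠ 0 := fun b => by
    have : 0 < (Finset.univ.filter fun b' : Br M D k => ucl b' = ucl b).card :=
      Finset.card_pos.2 ⟨b, by simp⟩
    positivity
  have hL := Hf_eq_push (toV (M := M) (D := D) (k := k)) (pmass μ (obsL D k)) (by
    intro a a' h
    refine pmass_obsL_REqv hμ ⟨(congrArg Prod.fst h : (toV a).1 = (toV a').1), 1, fun i => ?_⟩
    exact ucl_eq.1 (congrFun (congrArg Prod.snd h : (toV a).2 = (toV a').2) i))
  have hE := Hf_eq_push (fun b : Br M D k × Br M D k => (ucl b.1, ucl b.2)) (pmass μ (obsE D k)) (by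
    intro a a' h
    exact pmass_encE_eqv hD hμ (ucl_eq.1 (Prod.ext_iff.1 h).1) (ucl_eq.1 (Prod.ext_iff.1 h).2))
  have hcL : ∀ y : M × (Fin (D + 1) → Br M D k),
      Real.log ((fib toV y).card : ℝ) = ∑ i, s (y.2 i) := by
    intro y
    have : fib toV y
        = ({y.1} : Finset M) ×ˢ Fintype.piFinset fun i =>
          (Finset.univ.filter fun b' : Br M D k => ucl b' = ucl (y.2 i)) := by
      ext y'
      simp only [mem_fib, Finset.mem_filter, Finset.mem_univ, true_and, Finset.mem_product,
        Fintype.mem_piFinset, Finset.mem_singleton, toV, Prod.ext_iff, funext_iff]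
    rw [this, Finset.card_product, Fintype.card_piFinset, Finset.card_singleton, one_mul,
      Nat.cast_prod, Real.log_prod (fun i _ => hpos _)]
  have hcE : ∀ b : Br M D k × Br M D k,
      Real.log ((fib (fun b : Br M D k × Br M D k => (ucl b.1, ucl b.2)) b).card : ℝ) = s b.1 + s b.2 := by
    intro b
    have : fib (fun b : Br M D k × Br M D k => (ucl b.1, ucl b.2)) b
        = (Finset.univ.filter fun b' : Br M D k => ucl b' = ucl b.1) ×ˢ
          (Finset.univ.filter fun b' : Br M D k => ucl b' = ucl b.2) := by
      ext b'
      simp [mem_fib]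
    rw [this, Finset.card_product, Nat.cast_mul, Real.log_mul (hpos _) (hpos _)]
  have hperm : ∀ i : Fin (D + 1), ∑ y, pmass μ (obsL D k) y * s (y.2 i)
      = ∑ y, pmass μ (obsL D k) y * s (y.2 0) := by
    intro i
    let e : Equiv.Perm (M × (Fin (D + 1) → Br M D k)) :=
      (Equiv.refl M).prodCongr ((Equiv.swap 0 i).symm.arrowCongr (Equiv.refl _))
    rw [← Equiv.sum_comp e]
    refine Finset.sum_congr rfl fun y _ => ?_
    have h1 : pmass μ (obsL D k) (e y) = _ := pmass_obsL_perm hμ (Equiv.swap 0 i) y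
    have h2 : (e y).2 i = y.2 0 := by
      change y.2 (Equiv.swap 0 i i) = _
      rw [Equiv.swap_apply_right]
    rw [h1, h2]
  have hedge : ∑ y, pmass μ (obsL D k) y * s (y.2 0) = ∑ b, pmass μ (obsE D k) b * s b.1 := by
    have h1 : push edgeOf (pmass μ (obsL D k)) = pmass μ (obsE D k) := by
      rw [push_pmass μ _ (measurableSet_obsL k)]
      congr 1
      funext x
      exact edgeOf_encL k _
    rw [← h1, sum_push_mul edgeOf _ (fun b => s b.1)]
    rfl
  have hsw : ∑ b, pmass μ (obsE D k) b * s b.2 = ∑ b, pmass μ (obsE D k) b * s b.1 := by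
    rw [← Equiv.sum_comp (Equiv.prodComm _ _)]
    refine Finset.sum_congr rfl fun b _ => ?_
    rw [Equiv.prodComm_apply, pmass_encE_swap hD hμ, Prod.snd_swap]
  rw [Finset.sum_congr rfl (fun y _ => congrArg (pmass μ (obsL D k) y * ·) (hcL y))] at hL
  simp only [Finset.mul_sum] at hL
  rw [Finset.sum_comm, Finset.sum_congr rfl (fun i _ => (hperm i).trans hedge), Finset.sum_const,
    Finset.card_univ, Fintype.card_fin, nsmul_eq_mul, ← lawV_eq_push hμ] at hL
  rw [Finset.sum_congr rfl (fun y _ => congrArg (pmass μ (obsE D k) y * ·) (hcE y))] at hE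
  simp only [mul_add, Finset.sum_add_distrib] at hE
  rw [hsw, ← lawK_eq hD hμ] at hE
  rw [SigmaR, shannon_restrictTo μ (obsL D k) _ (obsL_inj_iff k),
    shannon_restrictTo μ (obsE D k) _ (fun x x' => encE_inj_iff k x x' hD), hL, hE]
  push_cast
  ring

end TreeEntropyFormula

end Entropy
/-! ### Type classes -/

section TypeClasses

/-- The number of points at which `f` takes the value `b`. -/
def cnt {X K : Type*} [Fintype X] (f : X → K) (b : K) : ℕ := (Finset.univ.filter fun x => f x = b).card

variable {X K : Type*} [Fintype X] [Fintype K]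

lemma sum_comp_eq_cnt (f : X → K) (g : K → ℝ) : ∑ x, g (f x) = ∑ b, (cnt f b : ℝ) * g b := by
  rw [← Finset.sum_fiberwise Finset.univ f]
  refine Finset.sum_congr rfl fun b _ => ?_
  rw [Finset.sum_congr rfl (fun x hx => by rw [(Finset.mem_filter.1 hx).2]), Finset.sum_const,
    nsmul_eq_mul, cnt]

lemma sum_cnt (f : X → K) : ∑ b, cnt f b = Fintype.card X := by
  have h := sum_comp_eq_cnt f (fun _ => 1)
  simp only [Finset.sum_const, Finset.card_univ, nsmul_eq_mul, mul_one] at h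
  exact_mod_cast h.symm

lemma cnt_comp_perm {X K : Type*} [Fintype X] (f : X → K) (s : Equiv.Perm X) (b : K) :
    cnt (f ∘ s) b = cnt f b := by
  unfold cnt
  refine Finset.card_bij (fun x _ => s x) (fun x hx => ?_) (fun x _ y _ h => s.injective h)
    (fun y hy => ⟨s.symm y, ?_, by simp⟩)
  · simpa using hx
  · simpa using hy

lemma exists_perm_of_cnt_eq {f g : X → K} (h : ∀ b, cnt f b = cnt g b) :
    ∃ s : Equiv.Perm X, f ∘ s = g := by
  have : ∀ b, Nonempty ({x // g x = b} ≃ {x // f x = b}) := fun b => by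
    refine ⟨Fintype.equivOfCardEq ?_⟩
    have := h b
    simp only [cnt] at this
    rw [Fintype.card_subtype, Fintype.card_subtype, this]
  have e := fun b => (this b).some
  refine ⟨(Equiv.sigmaFiberEquiv g).symm.trans
    ((Equiv.sigmaCongrRight e).trans (Equiv.sigmaFiberEquiv f)), ?_⟩
  funext x
  simp only [Function.comp_apply, Equiv.trans_apply]
  exact ((e (g x)) ⟨x, rfl⟩).2

lemma card_stabilizer (f : X → K) :
    (Finset.univ.filter fun s : Equiv.Perm X => f ∘ s = f).card = ∏ b, (cnt f b).factorial := by
  have h := DomMulAct.stabilizer_card (f := f)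
  rw [Fintype.card_subtype] at h
  convert h using 3 with b
  rw [cnt, Fintype.card_subtype]

lemma card_perm_comp_eq {f g : X → K} (h : ∀ b, cnt f b = cnt g b) :
    (Finset.univ.filter fun s : Equiv.Perm X => f ∘ s = g).card = ∏ b, (cnt f b).factorial := by
  obtain ⟨s₀, rfl⟩ := exists_perm_of_cnt_eq h
  rw [← card_stabilizer]
  refine Finset.card_bij (fun s _ => s * s₀⁻¹) (fun s hs => ?_)
    (fun x _ y _ h => mul_right_cancel h) (fun y hy => ⟨y * s₀, ?_, by simp⟩)
  · simp only [Finset.mem_filter, Finset.mem_univ, true_and] at hs ⊢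
    rw [Equiv.Perm.coe_mul, ← Function.comp_assoc, hs]
    funext x
    simp
  · simp only [Finset.mem_filter, Finset.mem_univ, true_and] at hy ⊢
    rw [Equiv.Perm.coe_mul, ← Function.comp_assoc, hy]

/-- Double counting over all rearrangements of a function. -/
lemma sum_perm_eq (f : X → K) (φ : (X → K) → ℕ) :
    ∑ s : Equiv.Perm X, φ (f ∘ s)
      = (∏ b, (cnt f b).factorial) * ∑ g : X → K with ∀ b, cnt f b = cnt g b, φ g := by
  rw [← Finset.sum_fiberwise Finset.univ (fun s : Equiv.Perm X => f ∘ s), Finset.sum_filter,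
    Finset.mul_sum]
  refine Finset.sum_congr rfl fun g _ => ?_
  rw [Finset.sum_congr rfl (fun s hs => by rw [(Finset.mem_filter.1 hs).2]), Finset.sum_const,
    smul_eq_mul]
  split_ifs with h
  · rw [card_perm_comp_eq h]
  · rw [mul_zero, mul_eq_zero]
    refine Or.inl (Finset.card_eq_zero.2 (Finset.filter_eq_empty_iff.2 fun s _ hs => h fun b => ?_))
    rw [← hs, cnt_comp_perm]

/-- The functions with the same counts as `f`. -/
def tclass (f : X → K) : Finset (X → K) := Finset.univ.filter fun g => ∀ b, cnt f b = cnt g b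

lemma mem_tclass {f g : X → K} : g ∈ tclass f ↔ ∀ b, cnt f b = cnt g b := by simp [tclass]

lemma card_typeClass (f : X → K) :
    (Fintype.card X).factorial = (∏ b, (cnt f b).factorial) * (tclass f).card := by
  unfold tclass
  have := sum_perm_eq f (fun _ => 1)
  simpa [Fintype.card_perm] using this

lemma exists_cnt_eq (ν : K → ℕ) (h : ∑ b, ν b = Fintype.card X) :
    ∃ f : X → K, ∀ b, cnt f b = ν b := by
  have : Fintype.card X = Fintype.card (Σ b, Fin (ν b)) := by simp [h]
  let e := Fintype.equivOfCardEq this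
  refine ⟨fun x => (e x).1, fun b => ?_⟩
  rw [cnt, ← Fintype.card_subtype]
  rw [Fintype.card_congr (e.subtypeEquiv (q := fun y => y.1 = b) (fun x => Iff.rfl)),
    Fintype.card_congr (Equiv.sigmaSubtype b), Fintype.card_fin]

end TypeClasses

section Factorials

lemma log_factorial_ge (k : ℕ) : k * Real.log k - k ≤ Real.log (k.factorial : ℝ) := by
  rcases Nat.eq_zero_or_pos k with rfl | hk
  · simp
  have h := Real.pow_div_factorial_le_exp (k : ℝ) (Nat.cast_nonneg k) k
  have hk' : (0 : ℝ) < k := by exact_mod_cast hk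
  have hf : (0 : ℝ) < k.factorial := by exact_mod_cast k.factorial_pos
  have := Real.log_le_log (by positivity) h
  rw [Real.log_exp, Real.log_div (by positivity) hf.ne', Real.log_pow] at this
  linarith

lemma log_factorial_le (k : ℕ) :
    Real.log (k.factorial : ℝ) ≤ k * Real.log k - k + (1 + Real.log (k + 1)) := by
  rcases Nat.eq_zero_or_pos k with rfl | hk
  · simp
  have key : Real.log (k.factorial : ℝ) ≤ k * Real.log k - k + (1 + Real.log k) := by
    induction k, hk using Nat.le_induction with
    | base => simp
    | succ k hk ih =>
      have hk' : (0 : ℝ) < k := by exact_mod_cast hk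
      have hf : (0 : ℝ) < k.factorial := by exact_mod_cast k.factorial_pos
      rw [Nat.factorial_succ, Nat.cast_mul, Real.log_mul (by positivity) hf.ne']
      push_cast
      have h1 : Real.log (k / (k + 1 : ℝ)) ≤ k / (k + 1 : ℝ) - 1 :=
        Real.log_le_sub_one_of_pos (by positivity)
      rw [Real.log_div (by positivity) (by positivity)] at h1
      have h2 : (k + 1 : ℝ) * (Real.log k - Real.log (k + 1)) ≤ (k + 1) * (k / (k + 1 : ℝ) - 1) :=
        mul_le_mul_of_nonneg_left h1 (by positivity)
      have h3 : (k + 1 : ℝ) * (k / (k + 1 : ℝ) - 1) = -1 := by field_simp; ring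
      linarith
  have : Real.log k ≤ Real.log (k + 1) :=
    Real.log_le_log (by exact_mod_cast hk) (by linarith)
  linarith

end Factorials
/-! ### Consistent matchings -/

section Multinomial

variable {K : Type*} [Fintype K]

lemma mul_Hf_div (c : K → ℕ) {N : ℕ} (hN : 0 < N) (hc : ∑ b, c b = N) :
    N * Hf (fun b => (c b : ℝ) / N) = N * Real.log N - ∑ b, c b * Real.log (c b) := by
  have hN' : (N : ℝ) ≠ 0 := by positivity
  have hc' : ∑ b, (c b : ℝ) = N := by exact_mod_cast hc
  rw [Hf, Finset.mul_sum, ← hc', Finset.sum_mul, ← Finset.sum_sub_distrib, hc']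
  refine Finset.sum_congr rfl fun b _ => ?_
  rw [Real.negMulLog]
  by_cases h : (c b : ℝ) = 0
  · simp [h]
  · rw [Real.log_div h hN']
    field_simp
    ring

/-- The logarithm of a multinomial coefficient. -/
def mlog (c : K → ℕ) (N : ℕ) : ℝ :=
  Real.log (N.factorial : ℝ) - ∑ b, Real.log ((c b).factorial : ℝ)

/-- The polynomial error terms. -/
def errN (N : ℕ) : ℝ := 1 + Real.log (N + 1)

lemma errN_mono {N N' : ℕ} (h : N ≤ N') : errN N ≤ errN N' := by
  have : (N : ℝ) ≤ N' := by exact_mod_cast h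
  have := Real.log_le_log (by positivity : (0 : ℝ) < N + 1) (by linarith : (N + 1 : ℝ) ≤ N' + 1)
  unfold errN
  linarith

lemma mlog_bounds (c : K → ℕ) {N : ℕ} (hN : 0 < N) (hc : ∑ b, c b = N) :
    N * Hf (fun b => (c b : ℝ) / N) - Fintype.card K * errN N ≤ mlog c N ∧
      mlog c N ≤ N * Hf (fun b => (c b : ℝ) / N) + errN N := by
  have hc' : ∑ b, (c b : ℝ) = N := by exact_mod_cast hc
  rw [mul_Hf_div c hN hc, mlog]
  have h1 : ∑ b, Real.log ((c b).factorial : ℝ) ≤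
      ∑ b, (c b * Real.log (c b) - c b + errN N) := by
    refine Finset.sum_le_sum fun b _ => (log_factorial_le _).trans ?_
    have := errN_mono (hc ▸ Finset.single_le_sum (fun _ _ => Nat.zero_le _) (Finset.mem_univ b))
    unfold errN at this ⊢
    linarith
  have h2 : ∑ b, (c b * Real.log (c b) - c b) ≤ ∑ b, Real.log ((c b).factorial : ℝ) :=
    Finset.sum_le_sum fun b _ => log_factorial_ge _
  rw [Finset.sum_add_distrib, Finset.sum_sub_distrib, hc', Finset.sum_const, Finset.card_univ,
    nsmul_eq_mul] at h1
  rw [Finset.sum_sub_distrib, hc'] at h2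
  have h3 := log_factorial_ge N
  have h4 := log_factorial_le N
  rw [← errN] at h4
  constructor <;> linarith

lemma log_card_typeClass {X : Type*} [Fintype X] (f : X → K) :
    Real.log ((tclass f).card : ℝ)
      = mlog (cnt f) (Fintype.card X) := by
  have h := congrArg (fun k : ℕ => Real.log (k : ℝ)) (card_typeClass f)
  have hp : ∀ b, ((cnt f b).factorial : ℝ) ≠ 0 := fun b => by
    exact_mod_cast (Nat.factorial_pos _).ne'
  have hpos : 0 < (tclass f).card := Finset.card_pos.2 ⟨f, by simp [mem_tclass]⟩
  simp only [Nat.cast_mul, Nat.cast_prod] at h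
  rw [Real.log_mul (Finset.prod_ne_zero_iff.2 fun b _ => hp b) (by exact_mod_cast hpos.ne'),
    Real.log_prod (fun b _ => hp b)] at h
  rw [mlog, h]
  ring

end Multinomial

section Matchings

variable {H : Type*} [Fintype H]

/-- Perfect matchings as fixed point free involutions. -/
def IsMat (m : Equiv.Perm H) : Prop := (∀ h, m (m h) = h) ∧ ∀ h, m h ≠ h

/-- The set of perfect matchings. -/
def mats (H : Type*) [Fintype H] : Finset (Equiv.Perm H) := Finset.univ.filter IsMat

/-- The perfect matchings which pair each point of type `b` with a point of type `c b`. -/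
def cons {K : Type*} (c : K → K) (κ : H → K) : Finset (Equiv.Perm H) :=
  Finset.univ.filter fun m => IsMat m ∧ ∀ h, κ (m h) = c (κ h)

lemma mem_cons {K : Type*} {c : K → K} {κ : H → K} {m : Equiv.Perm H} :
    m ∈ cons c κ ↔ IsMat m ∧ ∀ h, κ (m h) = c (κ h) := by simp [cons]

lemma isMat_conj {m : Equiv.Perm H} (hm : IsMat m) (s : Equiv.Perm H) : IsMat (s⁻¹ * m * s) := by
  refine ⟨fun h => ?_, fun h e => hm.2 (s h) ?_⟩
  · simp [Equiv.Perm.mul_apply, hm.1]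
  · have := congrArg s e
    simpa [Equiv.Perm.mul_apply] using this

lemma card_cons_comp {K : Type*} (c : K → K) (κ : H → K) (s : Equiv.Perm H) :
    (cons c (κ ∘ s)).card = (cons c κ).card := by
  symm
  refine Finset.card_bij (fun m _ => s⁻¹ * m * s) (fun m hm => ?_) (fun x _ y _ h => ?_)
    (fun m hm => ⟨s * m * s⁻¹, ?_, by group⟩)
  · rw [mem_cons] at hm ⊢
    refine ⟨isMat_conj hm.1 s, fun h => ?_⟩
    simp [Equiv.Perm.mul_apply, hm.2]
  · simpa using h
  · rw [mem_cons] at hm ⊢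
    refine ⟨by simpa using isMat_conj hm.1 s⁻¹, fun h => ?_⟩
    have := hm.2 (s⁻¹ h)
    simpa [Equiv.Perm.mul_apply] using this

/-- Representatives of the pairs of a matching. -/
def matRep (m : Equiv.Perm H) : Finset H :=
  Finset.univ.filter fun h => Fintype.equivFin H h < Fintype.equivFin H (m h)

lemma mem_matRep_mat {m : Equiv.Perm H} (hm : IsMat m) (h : H) :
    m h ∈ matRep m ↔ h ∉ matRep m := by
  simp only [matRep, Finset.mem_filter, Finset.mem_univ, true_and, hm.1, not_lt]
  refine ⟨le_of_lt, fun hle => lt_of_le_of_ne hle fun e => hm.2 h ?_⟩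
  exact (Fintype.equivFin H).injective e

lemma sum_matRep {α : Type*} [AddCommMonoid α] {m : Equiv.Perm H} (hm : IsMat m) (φ : H → α) :
    ∑ h, φ h = ∑ h ∈ matRep m, (φ h + φ (m h)) := by
  rw [Finset.sum_add_distrib, ← Finset.sum_add_sum_compl (matRep m)]
  congr 1
  symm
  refine Finset.sum_bij (fun h _ => m h) (fun h hh => ?_) (fun x _ y _ e => m.injective e)
    (fun h hh => ⟨m h, ?_, hm.1 h⟩) (fun _ _ => rfl)
  · rw [Finset.mem_compl, mem_matRep_mat hm]
    exact not_not.2 hh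
  · rw [mem_matRep_mat hm]
    exact Finset.mem_compl.1 hh

lemma two_mul_card_matRep {m : Equiv.Perm H} (hm : IsMat m) :
    2 * (matRep m).card = Fintype.card H := by
  have := sum_matRep hm (fun _ => (1 : ℕ))
  simp only [Finset.sum_const, smul_eq_mul, Finset.card_univ, mul_one] at this
  rw [this, mul_comm]

variable {K : Type*} [Fintype K]

/-- The type assignments with the same counts as `κ` which are consistent with `m`. -/
def consTypes (c : K → K) (κ : H → K) (m : Equiv.Perm H) : Finset (H → K) :=
  Finset.univ.filter fun κ' => (∀ b, cnt κ b = cnt κ' b) ∧ ∀ h, κ' (m h) = c (κ' h)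

/-- The empirical distribution. -/
def emp {X : Type*} [Fintype X] (f : X → K) (b : K) : ℝ := (cnt f b : ℝ) / Fintype.card X

lemma factorial_mul_card_cons (c : K → K) (κ : H → K) :
    (Fintype.card H).factorial * (cons c κ).card
      = (∏ b, (cnt κ b).factorial) * ∑ m ∈ mats H, (consTypes c κ m).card := by
  have h := sum_perm_eq κ (fun κ' => (cons c κ').card)
  simp only [card_cons_comp, Finset.sum_const, Finset.card_univ, Fintype.card_perm,
    smul_eq_mul] at h
  rw [h]
  congr 1
  simp only [cons, consTypes, Finset.card_eq_sum_ones, Finset.sum_filter, mats]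
  trans ∑ g : H → K, ∑ m : Equiv.Perm H,
    if (∀ b, cnt κ b = cnt g b) ∧ IsMat m ∧ ∀ h, g (m h) = c (g h) then 1 else 0
  · refine Finset.sum_congr rfl fun g _ => ?_
    by_cases h : ∀ b, cnt κ b = cnt g b <;> simp [h]
  · rw [Finset.sum_comm]
    refine Finset.sum_congr rfl fun m _ => ?_
    by_cases h : IsMat m <;> simp [h]

lemma cnt_conj {c : K → K} (hc : Function.Involutive c) {κ : H → K} {m : Equiv.Perm H}
    (h : ∀ h, κ (m h) = c (κ h)) (b : K) : cnt κ (c b) = cnt κ b := by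
  rw [← cnt_comp_perm κ m, cnt, cnt]
  congr 1
  ext x
  simp [h, hc.injective.eq_iff]

lemma sum_log_emp (κ : H → K) (hH : 0 < Fintype.card H) :
    ∑ h, Real.log (emp κ (κ h)) = -(Fintype.card H * Hf (emp κ)) := by
  rw [sum_comp_eq_cnt κ (fun b => Real.log (emp κ b)), Hf, Finset.mul_sum, ← Finset.sum_neg_distrib]
  refine Finset.sum_congr rfl fun b _ => ?_
  have : (Fintype.card H : ℝ) ≠ 0 := by positivity
  rw [Real.negMulLog]
  simp only [emp]
  field_simp

lemma card_consTypes_le {c : K → K} (hc : Function.Involutive c) (κ : H → K)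
    (hH : 0 < Fintype.card H) {m : Equiv.Perm H} (hm : IsMat m) :
    ((consTypes c κ m).card : ℝ) ≤ Real.exp (Fintype.card H / 2 * Hf (emp κ)) := by
  have hH' : (Fintype.card H : ℝ) ≠ 0 := by positivity
  have key : ∀ κ' ∈ consTypes c κ m,
      ∏ h : matRep m, emp κ (κ' h) = Real.exp (-(Fintype.card H / 2 * Hf (emp κ))) := by
    intro κ' h'
    obtain ⟨h1, h2⟩ := (Finset.mem_filter.1 h').2
    have hq : emp κ = emp κ' := funext fun b => by simp [emp, h1]
    have hpos : ∀ h, 0 < emp κ' (κ' h) := fun h => by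
      have : 0 < cnt κ' (κ' h) := Finset.card_pos.2 ⟨h, by simp⟩
      rw [emp]
      positivity
    rw [hq, ← Real.exp_log (Finset.prod_pos fun h _ => hpos h.1),
      Real.log_prod (fun h _ => (hpos h.1).ne')]
    congr 1
    have h3 := sum_matRep hm (fun h => Real.log (emp κ' (κ' h)))
    have h4 : ∀ h, emp κ' (κ' (m h)) = emp κ' (κ' h) := fun h => by
      rw [h2, emp, emp, cnt_conj hc h2]
    simp only [h4] at h3
    rw [sum_log_emp κ' hH, ← Finset.sum_coe_sort (matRep m), Finset.sum_add_distrib] at h3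
    linarith
  have hsum : ∑ κ' ∈ consTypes c κ m, ∏ h : matRep m, emp κ (κ' h) ≤ 1 := by
    have hnn : ∀ b, 0 ≤ emp κ b := fun b => by unfold emp; positivity
    calc ∑ κ' ∈ consTypes c κ m, ∏ h : matRep m, emp κ (κ' h)
        = ∑ f ∈ (consTypes c κ m).image (fun κ' (h : matRep m) => κ' h), ∏ h, emp κ (f h) := by
          rw [Finset.sum_image]
          intro x hx y hy e
          funext h
          have hx' := (Finset.mem_filter.1 hx).2.2
          have hy' := (Finset.mem_filter.1 hy).2.2
          by_cases hh : h ∈ matRep m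
          · exact congrFun e ⟨h, hh⟩
          · have := congrFun e ⟨m h, (mem_matRep_mat hm h).2 hh⟩
            simp only [hx', hy'] at this
            exact hc.injective this
      _ ≤ ∑ f : matRep m → K, ∏ h, emp κ (f h) :=
          Finset.sum_le_sum_of_subset_of_nonneg (Finset.subset_univ _)
            fun f _ _ => Finset.prod_nonneg fun h _ => hnn _
      _ = ∏ _h : matRep m, ∑ b, emp κ b := by
          rw [Finset.prod_univ_sum, Fintype.piFinset_univ]
      _ = 1 := by
          have : ∑ b, emp κ b = 1 := by
            simp only [emp]
            rw [← Finset.sum_div, div_eq_one_iff_eq hH']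
            exact_mod_cast sum_cnt κ
          simp [this]
  rw [Finset.sum_congr rfl key, Finset.sum_const, nsmul_eq_mul, Real.exp_neg] at hsum
  rwa [← div_eq_mul_inv, div_le_one (Real.exp_pos _)] at hsum

lemma card_consTypes_ge {c : K → K} (hc : Function.Involutive c) (κ : H → K)
    (hH : 0 < Fintype.card H) (hsym : ∀ b, cnt κ (c b) = cnt κ b) (hev : ∀ b, Even (cnt κ b))
    {m : Equiv.Perm H} (hm : IsMat m) :
    Real.exp (Fintype.card H / 2 * Hf (emp κ) - Fintype.card K * errN (Fintype.card H))
      ≤ ((consTypes c κ m).card : ℝ) := by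
  have hcard := two_mul_card_matRep hm
  have hhalf : ∀ b, 2 * (cnt κ b / 2) = cnt κ b := fun b => Nat.two_mul_div_two_of_even (hev b)
  have hsum : ∑ b, cnt κ b / 2 = Fintype.card (matRep m) := by
    have h1 : ∑ b, 2 * (cnt κ b / 2) = Fintype.card H := by
      rw [← sum_cnt κ]
      exact Finset.sum_congr rfl fun b _ => hhalf b
    rw [← Finset.mul_sum] at h1
    rw [Fintype.card_coe]
    omega
  obtain ⟨f₀, hf₀⟩ := exists_cnt_eq (fun b => cnt κ b / 2) hsum
  set T := tclass f₀ with hT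
  have hRpos : 0 < (matRep m).card := by omega
  have hR : ((matRep m).card : ℝ) = Fintype.card H / 2 := by
    rw [← hcard]; push_cast; ring
  have hTlog : Fintype.card H / 2 * Hf (emp κ) - Fintype.card K * errN (Fintype.card H)
      ≤ Real.log T.card := by
    rw [log_card_typeClass f₀, Fintype.card_coe]
    have hb := (mlog_bounds (cnt f₀) hRpos (by rw [sum_cnt, Fintype.card_coe])).1
    have he : (fun b => (cnt f₀ b : ℝ) / (matRep m).card) = emp κ := by
      funext b
      have : (cnt κ b : ℝ) = 2 * (cnt κ b / 2 : ℕ) := by exact_mod_cast (hhalf b).symm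
      rw [hf₀, emp, hR, this]
      field_simp
    rw [he, hR] at hb
    have : errN (matRep m).card ≤ errN (Fintype.card H) := errN_mono (by omega)
    have := mul_le_mul_of_nonneg_left this (Nat.cast_nonneg (Fintype.card K) : (0 : ℝ) ≤ _)
    linarith
  have hTpos : 0 < T.card := Finset.card_pos.2 ⟨f₀, by simp [hT, mem_tclass]⟩
  have hle : T.card ≤ (consTypes c κ m).card := by
    let ext : (matRep m → K) → H → K := fun f h =>
      if hh : h ∈ matRep m then f ⟨h, hh⟩ else c (f ⟨m h, (mem_matRep_mat hm h).2 hh⟩)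
    have ext1 : ∀ f (h : matRep m), ext f h = f h := fun f h => dif_pos h.2
    have ext2 : ∀ f (h : matRep m), ext f (m h) = c (f h) := fun f h => by
      have : m h ∉ matRep m := by rw [mem_matRep_mat hm]; exact not_not.2 h.2
      simp only [ext, dif_neg this, hm.1]
    refine Finset.card_le_card_of_injOn ext (fun f hf => ?_) (fun f _ g _ e => ?_)
    · have hf := mem_tclass.1 hf
      refine Finset.mem_filter.2 ⟨Finset.mem_univ _, fun b => ?_, fun h => ?_⟩
      · have h1 := sum_matRep hm (fun h => if ext f h = b then 1 else 0)
        rw [← Finset.card_filter, ← Finset.sum_coe_sort (matRep m), Finset.sum_add_distrib] at h1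
        simp only [ext1, ext2] at h1
        rw [← Finset.card_filter, ← Finset.card_filter] at h1
        have h2 : (Finset.univ.filter fun h => c (f h) = b).card = cnt f (c b) := by
          unfold cnt
          congr 1
          ext h
          simp only [Finset.mem_filter, Finset.mem_univ, true_and]
          rw [← hc.eq_iff, eq_comm]
        have h3 : cnt (ext f) b = cnt f b + cnt f (c b) := by
          rw [← h2]
          exact h1
        rw [h3, ← hf, ← hf, hf₀, hf₀, hsym, ← two_mul, hhalf]
      · by_cases hh : h ∈ matRep m
        · exact (ext2 f ⟨h, hh⟩).trans (congrArg c (ext1 f ⟨h, hh⟩).symm)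
        · have h4 := ext1 f ⟨m h, (mem_matRep_mat hm h).2 hh⟩
          have h5 := ext2 f ⟨m h, (mem_matRep_mat hm h).2 hh⟩
          simp only [hm.1] at h5
          rw [h5, hc, h4]
    · funext h
      rw [← ext1 f, ← ext1 g, e]
  calc _ ≤ Real.exp (Real.log T.card) := Real.exp_le_exp.2 hTlog
    _ = T.card := Real.exp_log (by exact_mod_cast hTpos)
    _ ≤ _ := by exact_mod_cast hle

lemma prod_factorial_eq_exp (κ : H → K) :
    ((∏ b, (cnt κ b).factorial : ℕ) : ℝ)
      = (Fintype.card H).factorial * Real.exp (-mlog (cnt κ) (Fintype.card H)) := by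
  have hp : ∀ b, ((cnt κ b).factorial : ℝ) ≠ 0 := fun b => by
    exact_mod_cast (Nat.factorial_pos _).ne'
  have hf : (0 : ℝ) < (Fintype.card H).factorial := by exact_mod_cast Nat.factorial_pos _
  have hP : (0 : ℝ) < ∏ b, ((cnt κ b).factorial : ℝ) :=
    Finset.prod_pos fun b _ => by exact_mod_cast Nat.factorial_pos _
  rw [mlog, neg_sub, Real.exp_sub, Real.exp_log hf, ← Real.log_prod (fun b _ => hp b),
    Real.exp_log hP]
  field_simp
  push_cast
  rfl

lemma card_cons_eq (c : K → K) (κ : H → K) :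
    ((cons c κ).card : ℝ) = Real.exp (-mlog (cnt κ) (Fintype.card H)) *
      ∑ m ∈ mats H, ((consTypes c κ m).card : ℝ) := by
  have h : (((Fintype.card H).factorial * (cons c κ).card : ℕ) : ℝ) = _ :=
    congrArg (Nat.cast (R := ℝ)) (factorial_mul_card_cons c κ)
  rw [Nat.cast_mul, Nat.cast_mul, prod_factorial_eq_exp, mul_assoc] at h
  have hf : ((Fintype.card H).factorial : ℝ) ≠ 0 := by exact_mod_cast Nat.factorial_ne_zero _
  have := mul_left_cancel₀ hf h
  rw [this]
  push_cast
  rfl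

theorem card_cons_le {c : K → K} (hc : Function.Involutive c) (κ : H → K)
    (hH : 0 < Fintype.card H) :
    ((cons c κ).card : ℝ) ≤ (mats H).card * Real.exp
      (-(Fintype.card H / 2 * Hf (emp κ)) + Fintype.card K * errN (Fintype.card H)) := by
  rw [card_cons_eq]
  have h1 : ∑ m ∈ mats H, ((consTypes c κ m).card : ℝ)
      ≤ (mats H).card * Real.exp (Fintype.card H / 2 * Hf (emp κ)) := by
    rw [← nsmul_eq_mul]
    exact Finset.sum_le_card_nsmul _ _ _ fun m hm =>
      card_consTypes_le hc κ hH (Finset.mem_filter.1 hm).2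
  have h2 := (mlog_bounds (cnt κ) hH (sum_cnt κ)).1
  calc _ ≤ Real.exp (-mlog (cnt κ) (Fintype.card H)) *
        ((mats H).card * Real.exp (Fintype.card H / 2 * Hf (emp κ))) :=
        mul_le_mul_of_nonneg_left h1 (Real.exp_pos _).le
    _ = (mats H).card * Real.exp
        (-mlog (cnt κ) (Fintype.card H) + Fintype.card H / 2 * Hf (emp κ)) := by
        rw [Real.exp_add]; ring
    _ ≤ _ := by
        refine mul_le_mul_of_nonneg_left (Real.exp_le_exp.2 ?_) (Nat.cast_nonneg _)
        change _ * Hf (emp κ) - _ ≤ _ at h2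
        linarith

theorem card_cons_ge {c : K → K} (hc : Function.Involutive c) (κ : H → K)
    (hH : 0 < Fintype.card H) (hsym : ∀ b, cnt κ (c b) = cnt κ b) (hev : ∀ b, Even (cnt κ b)) :
    (mats H).card * Real.exp
      (-(Fintype.card H / 2 * Hf (emp κ)) - (Fintype.card K + 1) * errN (Fintype.card H))
      ≤ ((cons c κ).card : ℝ) := by
  rw [card_cons_eq]
  have h1 : (mats H).card * Real.exp
        (Fintype.card H / 2 * Hf (emp κ) - Fintype.card K * errN (Fintype.card H))
      ≤ ∑ m ∈ mats H, ((consTypes c κ m).card : ℝ) := by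
    rw [← nsmul_eq_mul]
    exact Finset.card_nsmul_le_sum _ _ _ fun m hm =>
      card_consTypes_ge hc κ hH hsym hev (Finset.mem_filter.1 hm).2
  have h2 := (mlog_bounds (cnt κ) hH (sum_cnt κ)).2
  refine le_trans ?_ (mul_le_mul_of_nonneg_left h1 (Real.exp_pos _).le)
  rw [mul_left_comm, ← Real.exp_add]
  refine mul_le_mul_of_nonneg_left (Real.exp_le_exp.2 ?_) (Nat.cast_nonneg _)
  change _ ≤ _ * Hf (emp κ) + _ at h2
  linarith

end Matchings
/-! ### Sequences with prescribed statistics -/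

section Near

variable {A C X : Type*} [Fintype A] [Fintype C] [Fintype X]

/-- The class counts of `a` are bounded below by those of `P`, up to an error. -/
def Near (cl : A → C) (P : A → ℝ) (ε : ℝ) (a : X → A) : Prop :=
  ∀ c, Fintype.card X * (push cl P c - ε) ≤ cnt (cl ∘ a) c

lemma abs_cnt_sub_le {cl : A → C} {P : A → ℝ} (hP : ∑ b, P b = 1) {ε : ℝ} (hε : 0 ≤ ε)
    {a : X → A} (h : Near cl P ε a) (c : C) :
    |(cnt (cl ∘ a) c : ℝ) - Fintype.card X * push cl P c|
      ≤ Fintype.card X * ε * Fintype.card C := by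
  set N : ℝ := ((Fintype.card X : ℕ) : ℝ) with hN
  have hN0 : 0 ≤ N := Nat.cast_nonneg _
  have hcard : (1 : ℝ) ≤ Fintype.card C := by
    have : 0 < Fintype.card C := Fintype.card_pos_iff.2 ⟨c⟩
    exact_mod_cast this
  have hlow : ∀ c, 0 ≤ (cnt (cl ∘ a) c : ℝ) - N * push cl P c + N * ε := fun c => by
    have := h c
    linarith
  have hsum : ∑ c, ((cnt (cl ∘ a) c : ℝ) - N * push cl P c + N * ε) = N * ε * Fintype.card C := by
    rw [Finset.sum_add_distrib, Finset.sum_sub_distrib, ← Finset.mul_sum, sum_push, hP]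
    have : ∑ c, (cnt (cl ∘ a) c : ℝ) = N := by
      rw [hN]
      exact_mod_cast sum_cnt (cl ∘ a)
    rw [this]
    simp
    ring
  have hup := Finset.single_le_sum (fun c _ => hlow c) (Finset.mem_univ c)
  rw [hsum] at hup
  have h1 := hlow c
  have h2 : N * ε ≤ N * ε * Fintype.card C := le_mul_of_one_le_right (by positivity) hcard
  have h3 : 0 ≤ N * ε := by positivity
  rw [abs_le]
  constructor <;> linarith

lemma near_sum {cl : A → C} {P : A → ℝ} (hP : ∑ b, P b = 1) {ε : ℝ} (hε : 0 ≤ ε)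
    {a : X → A} (h : Near cl P ε a) (g : C → ℝ) {B : ℝ} (hB : ∀ c, |g c| ≤ B) :
    |∑ x, g (cl (a x)) - Fintype.card X * ∑ b, P b * g (cl b)|
      ≤ Fintype.card X * ε * (Fintype.card C ^ 2 * B) := by
  have h1 := sum_comp_eq_cnt (cl ∘ a) g
  simp only [Function.comp_apply] at h1
  rw [h1, ← sum_push_mul cl P g, Finset.mul_sum, ← Finset.sum_sub_distrib]
  refine (Finset.abs_sum_le_sum_abs _ _).trans ?_
  refine (Finset.sum_le_card_nsmul _ _ (Fintype.card X * ε * Fintype.card C * B)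
    fun c _ => ?_).trans_eq ?_
  · rw [← mul_assoc, ← sub_mul, abs_mul]
    exact mul_le_mul (abs_cnt_sub_le hP hε h c) (hB c) (abs_nonneg _) (by positivity)
  · rw [Finset.card_univ, nsmul_eq_mul]
    ring

lemma exists_factor (cl : A → C) (f : A → ℝ) (h : ∀ b b', cl b = cl b' → f b = f b') :
    ∃ g : C → ℝ, ∀ b, g (cl b) = f b :=
  ⟨Function.extend cl f 0, fun b => Function.FactorsThrough.extend_apply (fun b b' e => h b b' e) _ b⟩

theorem exists_card_near_le {cl : A → C} {P : A → ℝ} (hP0 : ∀ b, 0 ≤ P b) (hP : ∑ b, P b = 1)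
    (hcl : ∀ b b', cl b = cl b' → P b = P b') {δ : ℝ} (hδ : 0 < δ) :
    ∃ ε > 0, ∀ n : ℕ, ((Finset.univ.filter fun a : Fin n → A => Near cl P ε a).card : ℝ)
      ≤ Real.exp (n * (Hf P + δ)) := by
  have hA : 0 < Fintype.card A := by
    rcases isEmpty_or_nonempty A with h | h
    · simp at hP
    · exact Fintype.card_pos
  set θ := Real.exp (-(δ / 2)) with hθ
  have hθ0 : 0 < θ := Real.exp_pos _
  have hθ1 : θ < 1 := by rw [hθ, Real.exp_lt_one_iff]; linarith
  set q : A → ℝ := fun b => θ * P b + (1 - θ) / Fintype.card A with hq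
  have hq0 : ∀ b, 0 < q b := fun b => by
    have := hP0 b
    have : 0 < 1 - θ := by linarith
    simp only [hq]
    positivity
  have hq1 : ∑ b, q b = 1 := by
    simp only [hq]
    rw [Finset.sum_add_distrib, ← Finset.mul_sum, hP, Finset.sum_const, Finset.card_univ,
      nsmul_eq_mul]
    field_simp
    ring
  obtain ⟨g, hg⟩ := exists_factor cl (fun b => Real.log (q b))
    (fun b b' e => by simp only [hq, hcl b b' e])
  set B := ∑ c, |g c| with hB
  have hBc : ∀ c, |g c| ≤ B := fun c =>
    Finset.single_le_sum (f := fun c => |g c|) (fun _ _ => abs_nonneg _) (Finset.mem_univ c)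
  have hB0 : 0 ≤ B := Finset.sum_nonneg fun _ _ => abs_nonneg _
  set D := (Fintype.card C : ℝ) ^ 2 * B with hD
  have hD0 : 0 ≤ D := by positivity
  refine ⟨δ / (2 * (D + 1)), by positivity, fun n => ?_⟩
  set ε := δ / (2 * (D + 1)) with hε
  have hε0 : 0 ≤ ε := by positivity
  have hεD : ε * D ≤ δ / 2 := by
    rw [hε, div_mul_eq_mul_div, div_le_div_iff₀ (by positivity) (by positivity)]
    nlinarith
  have hlog : -(Hf P) - δ / 2 ≤ ∑ b, P b * Real.log (q b) := by
    have h1 : -(Hf P) - δ / 2 = ∑ b, P b * (Real.log (P b) - δ / 2) := by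
      simp only [mul_sub, Finset.sum_sub_distrib, ← Finset.sum_mul, hP]
      simp [Hf, Real.negMulLog]
    rw [h1]
    refine Finset.sum_le_sum fun b _ => ?_
    rcases (hP0 b).eq_or_lt with h | h
    · simp [← h]
    · refine mul_le_mul_of_nonneg_left ?_ h.le
      have h2 : Real.log (θ * P b) ≤ Real.log (q b) := by
        refine Real.log_le_log (by positivity) ?_
        have : 0 ≤ (1 - θ) / Fintype.card A := div_nonneg (by linarith) (Nat.cast_nonneg _)
        simp only [hq]
        linarith
      rw [Real.log_mul hθ0.ne' h.ne', hθ, Real.log_exp] at h2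
      linarith
  have hw : ∀ a ∈ Finset.univ.filter (fun a : Fin n → A => Near cl P ε a),
      Real.exp (-(n * (Hf P + δ))) ≤ ∏ x, q (a x) := by
    intro a ha
    have h1 := near_sum hP hε0 (Finset.mem_filter.1 ha).2 g hBc
    simp only [hg, Fintype.card_fin] at h1
    rw [← Real.exp_log (Finset.prod_pos fun x _ => hq0 (a x)),
      Real.log_prod (fun x _ => (hq0 _).ne')]
    refine Real.exp_le_exp.2 ?_
    have h2 := (abs_le.1 h1).1
    have h3 := mul_le_mul_of_nonneg_left hlog (Nat.cast_nonneg n : (0 : ℝ) ≤ n)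
    have h4 := mul_le_mul_of_nonneg_left hεD (Nat.cast_nonneg n : (0 : ℝ) ≤ n)
    rw [mul_assoc, ← hD] at h2
    nlinarith
  have htot : ∑ a ∈ Finset.univ.filter (fun a : Fin n → A => Near cl P ε a), ∏ x, q (a x) ≤ 1 := by
    calc _ ≤ ∑ a : Fin n → A, ∏ x, q (a x) :=
          Finset.sum_le_sum_of_subset_of_nonneg (Finset.subset_univ _)
            fun a _ _ => Finset.prod_nonneg fun x _ => (hq0 _).le
      _ = ∏ _x : Fin n, ∑ b, q b := by rw [Finset.prod_univ_sum, Fintype.piFinset_univ]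
      _ = 1 := by simp [hq1]
  have := (Finset.card_nsmul_le_sum _ _ _ hw).trans htot
  rw [nsmul_eq_mul, Real.exp_neg, ← div_eq_mul_inv, div_le_one (Real.exp_pos _)] at this
  exact this

end Near

section HalfEdgeTypes

variable {A C X K : Type*} [Fintype A] [Fintype C] [Fintype X] [Fintype K] {e : ℕ}

/-- The half-edge types determined by vertex types. -/
def kapA (kp : Fin e → A → K) (a : X → A) (h : X × Fin e) : K := kp h.2 (a h.1)

lemma cnt_kapA (kp : Fin e → A → K) (a : X → A) (t : K) :
    cnt (kapA kp a) t = ∑ x, cnt (fun i => kp i (a x)) t := by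
  simp only [cnt, Finset.card_filter]
  rw [Fintype.sum_prod_type]
  rfl

lemma abs_emp_kapA_sub_le {cl : A → C} {P : A → ℝ} (hP : ∑ b, P b = 1) {ε : ℝ} (hε : 0 ≤ ε)
    {a : X → A} (h : Near cl P ε a) {kp : Fin e → A → K} {Q : K → ℝ}
    (hcl : ∀ b b', cl b = cl b' → ∀ t, cnt (fun i => kp i b) t = cnt (fun i => kp i b') t)
    (hQ : ∀ i, push (kp i) P = Q) (hX : 0 < Fintype.card X) (he : 0 < e) (t : K) :
    |emp (kapA kp a) t - Q t| ≤ ε * Fintype.card C ^ 2 := by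
  obtain ⟨g, hg, hgB⟩ : ∃ g : C → ℝ, (∀ b, g (cl b) = cnt (fun i => kp i b) t) ∧
      ∀ c, |g c| ≤ e := by
    refine ⟨Function.extend cl (fun b => (cnt (fun i => kp i b) t : ℝ)) 0, fun b =>
      Function.FactorsThrough.extend_apply (fun b b' e => by rw [hcl b b' e]) _ b, fun c => ?_⟩
    by_cases h : ∃ b, cl b = c
    · obtain ⟨b, rfl⟩ := h
      rw [Function.FactorsThrough.extend_apply (fun b b' e => by rw [hcl b b' e]), Nat.abs_cast]
      have : cnt (fun i => kp i b) t ≤ Fintype.card (Fin e) := Finset.card_le_univ _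
      rw [Fintype.card_fin] at this
      exact_mod_cast this
    · rw [Function.extend_apply' _ _ _ h]
      simp
  have h1 := near_sum hP hε h g hgB
  simp only [hg] at h1
  have h2 : ∑ x, (cnt (fun i => kp i (a x)) t : ℝ) = cnt (kapA kp a) t := by
    rw [cnt_kapA]; push_cast; rfl
  have h3 : ∑ b, P b * (cnt (fun i => kp i b) t : ℝ) = e * Q t := by
    have : ∀ i, ∑ b, P b * (if kp i b = t then 1 else 0) = Q t := fun i => by
      rw [← hQ i, push, Finset.sum_filter]
      simp
    simp only [cnt, Finset.card_filter, Nat.cast_sum, Finset.mul_sum]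
    rw [Finset.sum_comm]
    push_cast
    rw [Finset.sum_congr rfl (fun i _ => this i)]
    simp
  rw [h2, h3] at h1
  have hX' : (0 : ℝ) < Fintype.card X := by exact_mod_cast hX
  have he' : (0 : ℝ) < e := by exact_mod_cast he
  have h4 : emp (kapA kp a) t - Q t
      = ((cnt (kapA kp a) t : ℝ) - Fintype.card X * (e * Q t)) / (Fintype.card X * e) := by
    rw [emp, Fintype.card_prod, Fintype.card_fin, Nat.cast_mul]
    field_simp
  rw [h4, abs_div, abs_of_pos (mul_pos hX' he'), div_le_iff₀ (mul_pos hX' he')]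
  refine h1.trans_eq ?_
  ring

lemma continuous_Hf : Continuous (Hf : (K → ℝ) → ℝ) := by
  unfold Hf
  exact continuous_finsetSum _ fun b _ => Real.continuous_negMulLog.comp (continuous_apply b)

lemma exists_Hf_near (Q : K → ℝ) {δ : ℝ} (hδ : 0 < δ) :
    ∃ η > 0, ∀ q : K → ℝ, (∀ t, |q t - Q t| ≤ η) → |Hf q - Hf Q| ≤ δ := by
  obtain ⟨η, hη, h⟩ := Metric.continuousAt_iff.1 (continuous_Hf.continuousAt (x := Q)) δ hδ
  refine ⟨η / 2, by positivity, fun q hq => ?_⟩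
  have : dist q Q < η := by
    refine lt_of_le_of_lt ((dist_pi_le_iff (by positivity)).2 fun t => ?_) (half_lt_self hη)
    rw [Real.dist_eq]
    exact hq t
  exact (Real.dist_eq _ _ ▸ h this).le

end HalfEdgeTypes

section Rounding

lemma exists_linear_approx :
    ∃ g : ℕ → ℝ →ₗ[ℚ] ℚ, ∀ x : ℝ, Tendsto (fun n => ((g n x : ℚ) : ℝ)) atTop (𝓝 x) := by
  let b := Module.Basis.ofVectorSpace ℚ ℝ
  have : ∀ i (n : ℕ), ∃ q : ℚ, |(q : ℝ) - b i| < 1 / (n + 1) := fun i n => by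
    obtain ⟨q, h1, h2⟩ := exists_rat_btwn (show b i - 1 / ((n : ℝ) + 1) < b i + 1 / (n + 1) by
      have : (0 : ℝ) < 1 / (n + 1) := by positivity
      linarith)
    exact ⟨q, by rw [abs_lt]; constructor <;> linarith⟩
  choose β hβ using this
  refine ⟨fun n => b.constr ℚ fun i => β i n, fun x => ?_⟩
  have hβ' : ∀ i, Tendsto (fun n => (β i n : ℝ)) atTop (𝓝 (b i)) := fun i => by
    rw [tendsto_iff_dist_tendsto_zero]
    refine squeeze_zero (fun _ => dist_nonneg) (fun n => ?_) tendsto_one_div_add_atTop_nhds_zero_nat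
    rw [Real.dist_eq]
    exact (hβ i n).le
  have hx : x = ∑ i ∈ (b.repr x).support, ((b.repr x i : ℚ) : ℝ) * b i := by
    conv_lhs => rw [← b.linearCombination_repr x, Finsupp.linearCombination_apply, Finsupp.sum]
    exact Finset.sum_congr rfl fun i _ => by rw [Rat.smul_def]
  have hg : ∀ n, ((b.constr ℚ (fun i => β i n) x : ℚ) : ℝ)
      = ∑ i ∈ (b.repr x).support, ((b.repr x i : ℚ) : ℝ) * β i n := fun n => by
    rw [Module.Basis.constr_apply, Finsupp.sum]
    simp only [smul_eq_mul]
    push_cast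
    rfl
  simp only [hg]
  conv => rhs; rw [hx]
  exact tendsto_finsetSum _ fun i _ => (hβ' i).const_mul _

lemma exists_common_denominator {A : Type*} [Fintype A] (x : A → ℚ) (hx : ∀ a, 0 ≤ x a) :
    ∃ L : ℕ, 0 < L ∧ ∃ w : A → ℕ, ∀ a, (w a : ℚ) = x a * L := by
  refine ⟨∏ a, (x a).den, Finset.prod_pos fun a _ => (x a).den_pos,
    fun a => (x a).num.toNat * ∏ a' ∈ Finset.univ.erase a, (x a').den, fun a => ?_⟩
  rw [← Finset.mul_prod_erase _ _ (Finset.mem_univ a)]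
  push_cast
  rw [← mul_assoc]
  congr 1
  have h1 : (((x a).num.toNat : ℤ) : ℚ) = (x a).num := by
    rw [Int.toNat_of_nonneg (Rat.num_nonneg.2 (hx a))]
  rw [Rat.mul_den_eq_num]
  exact_mod_cast h1

variable {A K : Type*} [Fintype A] {e : ℕ}

theorem exists_rational_weights {P : A → ℝ} (hP0 : ∀ b, 0 ≤ P b) (hP : ∑ b, P b = 1)
    {kp : Fin e → A → K} {c : K → K} {Q : K → ℝ} (hQ : ∀ i, push (kp i) P = Q)
    (hc : Function.Involutive c)
    (hsym : ∀ t, Q (c t) = Q t) (a₀ : A) (t₀ : K) (ha₀ : ∀ i, kp i a₀ = t₀) (ht₀ : c t₀ = t₀)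
    {ε : ℝ} (hε : 0 < ε) :
    ∃ (L : ℕ) (w : A → ℕ), 0 < L ∧ ∑ b, w b = L ∧ 0 < w a₀ ∧ (∀ b, |(w b : ℝ) / L - P b| ≤ ε) ∧
      ∀ t, ∑ b, w b * cnt (fun i => kp i b) (c t) = ∑ b, w b * cnt (fun i => kp i b) t := by
  obtain ⟨g, hg⟩ := exists_linear_approx
  have hpos : ∀ b, ∀ᶠ n in atTop, 0 ≤ g n (P b) := fun b => by
    rcases (hP0 b).eq_or_lt with h | h
    · simp [← h]
    · filter_upwards [(hg (P b)).eventually (lt_mem_nhds h)] with n hn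
      exact_mod_cast hn.le
  let y : ℕ → A → ℚ := fun n b => g n (P b) + if b = a₀ then 1 / ((n : ℚ) + 1) else 0
  have hy : ∀ b, Tendsto (fun n => (y n b : ℝ)) atTop (𝓝 (P b)) := fun b => by
    have h2 : Tendsto (fun n : ℕ => ((if b = a₀ then 1 / ((n : ℚ) + 1) else 0 : ℚ) : ℝ)) atTop
        (𝓝 0) := by
      split_ifs
      · push_cast
        exact tendsto_one_div_add_atTop_nhds_zero_nat
      · simp
    simpa [y] using (hg (P b)).add h2
  have hsum : Tendsto (fun n => ∑ b, (y n b : ℝ)) atTop (𝓝 1) := by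
    rw [← hP]
    exact tendsto_finsetSum _ fun b _ => hy b
  have hquot : ∀ b, ∀ᶠ n in atTop, |(y n b : ℝ) / (∑ b, (y n b : ℝ)) - P b| < ε := fun b => by
    have := (hy b).div hsum one_ne_zero
    rw [div_one] at this
    have := (Metric.tendsto_nhds.1 this) ε hε
    simpa [Real.dist_eq] using this
  obtain ⟨n, hn1, hn2⟩ := ((eventually_all.2 hpos).and (eventually_all.2 hquot)).exists
  have hy0 : ∀ b, 0 ≤ y n b := fun b => by
    have := hn1 b
    simp only [y]
    split_ifs <;> positivity
  have hya : 0 < y n a₀ := by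
    have := hn1 a₀
    simp only [y, if_true]
    positivity
  obtain ⟨L₀, hL₀, w, hw⟩ := exists_common_denominator (y n) hy0
  have hL₀' : (0 : ℚ) < L₀ := by exact_mod_cast hL₀
  have hwa : 0 < w a₀ := by
    have : (0 : ℚ) < w a₀ := by rw [hw]; positivity
    exact_mod_cast this
  refine ⟨∑ b, w b, w, ?_, rfl, hwa, fun b => ?_, fun t => ?_⟩
  · exact hwa.trans_le (Finset.single_le_sum (fun _ _ => Nat.zero_le _) (Finset.mem_univ a₀))
  · have hwR : ∀ b, (w b : ℝ) = y n b * L₀ := fun b => by exact_mod_cast congrArg (Rat.cast (K := ℝ)) (hw b)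
    have hL : (L₀ : ℝ) ≠ 0 := by positivity
    rw [Nat.cast_sum, Finset.sum_congr rfl (fun b _ => hwR b), ← Finset.sum_mul, hwR,
      mul_div_mul_right _ _ hL]
    exact (hn2 b).le
  · have hS : ∀ t, ∑ b, P b * (cnt (fun i => kp i b) t : ℝ) = e * Q t := fun t => by
      have : ∀ i, ∑ b, P b * (if kp i b = t then 1 else 0) = Q t := fun i => by
        rw [← hQ i, push, Finset.sum_filter]
        simp
      simp only [cnt, Finset.card_filter, Nat.cast_sum, Finset.mul_sum]
      rw [Finset.sum_comm]
      push_cast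
      rw [Finset.sum_congr rfl (fun i _ => this i)]
      simp
    have hG : ∀ t, ∑ b, g n (P b) * (cnt (fun i => kp i b) t : ℚ) = g n (e * Q t) := fun t => by
      rw [← hS t, map_sum]
      refine Finset.sum_congr rfl fun b _ => ?_
      have : P b * (cnt (fun i => kp i b) t : ℝ) = (cnt (fun i => kp i b) t : ℚ) • P b := by
        rw [Rat.smul_def]
        push_cast
        ring
      rw [this, map_smul, smul_eq_mul, mul_comm]
    have hca : cnt (fun i => kp i a₀) (c t) = cnt (fun i => kp i a₀) t := by
      simp only [cnt, ha₀]
      congr 1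
      ext i
      simp only [Finset.mem_filter, Finset.mem_univ, true_and]
      rw [← hc.eq_iff, ht₀]
    have hY : ∀ t, ∑ b, y n b * (cnt (fun i => kp i b) t : ℚ)
        = g n (e * Q t) + 1 / ((n : ℚ) + 1) * cnt (fun i => kp i a₀) t := fun t => by
      simp only [y, add_mul, Finset.sum_add_distrib, hG, ite_mul, zero_mul]
      simp
    have : ((∑ b, w b * cnt (fun i => kp i b) (c t) : ℕ) : ℚ)
        = (∑ b, w b * cnt (fun i => kp i b) t : ℕ) := by
      push_cast
      have h1 : ∀ t, ∑ b, (w b : ℚ) * (cnt (fun i => kp i b) t : ℚ)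
          = L₀ * ∑ b, y n b * (cnt (fun i => kp i b) t : ℚ) := fun t => by
        rw [Finset.mul_sum]
        exact Finset.sum_congr rfl fun b _ => by rw [hw]; ring
      rw [h1, h1, hY, hY, hsym, hca]
    exact_mod_cast this

end Rounding
section GoodSequence

variable {A K : Type*} [Fintype A] [Fintype K] {e : ℕ}

theorem exists_good_sequence {P : A → ℝ} (hP0 : ∀ b, 0 ≤ P b) (hP : ∑ b, P b = 1)
    {kp : Fin e → A → K} {c : K → K} {Q : K → ℝ} (hQ : ∀ i, push (kp i) P = Q)
    (hc : Function.Involutive c) (he : 0 < e)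
    (hsym : ∀ t, Q (c t) = Q t) (a₀ : A) (t₀ : K) (ha₀ : ∀ i, kp i a₀ = t₀) (ht₀ : c t₀ = t₀)
    {ε : ℝ} (hε : 0 < ε) :
    ∃ ρ > (0 : ℝ), ∃ n₀ : ℕ, ∀ n ≥ n₀, Even (n * e) → ∃ a : Fin n → A,
      (∀ b, |emp a b - P b| ≤ ε) ∧ ∀ t, Even (cnt (kapA kp a) t) ∧
        cnt (kapA kp a) (c t) = cnt (kapA kp a) t ∧
        (cnt (kapA kp a) t = 0 ∨ ρ * n ≤ cnt (kapA kp a) t) := by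
  obtain ⟨L, w, hL, hw, hwa, hwP, hW⟩ :=
    exists_rational_weights hP0 hP hQ hc hsym a₀ t₀ ha₀ ht₀ (half_pos hε)
  have hL' : (0 : ℝ) < L := by exact_mod_cast hL
  refine ⟨1 / (2 * L), by positivity, max (2 * L) (Nat.ceil (4 * L / ε)), fun n hn hev => ?_⟩
  have hn1 : 2 * L ≤ n := (le_max_left _ _).trans hn
  have hn2 : 4 * L / ε ≤ n := (Nat.le_ceil _).trans (by exact_mod_cast (le_max_right _ _).trans hn)
  set k := n / (2 * L) with hk
  set s := n % (2 * L) with hs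
  have hks : 2 * L * k + s = n := Nat.div_add_mod n (2 * L)
  have hs2 : s < 2 * L := Nat.mod_lt _ (by omega)
  have hk1 : 1 ≤ k := (Nat.one_le_div_iff (by omega)).2 hn1
  have hn0 : (0 : ℝ) < n := by
    have : 0 < n := by omega
    exact_mod_cast this
  have hνsum : ∑ b, (2 * k * w b + if b = a₀ then s else 0) = Fintype.card (Fin n) := by
    rw [Finset.sum_add_distrib, ← Finset.mul_sum, hw, Fintype.card_fin, ← hks]
    simp
    ring
  obtain ⟨a, ha⟩ := exists_cnt_eq _ hνsum
  have hG₀ : ∀ t, cnt (fun i => kp i a₀) t = if t = t₀ then e else 0 := fun t => by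
    simp only [cnt, ha₀]
    split_ifs with h
    · simp [h]
    · simp [Ne.symm h]
  have hcnt : ∀ t, cnt (kapA kp a) t
      = 2 * k * (∑ b, w b * cnt (fun i => kp i b) t) + if t = t₀ then s * e else 0 := fun t => by
    have h1 := sum_comp_eq_cnt a (fun b => (cnt (fun i => kp i b) t : ℝ))
    have h2 : cnt (kapA kp a) t = ∑ b, cnt a b * cnt (fun i => kp i b) t := by
      rw [cnt_kapA]
      exact_mod_cast h1
    rw [h2]
    simp only [ha, add_mul, Finset.sum_add_distrib, Finset.mul_sum, mul_assoc, ite_mul, zero_mul]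
    simp [hG₀]
  refine ⟨a, fun b => ?_, fun t => ⟨?_, ?_, ?_⟩⟩
  · have h1 : |(w b : ℝ) / L - P b| ≤ ε / 2 := hwP b
    have hwb : (w b : ℝ) / L ≤ 1 := by
      rw [div_le_one hL']
      have := hw ▸ Finset.single_le_sum (fun _ _ => Nat.zero_le _) (Finset.mem_univ b)
      exact_mod_cast this
    have hwb0 : 0 ≤ (w b : ℝ) / L := by positivity
    have hnR : (n : ℝ) = 2 * L * k + s := by exact_mod_cast hks.symm
    have h2 : emp a b - (w b : ℝ) / L = ((if b = a₀ then (s : ℝ) else 0) - s * (w b / L)) / n := by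
      rw [emp, ha, Fintype.card_fin]
      push_cast
      rw [div_sub' hn0.ne']
      congr 1
      rw [hnR]
      field_simp
      ring
    have hs3 : (s : ℝ) ≤ 2 * L := by exact_mod_cast hs2.le
    have h3 : |emp a b - (w b : ℝ) / L| ≤ ε / 2 := by
      rw [h2, abs_div, abs_of_pos hn0, div_le_iff₀ hn0]
      have h4 : 2 * (L : ℝ) ≤ ε / 2 * n := by
        rw [div_le_iff₀ hε] at hn2
        linarith
      refine le_trans ?_ (hs3.trans h4)
      have hs0 : (0 : ℝ) ≤ s := Nat.cast_nonneg _
      have h5 := mul_le_mul_of_nonneg_left hwb hs0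
      have h6 := mul_nonneg hs0 hwb0
      rw [abs_le]
      split_ifs <;> constructor <;> linarith
    calc |emp a b - P b| ≤ |emp a b - (w b : ℝ) / L| + |(w b : ℝ) / L - P b| := abs_sub_le _ _ _
      _ ≤ ε := by linarith
  · rw [hcnt]
    refine (((even_two.mul_right k).mul_right _)).add ?_
    split_ifs
    · rw [← hks, add_mul, mul_assoc, mul_assoc] at hev
      exact (Nat.even_add.1 hev).1 (even_two.mul_right _)
    · exact Even.zero
  · have : c t = t₀ ↔ t = t₀ := by rw [hc.eq_iff, ht₀]
    rw [hcnt, hcnt, hW]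
    simp only [this]
  · rcases Nat.eq_zero_or_pos (∑ b, w b * cnt (fun i => kp i b) t) with h | h
    · left
      have ht : t ≠ t₀ := by
        rintro rfl
        have h1 := (Finset.sum_eq_zero_iff.1 h) a₀ (Finset.mem_univ _)
        rw [hG₀, if_pos rfl] at h1
        rcases Nat.mul_eq_zero.1 h1 with h2 | h2 <;> omega
      rw [hcnt, h, if_neg ht, mul_zero]
    · right
      have h1 : 2 * k ≤ cnt (kapA kp a) t := by
        rw [hcnt]
        exact le_add_right (Nat.le_mul_of_pos_right _ h)
      have h2 : (n : ℝ) ≤ 4 * L * k := by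
        have h3 : n ≤ 4 * L * k := by nlinarith
        exact_mod_cast h3
      calc 1 / (2 * L : ℝ) * n ≤ 2 * k := by
            rw [div_mul_eq_mul_div, one_mul, div_le_iff₀ (by positivity)]
            linarith
        _ ≤ _ := by exact_mod_cast h1

end GoodSequence
/-! ### Walks along a matching of half-edges -/

section Walks

variable {X : Type*} {D : ℕ}

lemma validTd_cons {i : ℕ} {l : List ℕ} : ValidTd (D + 1) (i :: l) ↔
    (1 ≤ i ∧ (l = [] → i ≤ D + 1) ∧ (l ≠ [] → i ≤ D)) ∧ ValidTd (D + 1) l := by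
  cases l with
  | nil => simp [ValidTd]
  | cons j l => simp [ValidTd, List.dropLast_cons_of_ne_nil, List.getLast?_cons_cons, and_assoc]

/-- The half-edge number `i` at a vertex which was entered through the half-edge `o`. -/
def port (o : Option (Fin (D + 1))) (i : ℕ) : Fin (D + 1) :=
  match o with
  | none => if h : i - 1 < D + 1 then ⟨i - 1, h⟩ else 0
  | some j => if h : i - 1 < D then j.succAbove ⟨i - 1, h⟩ else 0

/-- The endpoint, and the half-edge of arrival, of the walk started at `v` with the given word. -/
def walk (m : Equiv.Perm (X × Fin (D + 1))) (v : X) : List ℕ → X × Option (Fin (D + 1))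
  | [] => (v, none)
  | i :: l => ((m ((walk m v l).1, port (walk m v l).2 i)).1,
      some (m ((walk m v l).1, port (walk m v l).2 i)).2)

/-- The half-edge used in the last step of the walk `i :: l`. -/
def out (m : Equiv.Perm (X × Fin (D + 1))) (v : X) (i : ℕ) (l : List ℕ) : X × Fin (D + 1) :=
  ((walk m v l).1, port (walk m v l).2 i)

lemma walk_cons (m : Equiv.Perm (X × Fin (D + 1))) (v : X) (i : ℕ) (l : List ℕ) :
    walk m v (i :: l) = ((m (out m v i l)).1, some (m (out m v i l)).2) := rfl

lemma port_inj {m : Equiv.Perm (X × Fin (D + 1))} {v : X} {i i' : ℕ} {l : List ℕ}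
    (hi : ValidTd (D + 1) (i :: l)) (hi' : ValidTd (D + 1) (i' :: l))
    (h : port (walk m v l).2 i = port (walk m v l).2 i') : i = i' := by
  rw [validTd_cons] at hi hi'
  cases l with
  | nil =>
    simp only [walk, port] at h
    have h1 := hi.1.2.1 rfl
    have h2 := hi'.1.2.1 rfl
    rw [dif_pos (by omega), dif_pos (by omega), Fin.mk.injEq] at h
    omega
  | cons j l =>
    have hw : (walk m v (j :: l)).2 = some (m (out m v j l)).2 := rfl
    rw [hw] at h
    simp only [port] at h
    have h1 := hi.1.2.2 (by simp)
    have h2 := hi'.1.2.2 (by simp)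
    rw [dif_pos (by omega), dif_pos (by omega), Fin.succAbove_right_inj, Fin.mk.injEq] at h
    omega

lemma exists_port {m : Equiv.Perm (X × Fin (D + 1))} {v : X} {l : List ℕ}
    (hl : ValidTd (D + 1) l) (p : Fin (D + 1)) (hp : (walk m v l).2 ≠ some p) :
    ∃ i, ValidTd (D + 1) (i :: l) ∧ port (walk m v l).2 i = p := by
  cases l with
  | nil => exact ⟨p + 1, by rw [validTd_cons]; simp [hl]; omega, by simp [walk, port, p.2]⟩
  | cons j l =>
    have h : (walk m v (j :: l)).2 = some (m (out m v j l)).2 := rfl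
    rw [h] at hp ⊢
    obtain ⟨q, hq⟩ := Fin.exists_succAbove_eq (x := p) (y := (m (out m v j l)).2) (by
      intro h; exact hp (by rw [h]))
    exact ⟨q + 1, by rw [validTd_cons]; simp [hl], by simpa [port] using hq⟩

lemma port_ne {m : Equiv.Perm (X × Fin (D + 1))} {v : X} {i : ℕ} {l : List ℕ}
    (hi : ValidTd (D + 1) (i :: l)) : (walk m v l).2 ≠ some (port (walk m v l).2 i) := by
  rw [validTd_cons] at hi
  cases l with
  | nil => simp [walk]
  | cons j l =>
    have h1 := hi.1.2.2 (by simp)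
    have hw : (walk m v (j :: l)).2 = some (m (out m v j l)).2 := rfl
    rw [hw]
    simp only [port]
    rw [dif_pos (by omega)]
    intro h
    exact Fin.succAbove_ne _ _ (Option.some.inj h).symm

lemma finite_words (D R : ℕ) : {l : List ℕ | ValidTd (D + 1) l ∧ l.length ≤ R}.Finite := by
  refine ((List.finite_length_le (Fin (D + 2)) R).image (List.map Fin.val)).subset ?_
  rintro l ⟨hl, hR⟩
  have h : ∀ i ∈ l, i < D + 2 := by
    intro i hi
    induction l with
    | nil => simp at hi
    | cons j l ih =>
      rw [validTd_cons] at hl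
      rcases List.mem_cons.1 hi with rfl | hi
      · by_cases h0 : l = []
        · have := hl.1.2.1 h0; omega
        · have := hl.1.2.2 h0; omega
      · exact ih hl.2 (by simp at hR; omega) hi
  refine ⟨l.pmap (fun i hi => ⟨i, hi⟩) h, by simpa using hR, ?_⟩
  rw [List.map_pmap]
  simp

/-- The valid words of length at most `R`. -/
def words (D R : ℕ) : Finset (List ℕ) := (finite_words D R).toFinset

lemma mem_words {D R : ℕ} {l : List ℕ} :
    l ∈ words D R ↔ ValidTd (D + 1) l ∧ l.length ≤ R := by simp [words]

/-- A set of words closed under removing the last step. -/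
def TailClosed (Z : Finset (List ℕ)) : Prop := ∀ i l, i :: l ∈ Z → l ∈ Z

lemma tailClosed_words (D R : ℕ) : TailClosed (words D R) := by
  intro i l h
  rw [mem_words] at h ⊢
  exact ⟨(validTd_cons.1 h.1).2, by have := h.2; simp at this; omega⟩

lemma nil_mem_words {D R : ℕ} : [] ∈ words D R := mem_words.2 ⟨validTd_nil, by simp⟩

lemma walk_congr {m m' : Equiv.Perm (X × Fin (D + 1))} {v : X} {Z : Finset (List ℕ)}
    (hZ : TailClosed Z) (h : ∀ i l, i :: l ∈ Z → m' (out m v i l) = m (out m v i l)) :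
    ∀ l ∈ Z, walk m' v l = walk m v l
  | [], _ => rfl
  | i :: l, hl => by
    have ih := walk_congr hZ h l (hZ i l hl)
    have ho : out m' v i l = out m v i l := by rw [out, ih, out]
    rw [walk_cons, walk_cons, ho, h i l hl]

variable [Fintype X]

lemma card_walk_eq_le (m : Equiv.Perm (X × Fin (D + 1))) (hm : IsMat m) (l : List ℕ) (v : X) :
    (Finset.univ.filter fun u => (walk m u l).1 = v).card ≤ (D + 1) ^ l.length := by
  induction l generalizing v with
  | nil =>
    refine le_trans (Finset.card_le_card (t := {v}) fun u hu => ?_) (by simp)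
    simpa [walk] using (Finset.mem_filter.1 hu).2
  | cons i l ih =>
    have hsub : (Finset.univ.filter fun u => (walk m u (i :: l)).1 = v) ⊆
        Finset.univ.biUnion fun p : Fin (D + 1) =>
          Finset.univ.filter fun u => (walk m u l).1 = (m (v, p)).1 := by
      intro u hu
      rw [Finset.mem_filter, walk_cons] at hu
      simp only [Finset.mem_biUnion, Finset.mem_univ, true_and, Finset.mem_filter]
      refine ⟨(m (out m u i l)).2, ?_⟩
      rw [← hu.2, Prod.mk.eta, hm.1]
      rfl
    refine (Finset.card_le_card hsub).trans (Finset.card_biUnion_le.trans ?_)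
    refine (Finset.sum_le_card_nsmul _ _ _ fun p _ => ih _).trans ?_
    simp [pow_succ']

/-- The vertices at which the walks of length at most `R` do not have distinct endpoints. -/
def badV (R : ℕ) (m : Equiv.Perm (X × Fin (D + 1))) : Finset X :=
  Finset.univ.filter fun v => ¬ Set.InjOn (fun l => (walk m v l).1) (words D R)

lemma mem_badV {R : ℕ} {m : Equiv.Perm (X × Fin (D + 1))} {v : X} :
    v ∈ badV R m ↔ ¬ Set.InjOn (fun l => (walk m v l).1) (words D R) := by simp [badV]

end Walks

section Conj

variable {H K : Type*} [Fintype H] {c : K → K} {κ : H → K}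

/-- Conjugation by a transposition. -/
def swapConj (m : Equiv.Perm H) (y g : H) : Equiv.Perm H := Equiv.swap y g * m * Equiv.swap y g

lemma swapConj_apply (m : Equiv.Perm H) (y g h : H) :
    swapConj m y g h = Equiv.swap y g (m (Equiv.swap y g h)) := rfl

lemma swapConj_swapConj (m : Equiv.Perm H) (y g : H) : swapConj (swapConj m y g) y g = m := by
  ext h
  simp [swapConj_apply]

lemma comp_swap {y g : H} (hg : κ g = κ y) (h : H) : κ (Equiv.swap y g h) = κ h := by
  rw [Equiv.swap_apply_def]
  split_ifs with h1 h2
  · rw [h1, hg]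
  · rw [h2, hg]
  · rfl

lemma swapConj_mem_cons {m : Equiv.Perm H} (hm : m ∈ cons c κ) {y g : H} (hg : κ g = κ y) :
    swapConj m y g ∈ cons c κ := by
  rw [mem_cons] at hm ⊢
  refine ⟨by simpa [swapConj] using isMat_conj hm.1 (Equiv.swap y g), fun h => ?_⟩
  rw [swapConj_apply, comp_swap hg, hm.2, comp_swap hg]

lemma swapConj_of_ne {m : Equiv.Perm H} {y g h : H} (h1 : h ≠ y) (h2 : h ≠ g) (h3 : m h ≠ y)
    (h4 : m h ≠ g) : swapConj m y g h = m h := by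
  rw [swapConj_apply, Equiv.swap_apply_of_ne_of_ne h1 h2, Equiv.swap_apply_of_ne_of_ne h3 h4]

lemma swapConj_apply_self {m : Equiv.Perm H} {g h : H} (h1 : m h ≠ h) (h2 : h ≠ g) :
    swapConj m (m h) g h = g := by
  rw [swapConj_apply, Equiv.swap_apply_of_ne_of_ne h1.symm h2, Equiv.swap_apply_left]

lemma swapConj_values {m : Equiv.Perm H} (hm : IsMat m) {y g : H} (n2 : g ≠ m y)
    (n3 : m g ≠ y) : swapConj m y g y = m g ∧ swapConj m y g g = m y ∧
      swapConj m y g (m y) = g ∧ swapConj m y g (m g) = y := by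
  refine ⟨?_, ?_, ?_, ?_⟩
  · rw [swapConj_apply, Equiv.swap_apply_left, Equiv.swap_apply_of_ne_of_ne n3 (hm.2 _)]
  · rw [swapConj_apply, Equiv.swap_apply_right, Equiv.swap_apply_of_ne_of_ne (hm.2 _) n2.symm]
  · rw [swapConj_apply, Equiv.swap_apply_of_ne_of_ne (hm.2 _) n2.symm, hm.1, Equiv.swap_apply_left]
  · rw [swapConj_apply, Equiv.swap_apply_of_ne_of_ne n3 (hm.2 _), hm.1, Equiv.swap_apply_right]

lemma swapConj_self (m : Equiv.Perm H) (y : H) : swapConj m y y = m := by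
  ext h
  rw [swapConj_apply, Equiv.swap_self]
  rfl

lemma card_mul_le_of_inj {α β γ : Type*} {S : Finset α} {T : α → Finset β} {U : Finset γ}
    (f : α → β → γ) (hU : ∀ a ∈ S, ∀ b ∈ T a, f a b ∈ U)
    (hf : ∀ a ∈ S, ∀ b ∈ T a, ∀ a' ∈ S, ∀ b' ∈ T a', f a b = f a' b' → a = a' ∧ b = b') {q : ℕ}
    (hq : ∀ a ∈ S, q ≤ (T a).card) : S.card * q ≤ U.card := by
  have h1 : S.card * q ≤ (S.sigma T).card := by
    rw [Finset.card_sigma, ← smul_eq_mul]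
    exact Finset.card_nsmul_le_sum _ _ _ hq
  refine h1.trans (Finset.card_le_card_of_injOn (fun x => f x.1 x.2) ?_ ?_)
  · rintro ⟨a, b⟩ h
    have h' := Finset.mem_sigma.1 h
    exact hU a h'.1 b h'.2
  · rintro ⟨a, b⟩ h ⟨a', b'⟩ h' hab
    have h1 := Finset.mem_sigma.1 h
    have h2 := Finset.mem_sigma.1 h'
    obtain ⟨rfl, rfl⟩ := hf a h1.1 b h1.2 a' h2.1 b' h2.2 hab
    rfl

end Conj
section Switching

variable {X K : Type*} [Fintype X] {D : ℕ} {c : K → K} {κ : X × Fin (D + 1) → K}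

/-- The half-edge used to arrive at the end of a word, with default value `x`. -/
def outD (m : Equiv.Perm (X × Fin (D + 1))) (v : X) (x : X × Fin (D + 1)) :
    List ℕ → X × Fin (D + 1)
  | [] => x
  | i :: l => out m v i l

/-- The walks along `Z` are injective, and the edge `i'` at the end of `l₀` closes a cycle
arriving at the half-edge `p` at the end of `l`. -/
structure Closes (m : Equiv.Perm (X × Fin (D + 1))) (v : X) (Z : Finset (List ℕ)) (l₀ : List ℕ)
    (i' : ℕ) (l : List ℕ) (p : Fin (D + 1)) : Prop where
  tail : TailClosed Z
  valid : ∀ l ∈ Z, ValidTd (D + 1) l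
  nil : [] ∈ Z
  inj : Set.InjOn (fun l => (walk m v l).1) Z
  mem₀ : l₀ ∈ Z
  valid' : ValidTd (D + 1) (i' :: l₀)
  notMem : i' :: l₀ ∉ Z
  mem : l ∈ Z
  eq : m (out m v i' l₀) = ((walk m v l).1, p)

lemma walk_swapConj {m : Equiv.Perm (X × Fin (D + 1))} (hm : IsMat m) {v : X}
    {Z : Finset (List ℕ)} {l₀ : List ℕ} {i' : ℕ} {l : List ℕ} {p : Fin (D + 1)}
    (h : Closes m v Z l₀ i' l p) {g : X × Fin (D + 1)}
    (hg1 : ∀ w ∈ Z, outD m v (out m v i' l₀) w ≠ g)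
    (hg2 : ∀ w ∈ Z, m (outD m v (out m v i' l₀) w) ≠ g) :
    (∀ w ∈ Z, walk (swapConj m ((walk m v l).1, p) g) v w = walk m v w) ∧
      swapConj m ((walk m v l).1, p) g (out m v i' l₀) = g := by
  rw [← h.eq]
  constructor
  · refine walk_congr h.tail fun i t hit => swapConj_of_ne ?_ (hg1 _ hit) ?_ (hg2 _ hit)
    · intro e
      have e1 : m (out m v i t) = out m v i' l₀ := by rw [e, hm.1]
      have e2 : i :: t = l₀ := h.inj hit h.mem₀ (by
        show (m (out m v i t)).1 = _
        rw [e1]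
        rfl)
      have e3 : (walk m v l₀).2 = some (m (out m v i t)).2 := by rw [← e2]; rfl
      rw [e1] at e3
      exact port_ne h.valid' e3
    · intro e
      have e1 := m.injective e
      have e2 : t = l₀ := h.inj (h.tail _ _ hit) h.mem₀ (by
        have := congrArg Prod.fst e1
        exact this)
      subst e2
      have e3 := port_inj (h.valid _ hit) h.valid' (congrArg Prod.snd e1)
      subst e3
      exact h.notMem hit
  · have h1 : out m v i' l₀ ≠ g := hg1 _ h.nil
    exact swapConj_apply_self (hm.2 _) h1

lemma card_closes_le (v : X) (Z : Finset (List ℕ)) (l₀ : List ℕ) (i' : ℕ) (l : List ℕ)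
    (p : Fin (D + 1)) {q : ℕ} (hq : ∀ t, cnt κ t = 0 ∨ q ≤ cnt κ t) :
    ((cons c κ).filter fun m => Closes m v Z l₀ i' l p).card * (q - 2 * Z.card) ≤
      (cons c κ).card := by
  refine card_mul_le_of_inj
    (T := fun m => (Finset.univ.filter fun g => κ g = κ ((walk m v l).1, p)) \
      (Z.image (outD m v (out m v i' l₀)) ∪ Z.image fun w => m (outD m v (out m v i' l₀) w)))
    (fun m g => swapConj m ((walk m v l).1, p) g) ?_ ?_ ?_
  · intro m hm g hg
    simp only [Finset.mem_sdiff, Finset.mem_filter] at hm hg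
    exact swapConj_mem_cons hm.1 hg.1.2
  · have key : ∀ m ∈ (cons c κ).filter (fun m => Closes m v Z l₀ i' l p), ∀ g ∈
        (Finset.univ.filter fun g => κ g = κ ((walk m v l).1, p)) \
        (Z.image (outD m v (out m v i' l₀)) ∪ Z.image fun w => m (outD m v (out m v i' l₀) w)),
        Closes m v Z l₀ i' l p ∧
        (∀ w ∈ Z, walk (swapConj m ((walk m v l).1, p) g) v w = walk m v w) ∧
      swapConj m ((walk m v l).1, p) g (out m v i' l₀) = g := by
      intro m hm g hg
      simp only [Finset.mem_sdiff, Finset.mem_filter, Finset.mem_union, Finset.mem_image,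
        not_or, not_exists, not_and] at hm hg
      exact ⟨hm.2, walk_swapConj (mem_cons.1 hm.1).1 hm.2 hg.2.1 hg.2.2⟩
    intro m hm g hg m' hm' g' hg' e
    obtain ⟨h, h1, h2⟩ := key m hm g hg
    obtain ⟨-, h1', h2'⟩ := key m' hm' g' hg'
    have hw : ∀ w ∈ Z, walk m v w = walk m' v w := fun w hw => by
      rw [← h1 w hw, ← h1' w hw, e]
    have ho : out m v i' l₀ = out m' v i' l₀ := by rw [out, out, hw _ h.mem₀]
    have hg : g = g' := by rw [← h2, ← h2', e, ho]
    refine ⟨?_, hg⟩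
    rw [← swapConj_swapConj m ((walk m v l).1, p) g, e, hw _ h.mem, hg, swapConj_swapConj]
  · intro m hm
    refine le_trans ?_ (Finset.le_card_sdiff _ _)
    have h1 := Finset.card_union_le (Z.image (outD m v (out m v i' l₀)))
      (Z.image fun w => m (outD m v (out m v i' l₀) w))
    have h2 := Finset.card_image_le (s := Z) (f := outD m v (out m v i' l₀))
    have h3 := Finset.card_image_le (s := Z) (f := fun w => m (outD m v (out m v i' l₀) w))
    have h4 : q ≤ (Finset.univ.filter fun g => κ g = κ ((walk m v l).1, p)).card := by
      refine (hq (κ ((walk m v l).1, p))).resolve_left ?_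
      rw [cnt, Finset.card_eq_zero, Finset.filter_eq_empty_iff]
      intro h
      exact h (Finset.mem_univ ((walk m v l).1, p)) rfl
    omega

lemma exists_closes {R : ℕ} {m : Equiv.Perm (X × Fin (D + 1))} {v : X} (hv : v ∈ badV R m) :
    ∃ Z ∈ (words D R).powerset, ∃ l₀ ∈ words D R, ∃ i' ∈ Finset.range (D + 2), ∃ l ∈ words D R,
      ∃ p, Closes m v Z l₀ i' l p := by
  rw [mem_badV] at hv
  have hne : ((words D R).powerset.filter fun Z => TailClosed Z ∧ [] ∈ Z ∧
      Set.InjOn (fun l => (walk m v l).1) Z).Nonempty := by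
    refine ⟨{[]}, ?_⟩
    rw [Finset.mem_filter, Finset.mem_powerset, Finset.singleton_subset_iff]
    refine ⟨nil_mem_words, ?_, by simp, by simp⟩
    intro i l h
    simp at h
  obtain ⟨Z, hZ, hmax⟩ := Finset.exists_max_image _ Finset.card hne
  simp only [Finset.mem_filter, Finset.mem_powerset] at hZ hmax
  obtain ⟨hZR, ht, hnil, hinj⟩ := hZ
  have hne' : (words D R \ Z).Nonempty := by
    rw [Finset.nonempty_iff_ne_empty, Ne, Finset.sdiff_eq_empty_iff_subset]
    intro h
    rw [← hZR.antisymm h] at hv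
    exact hv hinj
  obtain ⟨w, hw, hmin⟩ := Finset.exists_min_image _ List.length hne'
  simp only [Finset.mem_sdiff] at hw hmin
  cases w with
  | nil => exact (hw.2 hnil).elim
  | cons i' l₀ =>
    have hl₀ : l₀ ∈ Z := by
      by_contra h
      have := hmin l₀ ⟨tailClosed_words D R _ _ hw.1, h⟩
      simp at this
    have hval := (mem_words.1 hw.1).1
    have hni : ¬ Set.InjOn (fun l => (walk m v l).1) (insert (i' :: l₀) Z : Finset (List ℕ)) := by
      intro hinj'
      have := hmax (insert (i' :: l₀) Z) ⟨Finset.insert_subset hw.1 hZR, ?_,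
        Finset.mem_insert_of_mem hnil, hinj'⟩
      · rw [Finset.card_insert_of_notMem hw.2] at this
        omega
      · intro i l h
        rcases Finset.mem_insert.1 h with h | h
        · rw [(List.cons.inj h).2]
          exact Finset.mem_insert_of_mem hl₀
        · exact Finset.mem_insert_of_mem (ht _ _ h)
    rw [Finset.coe_insert, Set.injOn_insert (by simpa using hw.2)] at hni
    have : (walk m v (i' :: l₀)).1 ∈ (fun l => (walk m v l).1) '' (Z : Set (List ℕ)) := by
      by_contra h
      exact hni ⟨hinj, h⟩
    obtain ⟨l, hl, he⟩ := this
    refine ⟨Z, Finset.mem_powerset.2 hZR, l₀, hZR hl₀, i', ?_, l, hZR hl,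
      (m (out m v i' l₀)).2, ⟨ht, fun l hl => (mem_words.1 (hZR hl)).1, hnil, hinj, hl₀, hval,
        hw.2, hl, ?_⟩⟩
    · rw [validTd_cons] at hval
      rw [Finset.mem_range]
      by_cases h0 : l₀ = []
      · have := hval.1.2.1 h0; omega
      · have := hval.1.2.2 h0; omega
    · simp only at he
      rw [he]
      rfl

/-- The number of configurations in `exists_closes`. -/
def numCloses (D R : ℕ) : ℕ :=
  2 ^ (words D R).card * (words D R).card * (D + 2) * (words D R).card * (D + 1)

lemma card_badV_le (R : ℕ) (v : X) {q : ℕ} (hq : ∀ t, cnt κ t = 0 ∨ q ≤ cnt κ t) :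
    ((cons c κ).filter fun m => v ∈ badV R m).card * (q - 2 * (words D R).card) ≤
      numCloses D R * (cons c κ).card := by
  set J := (words D R).powerset ×ˢ words D R ×ˢ Finset.range (D + 2) ×ˢ words D R ×ˢ
    (Finset.univ : Finset (Fin (D + 1))) with hJ
  have hsub : ((cons c κ).filter fun m => v ∈ badV R m) ⊆ J.biUnion fun j =>
      (cons c κ).filter fun m => Closes m v j.1 j.2.1 j.2.2.1 j.2.2.2.1 j.2.2.2.2 := by
    intro m hm
    rw [Finset.mem_filter] at hm
    obtain ⟨Z, hZ, l₀, hl₀, i', hi', l, hl, p, h⟩ := exists_closes hm.2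
    rw [Finset.mem_biUnion]
    refine ⟨(Z, l₀, i', l, p), ?_, Finset.mem_filter.2 ⟨hm.1, h⟩⟩
    simp only [hJ, Finset.mem_product]
    exact ⟨hZ, hl₀, hi', hl, Finset.mem_univ _⟩
  have hJc : J.card = numCloses D R := by
    simp [hJ, numCloses, mul_assoc]
  calc _ ≤ (∑ j ∈ J, ((cons c κ).filter fun m =>
        Closes m v j.1 j.2.1 j.2.2.1 j.2.2.2.1 j.2.2.2.2).card) * (q - 2 * (words D R).card) :=
      Nat.mul_le_mul_right _ ((Finset.card_le_card hsub).trans Finset.card_biUnion_le)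
    _ = ∑ j ∈ J, ((cons c κ).filter fun m =>
        Closes m v j.1 j.2.1 j.2.2.1 j.2.2.2.1 j.2.2.2.2).card * (q - 2 * (words D R).card) := by
      rw [Finset.sum_mul]
    _ ≤ ∑ j ∈ J, (cons c κ).card := by
      refine Finset.sum_le_sum fun j hj => ?_
      refine le_trans (Nat.mul_le_mul_left _ ?_) (card_closes_le v j.1 j.2.1 j.2.2.1 j.2.2.2.1
        j.2.2.2.2 hq)
      have := Finset.card_le_card (Finset.mem_powerset.1 (Finset.mem_product.1 hj).1)
      omega
    _ = _ := by rw [Finset.sum_const, hJc, smul_eq_mul]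

/-- Half of the consistent matchings have a bounded number of bad vertices. -/
lemma card_cons_le_two_mul {R : ℕ} {q C : ℕ} (hq : ∀ t, cnt κ t = 0 ∨ q ≤ cnt κ t)
    (hC : 2 * numCloses D R * Fintype.card X ≤ (C + 1) * (q - 2 * (words D R).card))
    (hq0 : 2 * (words D R).card < q) :
    (cons c κ).card ≤ 2 * ((cons c κ).filter fun m => (badV R m).card ≤ C).card := by
  set N := (cons c κ).card with hN
  set B := (cons c κ).filter fun m => ¬ (badV R m).card ≤ C with hB
  have h1 : B.card * (C + 1) ≤ ∑ m ∈ cons c κ, (badV R m).card := by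
    calc B.card * (C + 1) = ∑ m ∈ B, (C + 1) := by simp
      _ ≤ ∑ m ∈ B, (badV R m).card := Finset.sum_le_sum fun m hm => by
        have := (Finset.mem_filter.1 hm).2
        omega
      _ ≤ _ := Finset.sum_le_sum_of_subset (Finset.filter_subset _ _)
  have h2 : ∑ m ∈ cons c κ, (badV R m).card =
      ∑ v : X, ((cons c κ).filter fun m => v ∈ badV R m).card := by
    simp only [Finset.card_eq_sum_ones, Finset.sum_filter]
    rw [Finset.sum_comm]
    refine Finset.sum_congr rfl fun m _ => ?_
    rw [← Finset.sum_filter]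
    congr 1
    ext v
    simp
  have h3 : (∑ v : X, ((cons c κ).filter fun m => v ∈ badV R m).card) *
      (q - 2 * (words D R).card) ≤ Fintype.card X * (numCloses D R * N) := by
    rw [Finset.sum_mul, ← smul_eq_mul (Fintype.card X), ← Finset.card_univ, ← Finset.sum_const]
    exact Finset.sum_le_sum fun v _ => card_badV_le R v hq
  set q' := q - 2 * (words D R).card with hq'
  have hq'0 : 0 < q' := by omega
  have h4 : 2 * B.card * ((C + 1) * q') ≤ N * ((C + 1) * q') :=
    calc 2 * B.card * ((C + 1) * q') = 2 * ((B.card * (C + 1)) * q') := by ring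
      _ ≤ 2 * (Fintype.card X * (numCloses D R * N)) :=
        Nat.mul_le_mul_left _ ((Nat.mul_le_mul_right _ (h2 ▸ h1)).trans h3)
      _ = N * (2 * numCloses D R * Fintype.card X) := by ring
      _ ≤ _ := Nat.mul_le_mul_left _ hC
  have h5 := Nat.le_of_mul_le_mul_right h4 (by positivity)
  have h6 := Finset.card_filter_add_card_filter_not (s := cons c κ)
    (fun m => (badV R m).card ≤ C)
  rw [← hN, ← hB] at h6
  omega

end Switching
section Repair

variable {X K : Type*} [Fintype X] {D : ℕ} {c : K → K} {κ : X × Fin (D + 1) → K}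

/-- The half-edges belonging to loops or multiple edges. -/
def badH (m : Equiv.Perm (X × Fin (D + 1))) : Finset (X × Fin (D + 1)) :=
  Finset.univ.filter fun h => (m h).1 = h.1 ∨ ∃ h', h' ≠ h ∧ h'.1 = h.1 ∧ (m h').1 = (m h).1

lemma mem_badH {m : Equiv.Perm (X × Fin (D + 1))} {h : X × Fin (D + 1)} :
    h ∈ badH m ↔ (m h).1 = h.1 ∨ ∃ h', h' ≠ h ∧ h'.1 = h.1 ∧ (m h').1 = (m h).1 := by
  simp [badH]

lemma mem_badV_of_mem_badH {R : ℕ} (hR : 1 ≤ R) {m : Equiv.Perm (X × Fin (D + 1))}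
    {h : X × Fin (D + 1)} (hh : h ∈ badH m) : h.1 ∈ badV R m := by
  rw [mem_badH] at hh
  rw [mem_badV]
  intro hinj
  have hw : ∀ p : Fin (D + 1), [(p : ℕ) + 1] ∈ words D R := fun p => by
    rw [mem_words, validTd_cons]
    refine ⟨⟨⟨by omega, fun _ => by omega, by simp⟩, validTd_nil⟩, by simpa using hR⟩
  have hpos : ∀ p : Fin (D + 1), (walk m h.1 [(p : ℕ) + 1]).1 = (m (h.1, p)).1 := fun p => by
    have : out m h.1 ((p : ℕ) + 1) [] = (h.1, p) := by simp [out, walk, port, p.2]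
    rw [walk_cons, this]
  rcases hh with hh | ⟨h', hne, h1, h2⟩
  · have := hinj (hw h.2) (nil_mem_words) (by simpa [walk] using (hpos h.2).trans hh)
    simp at this
  · have := hinj (hw h.2) (hw h'.2) (by
      simp only
      rw [hpos, hpos, Prod.mk.eta, ← h1, Prod.mk.eta, h2])
    simp only [List.cons.injEq, and_true, add_left_inj] at this
    exact hne (Prod.ext h1 (Fin.ext this.symm))

lemma card_badH_le {R : ℕ} (hR : 1 ≤ R) (m : Equiv.Perm (X × Fin (D + 1))) :
    (badH m).card ≤ (badV R m).card * (D + 1) := by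
  refine le_trans (Finset.card_le_card (t := badV R m ×ˢ Finset.univ) fun h hh => ?_) (by simp)
  exact Finset.mem_product.2 ⟨mem_badV_of_mem_badH hR hh, Finset.mem_univ _⟩

/-- The vertices at distance at most one from the edge of `y`. -/
def nearEdge (m : Equiv.Perm (X × Fin (D + 1))) (y : X × Fin (D + 1)) : Finset X :=
  ({y.1, (m y).1} ∪ Finset.univ.image fun p => (m (y.1, p)).1) ∪
    Finset.univ.image fun p => (m ((m y).1, p)).1

lemma card_nearEdge_le (m : Equiv.Perm (X × Fin (D + 1))) (y : X × Fin (D + 1)) :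
    (nearEdge m y).card ≤ 2 * D + 4 := by
  have h1 := Finset.card_union_le ({y.1, (m y).1} ∪ Finset.univ.image fun p => (m (y.1, p)).1)
    (Finset.univ.image fun p => (m ((m y).1, p)).1)
  have h2 := Finset.card_union_le {y.1, (m y).1} (Finset.univ.image fun p => (m (y.1, p)).1)
  have h3 := Finset.card_le_two (a := y.1) (b := (m y).1)
  have h4 := Finset.card_image_le (s := Finset.univ) (f := fun p => (m (y.1, p)).1)
  have h5 := Finset.card_image_le (s := Finset.univ) (f := fun p => (m ((m y).1, p)).1)
  simp only [Finset.card_univ, Fintype.card_fin] at h4 h5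
  unfold nearEdge
  omega

lemma notMem_nearEdge {m : Equiv.Perm (X × Fin (D + 1))} {y : X × Fin (D + 1)} {x : X}
    (h : x ∉ nearEdge m y) : x ≠ y.1 ∧ x ≠ (m y).1 ∧ (∀ h, h.1 = y.1 → (m h).1 ≠ x) ∧
      ∀ h, h.1 = (m y).1 → (m h).1 ≠ x := by
  simp only [nearEdge, Finset.mem_union, Finset.mem_insert, Finset.mem_singleton,
    Finset.mem_image, Finset.mem_univ, true_and, not_or, not_exists] at h
  refine ⟨h.1.1.1, h.1.1.2, fun h' e => ?_, fun h' e => ?_⟩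
  · have := h.1.2 h'.2
    rwa [← e, Prod.mk.eta] at this
  · have := h.2 h'.2
    rwa [← e, Prod.mk.eta] at this

lemma badH_swapConj {m : Equiv.Perm (X × Fin (D + 1))} (hm : IsMat m) {y g : X × Fin (D + 1)}
    (hg : g ∉ badH m) (h1 : g.1 ∉ nearEdge m y) (h2 : (m g).1 ∉ nearEdge m y) :
    badH (swapConj m y g) ⊆ (badH m).erase y := by
  obtain ⟨a1, a2, a3, a4⟩ := notMem_nearEdge h1
  obtain ⟨b1, b2, b3, b4⟩ := notMem_nearEdge h2
  have hgl : g.1 ≠ (m g).1 := fun e => hg (mem_badH.2 (Or.inl e.symm))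
  have n1 : g ≠ y := fun e => a1 (by rw [e])
  have n2 : g ≠ m y := fun e => a2 (by rw [e])
  have n3 : m g ≠ y := fun e => b1 (by rw [e])
  have n4 : m g ≠ m y := fun e => b2 (by rw [e])
  obtain ⟨s1, s2, s3, s4⟩ := swapConj_values hm n2 n3
  have s5 : ∀ h, h ≠ y → h ≠ g → h ≠ m y → h ≠ m g → swapConj m y g h = m h :=
    fun h k1 k2 k3 k4 => swapConj_of_ne k1 k2 (fun e => k3 (by rw [← e, hm.1]))
      (fun e => k4 (by rw [← e, hm.1]))
  generalize swapConj m y g = m' at *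
  have key : ∀ t h, t = y ∨ t = g ∨ t = m y ∨ t = m g → h ≠ t → h.1 = t.1 →
      (m' h).1 ≠ (m' t).1 := by
    intro t h ht hne he
    by_cases hT : h = y ∨ h = g ∨ h = m y ∨ h = m g
    · rcases ht with rfl | rfl | rfl | rfl <;> rcases hT with rfl | rfl | rfl | rfl <;>
        simp only [s1, s2, s3, s4, ne_eq, not_true_eq_false] at * <;> grind
    · simp only [not_or] at hT
      have := s5 h hT.1 hT.2.1 hT.2.2.1 hT.2.2.2
      rw [this]
      have c1 := a4 (m h)
      have c2 := b3 (m h)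
      rw [hm.1] at c1 c2
      rcases ht with rfl | rfl | rfl | rfl <;> grind
  have key' : ∀ t, t = y ∨ t = g ∨ t = m y ∨ t = m g → (m' t).1 ≠ t.1 := by
    rintro t (rfl | rfl | rfl | rfl) <;> grind
  intro h hh
  rw [mem_badH] at hh
  have hT : ¬ (h = y ∨ h = g ∨ h = m y ∨ h = m g) := by
    intro hT
    rcases hh with hh | ⟨h', e1, e2, e3⟩
    · exact key' h hT hh
    · exact key h h' hT e1 e2 e3
  have hT2 := hT
  simp only [not_or] at hT2
  rw [Finset.mem_erase, mem_badH]
  refine ⟨hT2.1, ?_⟩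
  rw [s5 h hT2.1 hT2.2.1 hT2.2.2.1 hT2.2.2.2] at hh
  refine hh.imp_right ?_
  rintro ⟨h', e1, e2, e3⟩
  have hT' : ¬ (h' = y ∨ h' = g ∨ h' = m y ∨ h' = m g) := fun hT' =>
    key h' h hT' e1.symm e2.symm (by
      rw [s5 h hT2.1 hT2.2.1 hT2.2.2.1 hT2.2.2.2, e3])
  simp only [not_or] at hT'
  rw [s5 h' hT'.1 hT'.2.1 hT'.2.2.1 hT'.2.2.2] at e3
  exact ⟨h', e1, e2, e3⟩

lemma exists_repair {m : Equiv.Perm (X × Fin (D + 1))} (hm : m ∈ cons c κ)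
    (y : X × Fin (D + 1)) {q : ℕ} (hq : ∀ t, cnt κ t = 0 ∨ q ≤ cnt κ t)
    (hq' : 2 * ((2 * D + 4) * (D + 1)) + (badH m).card < q) :
    ∃ g, κ g = κ y ∧ g ∉ badH m ∧ g.1 ∉ nearEdge m y ∧ (m g).1 ∉ nearEdge m y := by
  rw [mem_cons] at hm
  set N := nearEdge m y ×ˢ (Finset.univ : Finset (Fin (D + 1))) with hN
  have hNc : N.card ≤ (2 * D + 4) * (D + 1) := by
    rw [hN, Finset.card_product]
    simpa using Nat.mul_le_mul_right (D + 1) (card_nearEdge_le m y)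
  have h1 : q ≤ (Finset.univ.filter fun g => κ g = κ y).card := by
    refine (hq (κ y)).resolve_left ?_
    rw [cnt, Finset.card_eq_zero, Finset.filter_eq_empty_iff]
    intro h
    exact h (Finset.mem_univ y) rfl
  have h2 : (N ∪ N.image m ∪ badH m).card < (Finset.univ.filter fun g => κ g = κ y).card := by
    have e1 := Finset.card_union_le (N ∪ N.image m) (badH m)
    have e2 := Finset.card_union_le N (N.image m)
    have e3 := Finset.card_image_le (s := N) (f := m)
    omega
  obtain ⟨g, hg, hg'⟩ := Finset.exists_mem_notMem_of_card_lt_card h2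
  simp only [Finset.mem_union, not_or] at hg'
  refine ⟨g, (Finset.mem_filter.1 hg).2, hg'.2, fun h => hg'.1.1 ?_, fun h => hg'.1.2 ?_⟩
  · exact Finset.mem_product.2 ⟨h, Finset.mem_univ _⟩
  · exact Finset.mem_image.2 ⟨m g, Finset.mem_product.2 ⟨h, Finset.mem_univ _⟩, hm.1.1 g⟩

/-- Bound on the number of vertices which become bad after one repair. -/
def numSpoil (D R : ℕ) : ℕ := (words D R).card * (4 * (D + 1) ^ R)

lemma card_badV_swapConj_le {m : Equiv.Perm (X × Fin (D + 1))} (hm : IsMat m) (R : ℕ)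
    (y g : X × Fin (D + 1)) :
    (badV R (swapConj m y g)).card ≤ (badV R m).card + numSpoil D R := by
  set T : Finset X := {y.1, g.1, (m y).1, (m g).1} with hT
  have hTc : T.card ≤ 4 := Finset.card_le_four
  have hsub : badV R (swapConj m y g) ⊆ badV R m ∪ (words D R).biUnion fun l =>
      T.biUnion fun x => Finset.univ.filter fun u => (walk m u l).1 = x := by
    intro u hu
    by_contra hcon
    simp only [Finset.mem_union, Finset.mem_biUnion, Finset.mem_filter, Finset.mem_univ, true_and,
      not_or, not_exists, not_and] at hcon
    obtain ⟨c1, c2⟩ := hcon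
    have hw := walk_congr (m := m) (m' := swapConj m y g) (v := u) (tailClosed_words D R) (by
      intro i l hl
      have h3 := c2 l (tailClosed_words D R i l hl)
      refine swapConj_of_ne (fun e => ?_) (fun e => ?_) (fun e => ?_) fun e => ?_
      · exact h3 y.1 (by simp [hT]) (congrArg Prod.fst e)
      · exact h3 g.1 (by simp [hT]) (congrArg Prod.fst e)
      · refine h3 (m y).1 (by simp [hT]) ?_
        rw [← e, hm.1]; rfl
      · refine h3 (m g).1 (by simp [hT]) ?_
        rw [← e, hm.1]; rfl)
    rw [mem_badV] at hu c1
    rw [not_not] at c1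
    exact hu (c1.congr fun l hl => by simp only; rw [hw l hl])
  refine (Finset.card_le_card hsub).trans ((Finset.card_union_le _ _).trans ?_)
  refine Nat.add_le_add_left ?_ _
  refine Finset.card_biUnion_le_card_mul _ _ _ fun l hl => ?_
  refine (Finset.card_biUnion_le_card_mul _ _ ((D + 1) ^ R) fun x _ => ?_).trans
    (Nat.mul_le_mul_right _ hTc)
  exact (card_walk_eq_le m hm l x).trans
    (Nat.pow_le_pow_right (by omega) (mem_words.1 hl).2)

/-- The consistent matchings with few bad half-edges and few bad vertices. -/
def fewBad (c : K → K) (κ : X × Fin (D + 1) → K) (R j C : ℕ) :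
    Finset (Equiv.Perm (X × Fin (D + 1))) :=
  (cons c κ).filter fun m => (badH m).card ≤ j ∧ (badV R m).card ≤ C

lemma mem_fewBad {R j C : ℕ} {m : Equiv.Perm (X × Fin (D + 1))} : m ∈ fewBad c κ R j C ↔
    m ∈ cons c κ ∧ (badH m).card ≤ j ∧ (badV R m).card ≤ C := by simp [fewBad]

lemma card_fewBad_succ_le [Nonempty X] {R j C q : ℕ} (hq : ∀ t, cnt κ t = 0 ∨ q ≤ cnt κ t)
    (hq' : 2 * ((2 * D + 4) * (D + 1)) + (j + 1) < q) :
    (fewBad c κ R (j + 1) C).card ≤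
      (Fintype.card X * (D + 1)) ^ 2 * (fewBad c κ R j (C + numSpoil D R)).card := by
  have hsub : fewBad c κ R (j + 1) C ⊆
      (Finset.univ : Finset ((X × Fin (D + 1)) × (X × Fin (D + 1)))).biUnion fun z =>
        (fewBad c κ R j (C + numSpoil D R)).image fun m => swapConj m z.1 z.2 := by
    intro m hm
    rw [mem_fewBad] at hm
    obtain ⟨hmc, hm1, hm2⟩ := hm
    simp only [Finset.mem_biUnion, Finset.mem_univ, true_and, Finset.mem_image]
    rcases (badH m).eq_empty_or_nonempty with h0 | ⟨y, hy⟩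
    · refine ⟨(Classical.arbitrary _, Classical.arbitrary _), m,
        mem_fewBad.2 ⟨hmc, by simp [h0], by omega⟩, swapConj_self _ _⟩
    · obtain ⟨g, hg, hg1, hg2, hg3⟩ := exists_repair hmc y hq (by omega)
      refine ⟨(y, g), swapConj m y g, mem_fewBad.2 ⟨swapConj_mem_cons hmc hg, ?_, ?_⟩,
        swapConj_swapConj _ _ _⟩
      · have e1 := Finset.card_le_card (badH_swapConj (mem_cons.1 hmc).1 hg1 hg2 hg3)
        rw [Finset.card_erase_of_mem hy] at e1
        omega
      · exact (card_badV_swapConj_le (mem_cons.1 hmc).1 R y g).trans (by omega)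
  refine (Finset.card_le_card hsub).trans ?_
  refine (Finset.card_biUnion_le_card_mul _ _ _ fun z _ => Finset.card_image_le).trans ?_
  refine Nat.mul_le_mul_right _ (le_of_eq ?_)
  simp [sq]

lemma card_fewBad_le [Nonempty X] {R j C q : ℕ} (hq : ∀ t, cnt κ t = 0 ∨ q ≤ cnt κ t)
    (hq' : 2 * ((2 * D + 4) * (D + 1)) + j < q) :
    (fewBad c κ R j C).card ≤
      ((Fintype.card X * (D + 1)) ^ 2) ^ j * (fewBad c κ R 0 (C + j * numSpoil D R)).card := by
  induction j generalizing C with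
  | zero => simp
  | succ j ih =>
    refine (card_fewBad_succ_le hq hq').trans ?_
    refine (Nat.mul_le_mul_left _ (ih (C := C + numSpoil D R) (by omega))).trans (le_of_eq ?_)
    rw [pow_succ' _ j, mul_assoc, add_assoc, Nat.succ_mul, Nat.add_comm (j * _)]

end Repair

/-- A positive proportion, up to a polynomial factor, of the consistent matchings are simple with
a bounded number of bad vertices. -/
theorem card_cons_le_card_simple (D R : ℕ) (hR : 1 ≤ R) {ρ : ℝ} (hρ : 0 < ρ) :
    ∃ b C n₀ : ℕ, ∀ n ≥ n₀, ∀ {K : Type} (c : K → K) (κ : Fin n × Fin (D + 1) → K),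
      (∀ t, cnt κ t = 0 ∨ ρ * n ≤ cnt κ t) →
      (cons c κ).card ≤ 2 * (((n * (D + 1)) ^ 2) ^ b * (fewBad c κ R 0 C).card) := by
  set C := Nat.ceil (4 * numCloses D R / ρ) with hC
  set b := C * (D + 1) with hb
  set B := 2 * ((2 * D + 4) * (D + 1)) + b + 2 * (words D R).card with hB
  refine ⟨b, C + b * numSpoil D R, Nat.ceil (2 * (B + 1) / ρ) + 1, fun n hn K c κ hκ => ?_⟩
  have hn1 : 2 * (B + 1) / ρ ≤ n := (Nat.le_ceil _).trans (Nat.cast_le.2 (by omega))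
  rw [div_le_iff₀ hρ] at hn1
  have : Nonempty (Fin n) := ⟨⟨0, by omega⟩⟩
  set q := Nat.ceil (ρ * n) with hq
  have hκ' : ∀ t, cnt κ t = 0 ∨ q ≤ cnt κ t := fun t => (hκ t).imp_right fun h => Nat.ceil_le.2 h
  have hqn : ρ * n ≤ q := Nat.le_ceil _
  have hqB : 2 * (B + 1) ≤ q := by
    have : (2 * (B + 1) : ℝ) ≤ q := by linarith
    exact_mod_cast this
  have h1 := card_cons_le_two_mul (c := c) (R := R) (C := C) hκ' (by
    rw [Fintype.card_fin]
    have hC' : 4 * numCloses D R / ρ ≤ C := Nat.le_ceil _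
    rw [div_le_iff₀ hρ] at hC'
    have hsub : 2 * (q - 2 * (words D R).card) ≥ q := by omega
    have hsub' : (2 * ((q - 2 * (words D R).card : ℕ) : ℝ)) ≥ q := by exact_mod_cast hsub
    have : (2 * numCloses D R * n : ℝ) ≤ (C + 1) * ((q - 2 * (words D R).card : ℕ) : ℝ) := by
      have hn0 : (0 : ℝ) ≤ n := Nat.cast_nonneg n
      have hC0 : (0 : ℝ) ≤ C := Nat.cast_nonneg C
      nlinarith [mul_le_mul_of_nonneg_left hsub' hC0, mul_le_mul_of_nonneg_left hqn hC0,
        mul_le_mul_of_nonneg_right hC' hn0]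
    exact_mod_cast this) (by omega)
  refine h1.trans (Nat.mul_le_mul_left _ ?_)
  have h2 : ((cons c κ).filter fun m => (badV R m).card ≤ C) ⊆ fewBad c κ R b C := by
    intro m hm
    rw [Finset.mem_filter] at hm
    exact mem_fewBad.2 ⟨hm.1, (card_badH_le hR m).trans (Nat.mul_le_mul_right _ hm.2), hm.2⟩
  refine (Finset.card_le_card h2).trans ?_
  have h3 := card_fewBad_le (c := c) (R := R) (j := b) (C := C) hκ' (by omega)
  rwa [Fintype.card_fin] at h3
/-! ### Simple matchings and regular graphs -/

section Graphs

variable {X : Type*} {D : ℕ}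

/-- A matching of half-edges which produces a simple graph. -/
structure IsSimp (m : Equiv.Perm (X × Fin (D + 1))) : Prop where
  invol : ∀ h, m (m h) = h
  loop : ∀ h, (m h).1 ≠ h.1
  inj : ∀ v p q, (m (v, p)).1 = (m (v, q)).1 → p = q

lemma isSimp_iff [Fintype X] {m : Equiv.Perm (X × Fin (D + 1))} :
    IsSimp m ↔ IsMat m ∧ (badH m).card ≤ 0 := by
  rw [Nat.le_zero, Finset.card_eq_zero, Finset.eq_empty_iff_forall_notMem]
  constructor
  · rintro ⟨h1, h2, h3⟩
    refine ⟨⟨h1, fun h he => h2 h (congrArg Prod.fst he)⟩, ?_⟩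
    rintro ⟨v, p⟩ hb
    rw [mem_badH] at hb
    rcases hb with hb | ⟨⟨w, q⟩, hne, hw, he⟩
    · exact h2 _ hb
    · obtain rfl : w = v := hw
      exact hne (by rw [h3 _ _ _ he])
  · rintro ⟨hm, hb⟩
    refine ⟨hm.1, fun h he => hb h (mem_badH.2 (Or.inl he)), fun v p q he => ?_⟩
    by_contra hne
    exact hb (v, p) (mem_badH.2 (Or.inr ⟨(v, q), by simpa using Ne.symm hne, rfl, he.symm⟩))

/-- The graph produced by a matching of half-edges. -/
def graphOf (m : Equiv.Perm (X × Fin (D + 1))) (hm : IsSimp m) : SimpleGraph X where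
  Adj v w := ∃ p, (m (v, p)).1 = w
  symm := by
    constructor
    rintro v w ⟨p, rfl⟩
    exact ⟨(m (v, p)).2, by rw [Prod.mk.eta, hm.invol]⟩
  loopless := by
    constructor
    rintro v ⟨p, h⟩
    exact hm.loop _ h

/-- The regular graphs with their half-edges numbered. -/
def simpEquiv (G : SimpleGraph X) :
    {m : Equiv.Perm (X × Fin (D + 1)) // ∃ hm : IsSimp m, graphOf m hm = G} ≃
      {e : ∀ v, Fin (D + 1) → G.neighborSet v // ∀ v, Function.Bijective (e v)} where
  toFun m := ⟨fun v p => ⟨(m.1 (v, p)).1, by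
    obtain ⟨m, hm, rfl⟩ := m
    exact ⟨p, rfl⟩⟩, fun v => by
    obtain ⟨m, hm, rfl⟩ := m
    refine ⟨fun p q h => hm.inj v p q (congrArg Subtype.val h), ?_⟩
    rintro ⟨w, p, rfl⟩
    exact ⟨p, rfl⟩⟩
  invFun e :=
    have adj : ∀ v p, G.Adj v (e.1 v p).1 := fun v p => (e.1 v p).2
    let m : X × Fin (D + 1) → X × Fin (D + 1) := fun h =>
      ((e.1 h.1 h.2).1, (Equiv.ofBijective _ (e.2 (e.1 h.1 h.2).1)).symm ⟨h.1, (adj h.1 h.2).symm⟩)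
    have key : ∀ v p, (e.1 (m (v, p)).1 (m (v, p)).2).1 = v := fun v p =>
      congrArg Subtype.val ((Equiv.ofBijective _ (e.2 (e.1 v p).1)).apply_symm_apply
        ⟨v, (adj v p).symm⟩)
    have hm : Function.Involutive m := by
      rintro ⟨v, p⟩
      have h1 : (m (m (v, p))).1 = v := key v p
      refine Prod.ext h1 ((e.2 v).1 (Subtype.ext ?_))
      have h2 := key (m (v, p)).1 (m (v, p)).2
      rw [Prod.mk.eta] at h2
      have h3 : ∀ u : X × Fin (D + 1), u.1 = v → (e.1 u.1 u.2).1 = (e.1 v u.2).1 := by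
        rintro ⟨u, q⟩ rfl
        rfl
      rw [h3 _ h1] at h2
      exact h2
    ⟨hm.toPerm, ⟨hm, fun h he => (adj h.1 h.2).ne he.symm, fun v p q h =>
      (e.2 v).1 (Subtype.ext h)⟩, by
      ext v w
      constructor
      · rintro ⟨p, rfl⟩
        exact adj v p
      · intro h
        obtain ⟨p, hp⟩ := (e.2 v).2 ⟨w, h⟩
        exact ⟨p, congrArg Subtype.val hp⟩⟩
  left_inv := by
    rintro ⟨m, hm, rfl⟩
    apply Subtype.ext
    ext1 h
    refine Prod.ext rfl ?_
    refine (Equiv.symm_apply_eq _).2 (Subtype.ext ?_)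
    change h.1 = (m ((m h).1, (m h).2)).1
    rw [Prod.mk.eta, hm.invol]
  right_inv := by
    rintro ⟨e, he⟩
    rfl

lemma card_simpEquiv [Fintype X] (G : SimpleGraph X)
    (hG : ∀ v, (G.neighborSet v).ncard = D + 1) :
    Nat.card {m : Equiv.Perm (X × Fin (D + 1)) // ∃ hm : IsSimp m, graphOf m hm = G}
      = ((D + 1).factorial) ^ Fintype.card X := by
  have e1 : {e : ∀ v, Fin (D + 1) → G.neighborSet v // ∀ v, Function.Bijective (e v)} ≃
      ∀ v, (Fin (D + 1) ≃ G.neighborSet v) :=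
    ⟨fun e v => Equiv.ofBijective _ (e.2 v), fun e => ⟨fun v => e v, fun v => (e v).bijective⟩,
      fun e => rfl, fun e => by ext; rfl⟩
  rw [Nat.card_congr ((simpEquiv G).trans e1), Nat.card_pi]
  have : ∀ v, Nat.card (Fin (D + 1) ≃ G.neighborSet v) = (D + 1).factorial := by
    intro v
    have e2 : Fin (D + 1) ≃ G.neighborSet v := Fintype.equivOfCardEq (by
      rw [Fintype.card_fin, ← hG v, Set.ncard_eq_toFinset_card', Set.toFinset_card])
    rw [Nat.card_eq_fintype_card, Fintype.card_equiv e2, Fintype.card_fin]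
  rw [Finset.prod_congr rfl fun v _ => this v]
  simp

lemma graphOf_regular [Fintype X] {m : Equiv.Perm (X × Fin (D + 1))} (hm : IsSimp m) (v : X) :
    ((graphOf m hm).neighborSet v).ncard = D + 1 := by
  have := ((simpEquiv (D := D) (graphOf m hm)) ⟨m, hm, rfl⟩).2 v
  rw [← Nat.card_coe_set_eq, ← Nat.card_congr (Equiv.ofBijective _ this), Nat.card_fin]

/-- Every regular graph comes from the same number of matchings. -/
theorem ncard_graph_mul [Fintype X] {F : Type*} [Finite F] (S : SimpleGraph X → F → Prop) :
    {Gf : SimpleGraph X × F | (∀ v, (Gf.1.neighborSet v).ncard = D + 1) ∧ S Gf.1 Gf.2}.ncard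
        * ((D + 1).factorial) ^ Fintype.card X =
      {mf : Equiv.Perm (X × Fin (D + 1)) × F | ∃ hm : IsSimp mf.1, S (graphOf mf.1 hm) mf.2}.ncard
      := by
  have e : (Σ Gf : {Gf : SimpleGraph X × F |
      (∀ v, (Gf.1.neighborSet v).ncard = D + 1) ∧ S Gf.1 Gf.2},
      {m : Equiv.Perm (X × Fin (D + 1)) // ∃ hm : IsSimp m, graphOf m hm = Gf.1.1}) ≃
      {mf : Equiv.Perm (X × Fin (D + 1)) × F | ∃ hm : IsSimp mf.1, S (graphOf mf.1 hm) mf.2} :=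
    { toFun := fun z => ⟨(z.2.1, z.1.1.2), z.2.2.choose, by
        have h := z.1.2.2
        rwa [← z.2.2.choose_spec] at h⟩
      invFun := fun z => ⟨⟨(graphOf z.1.1 z.2.choose, z.1.2),
        graphOf_regular z.2.choose, z.2.choose_spec⟩, ⟨z.1.1, z.2.choose, rfl⟩⟩
      left_inv := by
        rintro ⟨⟨⟨G, f⟩, hG⟩, ⟨m, hm, h⟩⟩
        obtain rfl : graphOf m hm = G := h
        rfl
      right_inv := fun z => rfl }
  have : Fintype {Gf : SimpleGraph X × F |
      (∀ v, (Gf.1.neighborSet v).ncard = D + 1) ∧ S Gf.1 Gf.2} := Fintype.ofFinite _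
  rw [← Nat.card_coe_set_eq, ← Nat.card_coe_set_eq, ← Nat.card_congr e, Nat.card_sigma,
    Finset.sum_congr rfl fun Gf _ => card_simpEquiv Gf.1.1 Gf.2.1]
  simp

end Graphs

/-! ### Coverings of balls -/

section Cover

variable {X : Type*} {D : ℕ}

/-- A labelling of the vertices of the ball of radius `R` of the tree by vertices of the graph
which is a covering. -/
structure Cov (D : ℕ) (G : SimpleGraph X) (v : X) (R : ℕ) (β : List ℕ → X) : Prop where
  root : β [] = v
  adj : ∀ l i, ValidTd (D + 1) (i :: l) → l.length < R → G.Adj (β l) (β (i :: l))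
  surj : ∀ l w, ValidTd (D + 1) l → l.length < R → G.Adj (β l) w →
    (∃ i, ValidTd (D + 1) (i :: l) ∧ β (i :: l) = w) ∨ (l ≠ [] ∧ w = β l.tail)
  inj : ∀ l i j, ValidTd (D + 1) (i :: l) → ValidTd (D + 1) (j :: l) → l.length < R →
    β (i :: l) = β (j :: l) → i = j
  ne : ∀ l i, l ≠ [] → ValidTd (D + 1) (i :: l) → l.length < R → β (i :: l) ≠ β l.tail

lemma cov_walk {m : Equiv.Perm (X × Fin (D + 1))} (hm : IsSimp m) (v : X) (R : ℕ) :
    Cov D (graphOf m hm) v R (fun l => (walk m v l).1) where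
  root := rfl
  adj l i _ _ := ⟨port (walk m v l).2 i, rfl⟩
  surj l w hl _ hw := by
    obtain ⟨p, rfl⟩ := hw
    by_cases hp : (walk m v l).2 = some p
    · right
      cases l with
      | nil => simp [walk] at hp
      | cons j l =>
        refine ⟨by simp, ?_⟩
        rw [walk_cons] at hp ⊢
        obtain rfl : (m (out m v j l)).2 = p := by simpa using hp
        simp only [Prod.mk.eta, hm.invol]
        rfl
    · left
      obtain ⟨i, hi, rfl⟩ := exists_port hl p hp
      exact ⟨i, hi, rfl⟩
  inj l i j hi hj _ h := port_inj hi hj (hm.inj _ _ _ h)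
  ne l i hl hi _ h := by
    cases l with
    | nil => exact hl rfl
    | cons j l =>
      have h1 : (m ((walk m v (j :: l)).1, (m (out m v j l)).2)).1 = (walk m v l).1 := by
        rw [walk_cons]
        simp only [Prod.mk.eta, hm.invol]
        rfl
      have h2 := hm.inj _ _ _ (h.trans h1.symm)
      refine port_ne (m := m) (v := v) hi ?_
      rw [h2, walk_cons]

lemma Cov.range_le {G : SimpleGraph X} {v : X} {R : ℕ} {β β' : List ℕ → X} (h : Cov D G v R β)
    (h' : Cov D G v R β') : ∀ l, ValidTd (D + 1) l → l.length ≤ R →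
      ∃ l', ValidTd (D + 1) l' ∧ l'.length ≤ l.length ∧ β' l' = β l
  | [], _, _ => ⟨[], validTd_nil, le_rfl, by rw [h.root, h'.root]⟩
  | i :: l, hl, hR => by
    simp only [List.length_cons] at hR ⊢
    have hl' := (validTd_cons.1 hl).2
    obtain ⟨l', v', n', e'⟩ := h.range_le h' l hl' (by omega)
    have := h.adj l i hl (by omega)
    rw [← e'] at this
    rcases h'.surj l' _ v' (by omega) this with ⟨j, hj, e⟩ | ⟨hn, e⟩
    · exact ⟨j :: l', hj, by simp; omega, e⟩
    · cases l' with
      | nil => exact absurd rfl hn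
      | cons j l' =>
        refine ⟨l', (validTd_cons.1 v').2, ?_, e.symm⟩
        simp at n'
        omega

lemma Cov.injOn {G : SimpleGraph X} {v : X} {R : ℕ} {β β' : List ℕ → X} (h : Cov D G v R β)
    (h' : Cov D G v R β') (hi : Set.InjOn β (words D R)) : Set.InjOn β' (words D R) := by
  refine Finset.injOn_of_card_image_eq (le_antisymm Finset.card_image_le ?_)
  rw [← Finset.card_image_of_injOn hi]
  refine Finset.card_le_card fun w hw => ?_
  obtain ⟨l, hl, rfl⟩ := Finset.mem_image.1 hw
  rw [mem_words] at hl
  obtain ⟨l', v', n', e'⟩ := h.range_le h' l hl.1 hl.2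
  exact Finset.mem_image.2 ⟨l', mem_words.2 ⟨v', n'.trans hl.2⟩, e'⟩

end Cover

/-! ### Vertex types of a colored matching -/

section Types

variable {M : Type} {X : Type*} {D : ℕ}

/-- The branch behind a half-edge. -/
def Bm (f : X → M) (m : Equiv.Perm (X × Fin (D + 1))) : ∀ k : ℕ, X × Fin (D + 1) → Br M D k
  | 0, h => f (m h).1
  | k + 1, h => (f (m h).1, fun i => Bm f m k ((m h).1, (m h).2.succAbove i))

lemma rootCol_Bm (f : X → M) (m : Equiv.Perm (X × Fin (D + 1))) (k : ℕ) (h : X × Fin (D + 1)) :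
    rootCol (Bm f m k h) = f (m h).1 := by cases k <;> rfl

lemma cut_Bm (f : X → M) (m : Equiv.Perm (X × Fin (D + 1))) : ∀ (j k : ℕ) (_ : j ≤ k)
    (h : X × Fin (D + 1)), cut j k (Bm f m k h) = Bm f m j h
  | 0, k, _, h => rootCol_Bm f m k h
  | j + 1, 0, hj, _ => absurd hj (by omega)
  | j + 1, k + 1, hj, h => by
    change (f (m h).1, fun i => cut j k (Bm f m k ((m h).1, (m h).2.succAbove i)))
      = ((f (m h).1, fun i => Bm f m j ((m h).1, (m h).2.succAbove i)) : M × (Fin D → Br M D j))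
    simp only [cut_Bm f m j k (by omega)]

/-- The vertex types of a colored matching. -/
def typeOf (k : ℕ) (f : X → M) (m : Equiv.Perm (X × Fin (D + 1))) (v : X) : VType M D k :=
  (f v, fun i => ucl (Bm f m k (v, i)))

lemma kapA_typeOf (k : ℕ) (f : X → M) (m : Equiv.Perm (X × Fin (D + 1))) (hm : ∀ h, m (m h) = h)
    (h : X × Fin (D + 1)) :
    kapA kap (typeOf k f m) h = (ucl (Bm f m k h), ucl (Bm f m k (m h))) := by
  refine Prod.ext rfl (ucl_eq.2 ?_)
  rw [← cut_Bm f m k (k + 1) (by omega) (m h)]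
  refine cut_eqv _ _ ⟨?_, 1, fun j => (urep_ucl _).trans ?_⟩
  · change f h.1 = f (m (m h)).1
    rw [hm]
  · change Eqv k _ (Bm f m k ((m (m h)).1, (m (m h)).2.succAbove j))
    rw [hm]
    exact Eqv.refl _

lemma mem_cons_typeOf [Fintype X] (k : ℕ) (f : X → M) {m : Equiv.Perm (X × Fin (D + 1))}
    (hm : IsMat m) : m ∈ cons Prod.swap (kapA kap (typeOf k f m)) := by
  refine mem_cons.2 ⟨hm, fun h => ?_⟩
  rw [kapA_typeOf k f m hm.1, kapA_typeOf k f m hm.1, hm.1]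
  rfl

lemma cut_eqv_cut {j k : ℕ} (hj : j ≤ k) {u : Br M D k} {b : Br M D (k + 1)}
    (h : Eqv k u (cut k (k + 1) b)) : Eqv j (cut j k u) (cut j (k + 1) b) := by
  rw [← cut_cut j k (k + 1) hj b]
  exact cut_eqv j k h

lemma eq_typeOf [Fintype X] {k : ℕ} {a : X → VType M D k} {m : Equiv.Perm (X × Fin (D + 1))}
    (hm : m ∈ cons Prod.swap (kapA kap a)) : a = typeOf k (fun v => (a v).1) m := by
  obtain ⟨hm, hc⟩ := mem_cons.1 hm
  have h0 : ∀ h : X × Fin (D + 1), (a h.1).2 h.2 =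
      ucl (cut k (k + 1) (((a (m h).1).1, fun j => urep ((a (m h).1).2 ((m h).2.succAbove j))) :
        M × (Fin D → Br M D k))) := fun h => by
    exact (congrArg Prod.snd (hc h)).symm
  have key : ∀ j ≤ k, ∀ h : X × Fin (D + 1),
      Eqv j (cut j k (urep ((a h.1).2 h.2))) (Bm (fun v => (a v).1) m j h) := by
    intro j
    induction j with
    | zero =>
      intro hj h
      have h1 := urep_ucl (cut k (k + 1) (((a (m h).1).1, fun j =>
        urep ((a (m h).1).2 ((m h).2.succAbove j))) : M × (Fin D → Br M D k)))
      rw [← h0 h] at h1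
      exact cut_eqv_cut hj h1
    | succ j ih =>
      intro hj h
      have h1 := urep_ucl (cut k (k + 1) (((a (m h).1).1, fun j =>
        urep ((a (m h).1).2 ((m h).2.succAbove j))) : M × (Fin D → Br M D k)))
      rw [← h0 h] at h1
      exact (cut_eqv_cut hj h1).trans ⟨rfl, 1, fun i => ih (by omega) ((m h).1, (m h).2.succAbove i)⟩
  funext v
  refine Prod.ext rfl (funext fun i => ?_)
  have := ucl_eq.2 (key k le_rfl (v, i))
  rwa [cut_self, ucl_urep] at this

lemma Cov.eqv_Bm {m : Equiv.Perm (X × Fin (D + 1))} {hm : IsSimp m} {v : X} {R : ℕ}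
    {β : List ℕ → X} (hβ : Cov D (graphOf m hm) v R β) (f : X → M) :
    ∀ (j : ℕ) (l : List ℕ) (h : X × Fin (D + 1)), l ≠ [] → ValidTd (D + 1) l → l.length + j ≤ R →
      h.1 = β l.tail → (m h).1 = β l →
      Eqv j (br D j (fun w => f (β (w ++ l)))) (Bm f m j h)
  | 0, l, h, _, _, _, _, h2 => by
    change f (β ([] ++ l)) = f (m h).1
    rw [h2]
    rfl
  | j + 1, l, h, hn, hl, hR, h1, h2 => by
    refine ⟨congrArg f h2.symm, ?_⟩
    have hv : ∀ i : Fin D, ValidTd (D + 1) ((i.1 + 1) :: l) := fun i =>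
      validTd_cons.2 ⟨⟨by omega, fun h => absurd h hn, fun _ => i.2⟩, hl⟩
    have hs : ∀ i : Fin D, ∃ t : Fin D,
        (m ((m h).1, (m h).2.succAbove t)).1 = β ((i.1 + 1) :: l) := by
      intro i
      obtain ⟨p, hp⟩ := hβ.adj l _ (hv i) (by omega)
      rw [← h2] at hp
      have hne : p ≠ (m h).2 := by
        rintro rfl
        rw [Prod.mk.eta, hm.invol, h1] at hp
        exact hβ.ne l _ hn (hv i) (by omega) hp.symm
      obtain ⟨t, rfl⟩ := Fin.exists_succAbove_eq hne
      exact ⟨t, hp⟩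
    choose s hs using hs
    have hsi : Function.Injective s := by
      intro i i' he
      have := hs i
      rw [he, hs i'] at this
      have := hβ.inj l _ _ (hv i') (hv i) (by omega) this
      exact Fin.ext (by omega)
    refine ⟨Equiv.ofBijective s (Finite.injective_iff_bijective.1 hsi), fun i => ?_⟩
    have := hβ.eqv_Bm f j ((i.1 + 1) :: l) ((m h).1, (m h).2.succAbove (s i)) (by simp) (hv i)
      (by simp; omega) h2 (hs i)
    have h3 : (fun w => f (β (w ++ (i.1 + 1) :: l))) = fun w => f (β ((w ++ [i.1 + 1]) ++ l)) := by
      funext w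
      simp
    rw [h3] at this
    exact this

/-- The type of a vertex is read off any covering, up to the numbering of the ports. -/
theorem Cov.exists_portPerm {k : ℕ} {m : Equiv.Perm (X × Fin (D + 1))} {hm : IsSimp m} {v : X}
    {β : List ℕ → X} (hβ : Cov D (graphOf m hm) v (k + 1) β) (f : X → M) :
    ∃ s, toV (encL D k (fun l => f (β l))) = portPerm s (typeOf k f m v) := by
  have hv : ∀ i : Fin (D + 1), ValidTd (D + 1) [i.1 + 1] := fun i =>
    validTd_cons.2 ⟨⟨by omega, fun _ => i.2, fun h => absurd rfl h⟩, validTd_nil⟩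
  have hs : ∀ i : Fin (D + 1), ∃ p, (m (v, p)).1 = β [i.1 + 1] := by
    intro i
    have := hβ.adj [] _ (hv i) (by simp)
    rwa [hβ.root] at this
  choose s hs using hs
  have hsi : Function.Injective s := by
    intro i i' he
    have := hs i
    rw [he, hs i'] at this
    have := hβ.inj [] _ _ (hv i') (hv i) (by simp) this
    exact Fin.ext (by omega)
  refine ⟨Equiv.ofBijective s (Finite.injective_iff_bijective.1 hsi), ?_⟩
  change _ = ((f v, fun i => ucl (Bm f m k (v, s i))) : VType M D k)
  refine Prod.ext (congrArg f hβ.root) (funext fun i => ucl_eq.2 ?_)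
  exact hβ.eqv_Bm f k [i.1 + 1] (v, s i) (by simp) (hv i) (by simp; omega) hβ.root.symm (hs i)

end Types

/-! ### Labels of the breadth-first search -/

section Search

variable {n : ℕ}

lemma card_filter_takeWhile_inj {α : Type*} (P : α → Prop) {w w' : α} (hw : P w) (hw' : P w') :
    ∀ L : List α, w ∈ L → w' ∈ L →
      ((L.takeWhile (fun u => decide (u ≠ w))).filter (fun u => decide (P u))).length =
        ((L.takeWhile (fun u => decide (u ≠ w'))).filter (fun u => decide (P u))).length → w = w'
  | [], h, _, _ => absurd h (by simp)
  | x :: L, h, h', he => by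
    by_cases hx : x = w
    · subst hx
      by_cases hx' : x = w'
      · exact hx'
      · exfalso
        simp [hx', hw] at he
    · by_cases hx' : x = w'
      · subst hx'
        exfalso
        simp [hx, hw'] at he
      · have h1 : w ∈ L := by
          rcases List.mem_cons.1 h with h | h
          exacts [absurd h.symm hx, h]
        have h2 : w' ∈ L := by
          rcases List.mem_cons.1 h' with h | h
          exacts [absurd h.symm hx', h]
        refine card_filter_takeWhile_inj P hw hw' L h1 h2 ?_
        by_cases hP : P x
        · simpa [hx, hx', hP] using he
        · simpa [hx, hx', hP] using he

lemma length_filter_takeWhile {α : Type*} (P : α → Prop) (key : α → ℕ) {w : α}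
    (hk : ∀ u, P u → key u = key w → u = w) :
    ∀ L : List α, w ∈ L → L.Pairwise (fun a b => key a ≤ key b) →
      ((L.takeWhile (fun u => decide (u ≠ w))).filter (fun u => decide (P u))).length =
        (L.filter (fun u => decide (P u ∧ key u < key w))).length
  | [], h, _ => absurd h (by simp)
  | x :: L, h, hs => by
    rw [List.pairwise_cons] at hs
    by_cases hx : x = w
    · subst hx
      have : (x :: L).filter (fun u => decide (P u ∧ key u < key x)) = [] := by
        rw [List.filter_eq_nil_iff]
        intro a ha
        rcases List.mem_cons.1 ha with rfl | ha
        · simp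
        · have := hs.1 a ha
          simp only [decide_eq_true_eq, not_and, not_lt]
          exact fun _ => this
      rw [this]
      simp
    · have h1 : w ∈ L := by
        rcases List.mem_cons.1 h with h | h
        exacts [absurd h.symm hx, h]
      have ih := length_filter_takeWhile P key hk L h1 hs.2
      by_cases hP : P x
      · have h2 : key x < key w := lt_of_le_of_ne (hs.1 w h1) fun e => hx (hk x hP e)
        simpa [hx, hP, h2] using ih
      · simpa [hx, hP] using ih

variable {G : SimpleGraph (Fin n)} {v : Fin n} {σ : Equiv.Perm (Fin n)}

lemma mem_bfsLayer {k : ℕ} {w : Fin n} :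
    w ∈ bfsLayer G v σ k ↔ G.Reachable v w ∧ G.dist v w = k := by
  cases k with
  | zero =>
    simp only [bfsLayer, List.mem_singleton]
    constructor
    · rintro rfl
      exact ⟨SimpleGraph.Reachable.refl _, SimpleGraph.dist_self⟩
    · rintro ⟨h, h'⟩
      exact (h.dist_eq_zero_iff.1 h').symm
  | succ k => simp [bfsLayer, List.mem_mergeSort]

lemma length_of_bfsPathAux : ∀ (k : ℕ) (w : Fin n) (l : List ℕ),
    bfsPathAux G v σ k w = some l → l.length = k
  | 0, w, l, h => by
    unfold bfsPathAux at h
    split_ifs at h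
    cases h
    rfl
  | k + 1, w, l, h => by
    unfold bfsPathAux at h
    split at h
    · simp at h
    · rename_i p hp
      obtain ⟨l', hl', rfl⟩ := Option.map_eq_some_iff.1 h
      simp [length_of_bfsPathAux k p l' hl']

lemma bfsPathAux_inj : ∀ (k : ℕ) (w w' : Fin n) (l : List ℕ), w ∈ bfsLayer G v σ k →
    w' ∈ bfsLayer G v σ k → bfsPathAux G v σ k w = some l → bfsPathAux G v σ k w' = some l →
    w = w'
  | 0, w, w', l, h, h', _, _ => by
    simp only [bfsLayer, List.mem_singleton] at h h'
    rw [h, h']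
  | k + 1, w, w', l, h, h', e, e' => by
    unfold bfsPathAux at e e'
    split at e
    · simp at e
    · rename_i p hp
      split at e'
      · simp at e'
      · rename_i p' hp'
        obtain ⟨l₁, hl₁, rfl⟩ := Option.map_eq_some_iff.1 e
        obtain ⟨l₂, hl₂, hl⟩ := Option.map_eq_some_iff.1 e'
        rw [List.cons.injEq] at hl
        obtain rfl := hl.2
        obtain rfl := bfsPathAux_inj k p p' _ (List.mem_of_find?_eq_some hp)
          (List.mem_of_find?_eq_some hp') hl₁ hl₂
        exact card_filter_takeWhile_inj
          (fun w' => (bfsLayer G v σ k).find? (fun u => decide (G.Adj u w')) = some p) hp hp' _ h h'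
          (by have := Nat.add_left_cancel hl.1.symm; convert this)

lemma bfsPath_eq_some {w : Fin n} {l : List ℕ} : bfsPath G v σ w = some l ↔
    w ∈ bfsLayer G v σ l.length ∧ bfsPathAux G v σ l.length w = some l := by
  unfold bfsPath
  rw [mem_bfsLayer]
  constructor
  · intro h
    split_ifs at h with hr
    have := length_of_bfsPathAux _ _ _ h
    rw [this]
    exact ⟨⟨hr, rfl⟩, h⟩
  · rintro ⟨⟨h, hd⟩, h'⟩
    rw [if_pos h, hd, h']

lemma bfsPath_inj {w w' : Fin n} {l : List ℕ} (h : bfsPath G v σ w = some l)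
    (h' : bfsPath G v σ w' = some l) : w = w' := by
  rw [bfsPath_eq_some] at h h'
  exact bfsPathAux_inj _ _ _ _ h.1 h'.1 h.2 h'.2

lemma exists_eq_of_injective_nbr {D : ℕ} (hG : ∀ v, (G.neighborSet v).ncard = D + 1) {x : Fin n}
    {u : Fin (D + 1) → Fin n} (hu : Function.Injective u) (ha : ∀ i, G.Adj x (u i)) {w : Fin n}
    (hw : G.Adj x w) : ∃ i, u i = w := by
  have h1 : Set.range u = G.neighborSet x := by
    refine Set.eq_of_subset_of_ncard_le ?_ ?_
    · rintro _ ⟨i, rfl⟩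
      exact ha i
    · rw [hG, ← Nat.card_coe_set_eq, Nat.card_range_of_injective hu, Nat.card_fin]
  have : w ∈ Set.range u := h1 ▸ hw
  exact this

/-- If the breadth-first search sees the ball of a colored regular tree, then this ball is
covered. -/
theorem exists_cov_of_resS_eq {M : Type*} {D r : ℕ} (hG : ∀ v, (G.neighborSet v).ncard = D + 1)
    {f : Fin n → M} {x : TdVertex (D + 1) → M}
    (hg : resS r (bfsRCG G f v σ) = resS r (iotaTd (D + 1) x)) :
    ∃ β, Cov D G v r β ∧ ∀ l (hl : ValidTd (D + 1) l), l.length ≤ r → f (β l) = x ⟨l, hl⟩ := by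
  have hc : ∀ l (hl : ValidTd (D + 1) l), l.length ≤ r →
      ∃ w, bfsPath G v σ w = some l ∧ f w = x ⟨l, hl⟩ := by
    intro l hl hr
    have := congrFun (congrArg RCG.col hg) l
    simp only [resS, hr, if_true, bfsRCG, iotaTd, dif_pos hl] at this
    split_ifs at this with h
    exact ⟨_, h.choose_spec, by simpa using this⟩
  have ha : ∀ l i, ValidTd (D + 1) (i :: l) → l.length < r →
      ∃ w₁ w₂, bfsPath G v σ w₁ = some l ∧ bfsPath G v σ w₂ = some (i :: l) ∧ G.Adj w₁ w₂ := by
    intro l i hl hr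
    have := congrFun (congrArg RCG.adj hg) (l, i :: l)
    have hr' : l.length ≤ r ∧ (i :: l).length ≤ r := ⟨hr.le, hr⟩
    have hh : ValidTd (D + 1) l ∧ ValidTd (D + 1) (i :: l) ∧
        ((∃ j, i :: l = j :: l) ∨ (∃ j, l = j :: (i :: l))) :=
      ⟨(validTd_cons.1 hl).2, hl, Or.inl ⟨i, rfl⟩⟩
    simp only [resS, if_pos hr', bfsRCG, iotaTd, if_pos hh] at this
    split_ifs at this with h
    exact h
  let β : List ℕ → Fin n := fun l => if h : ∃ w, bfsPath G v σ w = some l then h.choose else v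
  have hβ : ∀ {l w}, bfsPath G v σ w = some l → β l = w := by
    intro l w h
    have h' : ∃ w, bfsPath G v σ w = some l := ⟨w, h⟩
    simp only [β, dif_pos h']
    exact bfsPath_inj h'.choose_spec h
  have hp : ∀ {l}, ValidTd (D + 1) l → l.length ≤ r → bfsPath G v σ (β l) = some l := by
    intro l hl hr
    obtain ⟨w, hw, -⟩ := hc l hl hr
    rwa [hβ hw]
  have hi : ∀ {l l'}, ValidTd (D + 1) l → l.length ≤ r → ValidTd (D + 1) l' → l'.length ≤ r →
      β l = β l' → l = l' := by
    intro l l' h1 h2 h3 h4 he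
    have := hp h1 h2
    rw [he, hp h3 h4] at this
    exact (Option.some.inj this).symm
  have hadj : ∀ l i, ValidTd (D + 1) (i :: l) → l.length < r → G.Adj (β l) (β (i :: l)) := by
    intro l i hl hr
    obtain ⟨w₁, w₂, h1, h2, h3⟩ := ha l i hl hr
    rwa [hβ h1, hβ h2]
  refine ⟨β, ⟨?_, hadj, ?_, ?_, ?_⟩, ?_⟩
  · obtain ⟨w, hw, -⟩ := hc [] validTd_nil (by simp)
    rw [hβ hw]
    have := (bfsPath_eq_some.1 hw).1
    simpa [bfsLayer] using this
  · intro l w hl hr hw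
    cases l with
    | nil =>
      have hv : ∀ i : Fin (D + 1), ValidTd (D + 1) [i.1 + 1] := fun i =>
        validTd_cons.2 ⟨⟨by omega, fun _ => i.2, fun h => absurd rfl h⟩, validTd_nil⟩
      obtain ⟨i, hi⟩ := exists_eq_of_injective_nbr hG (u := fun i : Fin (D + 1) => β [i.1 + 1])
        (fun i j h => by
          have := hi (hv i) hr (hv j) hr h
          exact Fin.ext (by simpa using this))
        (fun i => hadj [] _ (hv i) hr) hw
      exact Or.inl ⟨_, hv i, hi⟩
    | cons a l =>
      have hv : ∀ i : Fin D, ValidTd (D + 1) ((i.1 + 1) :: a :: l) := fun i =>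
        validTd_cons.2 ⟨⟨by omega, fun h => absurd h (by simp), fun _ => i.2⟩, hl⟩
      have hl' := (validTd_cons.1 hl).2
      have hr1 : l.length ≤ r := by simp at hr; omega
      obtain ⟨i, hi⟩ := exists_eq_of_injective_nbr hG
        (u := fun i : Fin (D + 1) => Fin.cases (β l) (fun i => β ((i.1 + 1) :: a :: l)) i)
        (fun i j h => by
          induction i using Fin.cases with
          | zero =>
            induction j using Fin.cases with
            | zero => rfl
            | succ j =>
              have := congrArg List.length (hi hl' hr1 (hv j) hr h)
              simp only [List.length_cons] at this
              omega
          | succ i =>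
            induction j using Fin.cases with
            | zero =>
              have := congrArg List.length (hi (hv i) hr hl' hr1 h)
              simp only [List.length_cons] at this
              omega
            | succ j =>
              have := hi (hv i) hr (hv j) hr h
              exact congrArg _ (Fin.ext (by simpa using this)))
        (fun i => by
          induction i using Fin.cases with
          | zero => exact (hadj l a hl (by simp at hr; omega)).symm
          | succ i => exact hadj _ _ (hv i) hr) hw
      induction i using Fin.cases with
      | zero => exact Or.inr ⟨by simp, hi.symm⟩
      | succ i => exact Or.inl ⟨_, hv i, hi⟩
  · intro l i j h1 h2 hr he
    have := hi h1 hr h2 hr he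
    simpa using this
  · intro l i hn hl hr he
    cases l with
    | nil => exact hn rfl
    | cons a l =>
      have := congrArg List.length (hi hl hr (validTd_cons.1 (validTd_cons.1 hl).2).2
        (by simp at hr ⊢; omega) he)
      simp only [List.length_cons] at this
      omega
  · intro l hl hr
    obtain ⟨w, hw, h⟩ := hc l hl hr
    rw [hβ hw, h]

end Search

/-! ### The ordered covering -/

section Ordered

variable {n : ℕ}

/-- The rank of `w` among the elements of `S` in the order given by `σ`. -/
def rank (σ : Equiv.Perm (Fin n)) (S : Finset (Fin n)) (w : Fin n) : ℕ :=
  (S.filter fun u => σ u < σ w).card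

lemma rank_lt {σ : Equiv.Perm (Fin n)} {S : Finset (Fin n)} {w : Fin n} (hw : w ∈ S) :
    rank σ S w < S.card := by
  refine Finset.card_lt_card (Finset.filter_ssubset.2 ⟨w, hw, lt_irrefl _⟩)

lemma rank_inj {σ : Equiv.Perm (Fin n)} {S : Finset (Fin n)} {w w' : Fin n} (hw : w ∈ S)
    (hw' : w' ∈ S) (h : rank σ S w = rank σ S w') : w = w' := by
  have key : ∀ {a b}, a ∈ S → σ a < σ b → rank σ S a < rank σ S b := by
    intro a b ha hab
    refine Finset.card_lt_card ((Finset.ssubset_iff_of_subset ?_).2 ⟨a, ?_, ?_⟩)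
    · intro u hu
      rw [Finset.mem_filter] at hu ⊢
      exact ⟨hu.1, hu.2.trans hab⟩
    · exact Finset.mem_filter.2 ⟨ha, hab⟩
    · exact fun h => lt_irrefl _ (Finset.mem_filter.1 h).2
  rcases lt_trichotomy (σ w) (σ w') with h' | h' | h'
  · exact absurd h (key hw h').ne
  · exact σ.injective h'
  · exact absurd h (key hw' h').ne'

lemma exists_rank (σ : Equiv.Perm (Fin n)) (S : Finset (Fin n)) {j : ℕ} (hj : j < S.card) :
    ∃ w ∈ S, rank σ S w = j := by
  have h : S.image (rank σ S) = Finset.range S.card := by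
    refine Finset.eq_of_subset_of_card_le (fun a ha => ?_) ?_
    · obtain ⟨w, hw, rfl⟩ := Finset.mem_image.1 ha
      exact Finset.mem_range.2 (rank_lt hw)
    · rw [Finset.card_range, Finset.card_image_of_injOn fun a ha b hb => rank_inj ha hb]
  obtain ⟨w, hw, h⟩ := Finset.mem_image.1 (h.symm ▸ Finset.mem_range.2 hj)
  exact ⟨w, hw, h⟩

/-- The element of rank `j` of `S`, or `x` if there is none. -/
def sel (σ : Equiv.Perm (Fin n)) (S : Finset (Fin n)) (x : Fin n) (j : ℕ) : Fin n :=
  if h : ∃ w ∈ S, rank σ S w = j then h.choose else x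

lemma sel_spec {σ : Equiv.Perm (Fin n)} {S : Finset (Fin n)} {x : Fin n} {j : ℕ}
    (hj : j < S.card) : sel σ S x j ∈ S ∧ rank σ S (sel σ S x j) = j := by
  have h := exists_rank σ S hj
  rw [sel, dif_pos h]
  exact h.choose_spec

lemma sel_eq {σ : Equiv.Perm (Fin n)} {S : Finset (Fin n)} {x w : Fin n} {j : ℕ}
    (hw : w ∈ S) (h : rank σ S w = j) : sel σ S x j = w := by
  have := sel_spec (σ := σ) (x := x) (h ▸ rank_lt hw)
  exact rank_inj this.1 hw (this.2.trans h.symm)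

variable (G : SimpleGraph (Fin n))

/-- The neighbors which are not the parent. -/
def nbr (p : Fin n × Option (Fin n)) : Finset (Fin n) :=
  Finset.univ.filter fun w => G.Adj p.1 w ∧ p.2 ≠ some w

/-- The vertex, and its parent, at the end of the path whose steps are given by the ranks among
the children. -/
def pos (v : Fin n) (σ : Equiv.Perm (Fin n)) : List ℕ → Fin n × Option (Fin n)
  | [] => (v, none)
  | i :: l => (sel σ (nbr G (pos v σ l)) (pos v σ l).1 (i - 1), some (pos v σ l).1)

variable {G} {v : Fin n} {σ : Equiv.Perm (Fin n)} {D : ℕ}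

lemma mem_nbr {p : Fin n × Option (Fin n)} {w : Fin n} :
    w ∈ nbr G p ↔ G.Adj p.1 w ∧ p.2 ≠ some w := by simp [nbr]

lemma card_nbr_none (hG : ∀ v, (G.neighborSet v).ncard = D + 1) (w : Fin n) :
    (nbr G (w, none)).card = D + 1 := by
  rw [← hG w, ← Set.ncard_coe_finset]
  congr 1
  ext u
  simp [mem_nbr]

lemma card_nbr_some (hG : ∀ v, (G.neighborSet v).ncard = D + 1) {w u : Fin n} (h : G.Adj w u) :
    (nbr G (w, some u)).card = D := by
  have h1 : nbr G (w, some u) = (nbr G (w, none)).erase u := by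
    ext z
    simp only [mem_nbr, Finset.mem_erase, ne_eq, Option.some.injEq, reduceCtorEq,
      not_false_eq_true, and_true, eq_comm (a := u)]
    tauto
  rw [h1, Finset.card_erase_of_mem (by simp [mem_nbr, h]), card_nbr_none hG]
  rfl

lemma pos_spec (hG : ∀ v, (G.neighborSet v).ncard = D + 1) : ∀ (l : List ℕ) (i : ℕ),
    ValidTd (D + 1) (i :: l) → (pos G v σ (i :: l)).1 ∈ nbr G (pos G v σ l) ∧
      rank σ (nbr G (pos G v σ l)) (pos G v σ (i :: l)).1 = i - 1
  | [], i, h => by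
    have := (validTd_cons.1 h).1
    have := this.2.1 rfl
    exact sel_spec (by rw [pos, card_nbr_none hG]; omega)
  | a :: l, i, h => by
    obtain ⟨⟨h1, -, h2⟩, h'⟩ := validTd_cons.1 h
    have := h2 (by simp)
    have ha := (mem_nbr.1 (pos_spec hG l a h').1).1
    exact sel_spec (by
      change i - 1 < (nbr G ((pos G v σ (a :: l)).1, some (pos G v σ l).1)).card
      rw [card_nbr_some hG ha.symm]; omega)

lemma validTd_of_lt (hG : ∀ v, (G.neighborSet v).ncard = D + 1) {l : List ℕ} {j : ℕ}
    (hl : ValidTd (D + 1) l) (hj : j < (nbr G (pos G v σ l)).card) :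
    ValidTd (D + 1) ((j + 1) :: l) := by
  cases l with
  | nil =>
    rw [pos, card_nbr_none hG] at hj
    exact validTd_cons.2 ⟨⟨by omega, fun _ => by omega, fun h => absurd rfl h⟩, hl⟩
  | cons a l =>
    have ha := (mem_nbr.1 (pos_spec (v := v) (σ := σ) hG l a hl).1).1
    have : (nbr G ((pos G v σ (a :: l)).1, some (pos G v σ l).1)).card = D :=
      card_nbr_some hG ha.symm
    change j < (nbr G ((pos G v σ (a :: l)).1, some (pos G v σ l).1)).card at hj
    exact validTd_cons.2 ⟨⟨by omega, fun h => absurd h (by simp), fun _ => by omega⟩, hl⟩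

lemma cov_pos (hG : ∀ v, (G.neighborSet v).ncard = D + 1) (v : Fin n) (σ : Equiv.Perm (Fin n))
    (R : ℕ) : Cov D G v R (fun l => (pos G v σ l).1) where
  root := rfl
  adj l i h _ := (mem_nbr.1 (pos_spec hG l i h).1).1
  surj l w hl _ hw := by
    by_cases h : (pos G v σ l).2 = some w
    · right
      cases l with
      | nil => simp [pos] at h
      | cons a l => exact ⟨by simp, (Option.some.inj h).symm⟩
    · left
      have hm : w ∈ nbr G (pos G v σ l) := mem_nbr.2 ⟨hw, h⟩
      exact ⟨_, validTd_of_lt hG hl (rank_lt (σ := σ) hm), sel_eq hm rfl⟩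
  inj l i j hi hj _ h := by
    have h1 := (pos_spec (v := v) (σ := σ) hG l i hi).2
    have h2 := (pos_spec (v := v) (σ := σ) hG l j hj).2
    rw [h, h2] at h1
    have := (validTd_cons.1 hi).1.1
    have := (validTd_cons.1 hj).1.1
    omega
  ne l i hn hl _ h := by
    cases l with
    | nil => exact hn rfl
    | cons a l => exact (mem_nbr.1 (pos_spec (v := v) (σ := σ) hG _ i hl).1).2 (by rw [h]; rfl)

lemma Cov.exists_of_dist {R : ℕ} {β : List ℕ → Fin n} (hβ : Cov D G v R β) : ∀ (k : ℕ), k ≤ R →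
    ∀ (w : Fin n) (p : G.Walk v w), p.length = k →
    ∃ l, ValidTd (D + 1) l ∧ l.length ≤ k ∧ β l = w := by
  intro k
  induction k with
  | zero =>
    intro _ w p hp
    obtain rfl := SimpleGraph.Walk.eq_of_length_eq_zero hp
    exact ⟨[], validTd_nil, le_rfl, hβ.root⟩
  | succ k ih =>
    intro hk w p hp
    have hnn : ¬ p.Nil := by
      intro h
      rw [← SimpleGraph.Walk.length_eq_zero_iff] at h
      omega
    obtain ⟨l, h1, h2, h3⟩ := ih (by omega) p.penultimate p.dropLast (by
      rw [SimpleGraph.Walk.length_dropLast]; omega)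
    have := p.adj_penultimate hnn
    rw [← h3] at this
    rcases hβ.surj l w h1 (by omega) this with ⟨i, hi, e⟩ | ⟨hn, e⟩
    · exact ⟨i :: l, hi, by simp; omega, e⟩
    · cases l with
      | nil => exact absurd rfl hn
      | cons a l =>
        simp only [List.length_cons] at h2
        exact ⟨l, (validTd_cons.1 h1).2, by omega, e.symm⟩

lemma Cov.reachable_dist_le {R : ℕ} {β : List ℕ → Fin n} (hβ : Cov D G v R β) :
    ∀ l, ValidTd (D + 1) l → l.length ≤ R → G.Reachable v (β l) ∧ G.dist v (β l) ≤ l.length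
  | [], _, _ => by
    rw [hβ.root]
    simp
  | i :: l, hl, hR => by
    simp only [List.length_cons] at hR ⊢
    obtain ⟨h1, h2⟩ := hβ.reachable_dist_le l (validTd_cons.1 hl).2 (by omega)
    have ha := hβ.adj l i hl (by omega)
    refine ⟨h1.trans ha.reachable, ?_⟩
    obtain ⟨p, hp⟩ := h1.exists_walk_length_eq_dist
    have := SimpleGraph.dist_le (p.concat ha)
    rw [SimpleGraph.Walk.length_concat] at this
    omega

lemma Cov.mem_bfsLayer {R : ℕ} {β : List ℕ → Fin n} (hβ : Cov D G v R β)
    (hi : Set.InjOn β (words D R)) {k : ℕ} (hk : k ≤ R) {w : Fin n} :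
    w ∈ bfsLayer G v σ k ↔ ∃ l, ValidTd (D + 1) l ∧ l.length = k ∧ β l = w := by
  rw [TreeEntropy.mem_bfsLayer]
  have key : ∀ l, ValidTd (D + 1) l → l.length ≤ R → G.dist v (β l) = l.length := by
    intro l hl hR
    obtain ⟨h1, h2⟩ := hβ.reachable_dist_le l hl hR
    refine le_antisymm h2 ?_
    obtain ⟨p, hp⟩ := h1.exists_walk_length_eq_dist
    obtain ⟨l', e1, e2, e3⟩ := hβ.exists_of_dist _ (h2.trans hR) _ p hp
    have := hi (mem_words.2 ⟨e1, by omega⟩) (mem_words.2 ⟨hl, hR⟩) e3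
    rwa [this] at e2
  constructor
  · rintro ⟨h, rfl⟩
    obtain ⟨p, hp⟩ := h.exists_walk_length_eq_dist
    obtain ⟨l, e1, e2, rfl⟩ := hβ.exists_of_dist _ hk _ p hp
    exact ⟨l, e1, (key l e1 (e2.trans hk)).symm, rfl⟩
  · rintro ⟨l, hl, rfl, rfl⟩
    exact ⟨(hβ.reachable_dist_le l hl hk).1, key l hl hk⟩

lemma Cov.find_parent {R : ℕ} {β : List ℕ → Fin n} (hβ : Cov D G v R β)
    (hi : Set.InjOn β (words D R)) {l : List ℕ} {i : ℕ} (hl : ValidTd (D + 1) (i :: l))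
    (hR : l.length + 1 ≤ R) :
    (bfsLayer G v σ l.length).find? (fun u => decide (G.Adj u (β (i :: l)))) = some (β l) := by
  have hl' := (validTd_cons.1 hl).2
  have h1 : ((bfsLayer G v σ l.length).find? (fun u => decide (G.Adj u (β (i :: l))))).isSome := by
    rw [List.find?_isSome]
    exact ⟨β l, (hβ.mem_bfsLayer hi (by omega)).2 ⟨l, hl', rfl, rfl⟩, by
      simpa using hβ.adj l i hl hR⟩
  obtain ⟨u, hu⟩ := Option.isSome_iff_exists.1 h1
  rw [hu]
  congr 1
  have hmem := List.mem_of_find?_eq_some hu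
  have hadj : G.Adj u (β (i :: l)) := by simpa using List.find?_some hu
  obtain ⟨l₁, h2, h3, rfl⟩ := (hβ.mem_bfsLayer hi (by omega)).1 hmem
  rcases hβ.surj l₁ _ h2 (by omega) hadj with ⟨j, hj, e⟩ | ⟨hn, e⟩
  · have := hi (mem_words.2 ⟨hj, by simp; omega⟩) (mem_words.2 ⟨hl, hR⟩) e
    rw [List.cons.injEq] at this
    rw [this.2]
  · cases l₁ with
    | nil => exact absurd rfl hn
    | cons a l₁ =>
      simp only [List.length_cons] at h3
      have := hi (mem_words.2 ⟨hl, hR⟩)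
        (mem_words.2 ⟨(validTd_cons.1 h2).2, by omega⟩) e
      have := congrArg List.length this
      simp at this
      omega

end Ordered

/-! ### The search of a good vertex -/

section Good

variable {n : ℕ} {G : SimpleGraph (Fin n)} {v : Fin n} {σ : Equiv.Perm (Fin n)} {D : ℕ}

lemma nodup_bfsLayer (k : ℕ) : (bfsLayer G v σ k).Nodup := by
  cases k with
  | zero => simp [bfsLayer]
  | succ k =>
    unfold bfsLayer
    exact (List.mergeSort_perm _ _).nodup_iff.2 ((List.nodup_finRange n).filter _)

/-- The sorting key of the next layer. -/
def layerKey (G : SimpleGraph (Fin n)) (v : Fin n) (σ : Equiv.Perm (Fin n)) (k : ℕ) (w : Fin n) :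
    ℕ :=
  ((bfsLayer G v σ k).idxOf
    (((bfsLayer G v σ k).find? (fun u => decide (G.Adj u w))).getD v)) * n + (σ w : ℕ)

lemma pairwise_bfsLayer (k : ℕ) :
    (bfsLayer G v σ (k + 1)).Pairwise fun a b => layerKey G v σ k a ≤ layerKey G v σ k b := by
  have := List.pairwise_mergeSort (le := fun a b => decide (layerKey G v σ k a ≤ layerKey G v σ k b))
    (fun a b c h h' => by simp only [decide_eq_true_eq] at *; omega)
    (fun a b => by simp only [Bool.or_eq_true, decide_eq_true_eq]; omega)
    ((List.finRange n).filter
        (fun w => decide (G.Reachable v w ∧ G.dist v w = k + 1)))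
  simp only [decide_eq_true_eq] at this
  unfold bfsLayer
  convert this <;> rfl

lemma exists_cons_of_mem_nbr (hG : ∀ v, (G.neighborSet v).ncard = D + 1) {l : List ℕ}
    (hl : ValidTd (D + 1) l) {u : Fin n} (hu : u ∈ nbr G (pos G v σ l)) :
    ∃ i, ValidTd (D + 1) (i :: l) ∧ (pos G v σ (i :: l)).1 = u :=
  ⟨_, validTd_of_lt hG hl (rank_lt (σ := σ) hu), sel_eq hu rfl⟩

lemma bfsPathAux_pos (hG : ∀ v, (G.neighborSet v).ncard = D + 1) {R : ℕ}
    (hi : Set.InjOn (fun l => (pos G v σ l).1) (words D R)) : ∀ l, ValidTd (D + 1) l →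
      l.length ≤ R → bfsPathAux G v σ l.length (pos G v σ l).1 = some l
  | [], _, _ => by simp [bfsPathAux, pos]
  | i :: l, hl, hR => by
    simp only [List.length_cons] at hR ⊢
    have hc := cov_pos hG v σ R
    have hl' := (validTd_cons.1 hl).2
    have ih := bfsPathAux_pos hG hi l hl' (by omega)
    have hf := hc.find_parent hi hl hR (σ := σ)
    have hmem : ∀ w, w ∈ bfsLayer G v σ (l.length + 1) →
        (bfsLayer G v σ l.length).find? (fun u => decide (G.Adj u w)) = some (pos G v σ l).1 →
        w ∈ nbr G (pos G v σ l) := by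
      intro w hw hp
      obtain ⟨l₁, h1, h2, rfl⟩ := (hc.mem_bfsLayer hi hR).1 hw
      cases l₁ with
      | nil => simp at h2
      | cons j l₁ =>
        have h3 : l₁.length = l.length := by simpa using h2
        have h4 := hc.find_parent hi h1 (by omega) (σ := σ)
        rw [h3] at h4
        have h5 := hi (mem_words.2 ⟨(validTd_cons.1 h1).2, by omega⟩)
          (mem_words.2 ⟨hl', by omega⟩) (Option.some.inj (h4.symm.trans hp))
        rw [h5] at h1 ⊢
        exact (pos_spec hG l j h1).1
    have hmem' : ∀ w, w ∈ nbr G (pos G v σ l) → w ∈ bfsLayer G v σ (l.length + 1) ∧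
        (bfsLayer G v σ l.length).find? (fun u => decide (G.Adj u w)) = some (pos G v σ l).1 := by
      intro w hw
      obtain ⟨j, hj, rfl⟩ := exists_cons_of_mem_nbr hG hl' hw
      exact ⟨(hc.mem_bfsLayer hi hR).2 ⟨j :: l, hj, by simp, rfl⟩, hc.find_parent hi hj hR⟩
    have hkey : ∀ w, (bfsLayer G v σ l.length).find? (fun u => decide (G.Adj u w))
        = some (pos G v σ l).1 → layerKey G v σ l.length w =
          (bfsLayer G v σ l.length).idxOf (pos G v σ l).1 * n + (σ w : ℕ) := by
      intro w hw
      rw [layerKey, hw]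
      rfl
    have hlen : (((bfsLayer G v σ (l.length + 1)).takeWhile
        (fun w' => decide (w' ≠ (pos G v σ (i :: l)).1))).filter (fun w' => decide
          ((bfsLayer G v σ l.length).find? (fun u => decide (G.Adj u w')) =
            some (pos G v σ l).1))).length = i - 1 := by
      have h1 := length_filter_takeWhile (fun w' =>
          (bfsLayer G v σ l.length).find? (fun u => decide (G.Adj u w')) = some (pos G v σ l).1)
        (layerKey G v σ l.length) (w := (pos G v σ (i :: l)).1)
        (fun u hu he => by
          rw [hkey u hu, hkey _ hf] at he
          exact σ.injective (Fin.ext (by omega)))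
        (bfsLayer G v σ (l.length + 1))
        ((hc.mem_bfsLayer hi hR).2 ⟨i :: l, hl, by simp, rfl⟩) (pairwise_bfsLayer _)
      have h2 := (pos_spec (v := v) (σ := σ) hG l i hl).2
      rw [← h2, rank]
      refine (Eq.trans (by congr!) h1).trans ?_
      rw [← List.toFinset_card_of_nodup ((nodup_bfsLayer _).filter _)]
      congr 1
      ext u
      simp only [Finset.mem_filter, List.mem_toFinset, List.mem_filter, decide_eq_true_eq]
      refine Iff.symm ⟨?_, ?_⟩
      · rintro ⟨h3, h4⟩
        obtain ⟨h5, h6⟩ := hmem' u h3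
        refine ⟨h5, h6, ?_⟩
        rw [hkey u h6, hkey _ hf]
        have : (σ u : ℕ) < (σ (pos G v σ (i :: l)).1 : ℕ) := h4
        omega
      · rintro ⟨h3, h4, h5⟩
        refine ⟨hmem u h3 h4, ?_⟩
        rw [hkey u h4, hkey _ hf] at h5
        exact Fin.lt_def.2 (by omega)
    have h1 := (validTd_cons.1 hl).1.1
    unfold bfsPathAux
    rw [hf]
    simp only [ih, Option.map_some]
    congr 2
    have h2 : 1 + (i - 1) = i := by omega
    conv_rhs => rw [← h2, ← hlen]

lemma bfsPath_pos (hG : ∀ v, (G.neighborSet v).ncard = D + 1) {R : ℕ}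
    (hi : Set.InjOn (fun l => (pos G v σ l).1) (words D R)) {l : List ℕ} (hl : ValidTd (D + 1) l)
    (hR : l.length ≤ R) : bfsPath G v σ (pos G v σ l).1 = some l :=
  bfsPath_eq_some.2 ⟨((cov_pos hG v σ R).mem_bfsLayer hi hR).2 ⟨l, hl, rfl, rfl⟩,
    bfsPathAux_pos hG hi l hl hR⟩

/-- Around a vertex whose neighborhood is a tree, the search sees the ordered covering. -/
theorem resS_bfsRCG {M : Type*} {r : ℕ} (hG : ∀ v, (G.neighborSet v).ncard = D + 1)
    (hi : Set.InjOn (fun l => (pos G v σ l).1) (words D (r + 1))) (f : Fin n → M) :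
    resS r (bfsRCG G f v σ) =
      resS r (iotaTd (D + 1) fun l => f (pos G v σ l.1).1) := by
  have hc := cov_pos hG v σ (r + 1)
  have hp : ∀ {l}, ValidTd (D + 1) l → l.length ≤ r → bfsPath G v σ (pos G v σ l).1 = some l :=
    fun hl hr => bfsPath_pos hG hi hl (by omega)
  have hp' : ∀ {l w}, l.length ≤ r → bfsPath G v σ w = some l →
      ValidTd (D + 1) l ∧ w = (pos G v σ l).1 := by
    intro l w hr h
    obtain ⟨l', h1, h2, rfl⟩ := (hc.mem_bfsLayer hi (by omega)).1 (bfsPath_eq_some.1 h).1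
    rw [hp h1 (by omega)] at h
    obtain rfl := Option.some.inj h
    exact ⟨h1, rfl⟩
  have hcol : (resS r (bfsRCG G f v σ)).col =
      (resS r (iotaTd (D + 1) fun l => f (pos G v σ l.1).1)).col := by
    funext l
    by_cases hr : l.length ≤ r
    · simp only [resS, hr, if_true, bfsRCG, iotaTd]
      by_cases hl : ValidTd (D + 1) l
      · have h : ∃ w, bfsPath G v σ w = some l := ⟨_, hp hl hr⟩
        rw [dif_pos h, dif_pos hl, (hp' hr h.choose_spec).2]
      · have h : ¬ ∃ w, bfsPath G v σ w = some l := fun ⟨w, h⟩ => hl (hp' hr h).1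
        rw [dif_neg h, dif_neg hl]
    · simp only [resS, hr, if_false]
  have hadj : (resS r (bfsRCG G f v σ)).adj =
      (resS r (iotaTd (D + 1) fun l => f (pos G v σ l.1).1)).adj := by
    funext p
    obtain ⟨l, l'⟩ := p
    by_cases hr : l.length ≤ r ∧ l'.length ≤ r
    · simp only [resS, hr, and_self, if_true, bfsRCG, iotaTd]
      refine if_congr ?_ rfl rfl
      constructor
      · rintro ⟨w₁, w₂, h1, h2, h3⟩
        obtain ⟨v1, rfl⟩ := hp' hr.1 h1
        obtain ⟨v2, rfl⟩ := hp' hr.2 h2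
        refine ⟨v1, v2, ?_⟩
        rcases hc.surj l _ v1 (by omega) h3 with ⟨i, hi', e⟩ | ⟨hn, e⟩
        · exact Or.inl ⟨i, hi (mem_words.2 ⟨v2, by omega⟩)
            (mem_words.2 ⟨hi', by simp; omega⟩) e.symm⟩
        · right
          cases l with
          | nil => exact absurd rfl hn
          | cons a l =>
            have hr1 := hr.1
            simp only [List.length_cons] at hr1
            have := hi (mem_words.2 ⟨v2, by omega⟩)
              (mem_words.2 ⟨(validTd_cons.1 v1).2, by omega⟩) e
            exact ⟨a, by rw [this]⟩
      · rintro ⟨v1, v2, h⟩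
        refine ⟨_, _, hp v1 hr.1, hp v2 hr.2, ?_⟩
        rcases h with ⟨i, rfl⟩ | ⟨i, rfl⟩
        · exact hc.adj l i v2 (by omega)
        · exact (hc.adj l' i v1 (by omega)).symm
    · simp only [resS, hr, if_false]
  cases h1 : resS r (bfsRCG G f v σ)
  cases h2 : resS r (iotaTd (D + 1) fun l => f (pos G v σ l.1).1)
  rw [h1, h2] at hcol hadj
  simp only at hcol hadj
  rw [hcol, hadj]

end Good

/-! ### Uniformity of the search over the labelings -/

section Orbit

lemma exists_perm_extend {ι : Type*} {n : ℕ} {W : Finset ι} {b b' : ι → Fin n}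
    (hb : Set.InjOn b W) (hb' : Set.InjOn b' W) :
    ∃ π : Equiv.Perm (Fin n), ∀ l ∈ W, π (b l) = b' l := by
  let F : Fin n → Fin n := fun w => if h : ∃ l ∈ W, b l = w then b' h.choose else w
  have hF : ∀ l ∈ W, F (b l) = b' l := by
    intro l hl
    have h : ∃ l' ∈ W, b l' = b l := ⟨l, hl, rfl⟩
    change dite _ _ _ = _
    rw [dif_pos h, hb h.choose_spec.1 hl h.choose_spec.2]
  have hinj : Set.InjOn F (W.image b) := by
    intro x hx y hy hxy
    obtain ⟨l, hl, rfl⟩ := Finset.mem_image.1 (Finset.mem_coe.1 hx)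
    obtain ⟨l', hl', rfl⟩ := Finset.mem_image.1 (Finset.mem_coe.1 hy)
    rw [hF l hl, hF l' hl'] at hxy
    rw [hb' hl hl' hxy]
  obtain ⟨g, hg⟩ := Finset.exists_equiv_extend_of_card_eq (t := (Finset.univ : Finset (Fin n)))
    (by simp) (Finset.subset_univ ((W.image b).image F)) hinj
  refine ⟨g.trans (Equiv.subtypeUnivEquiv Finset.mem_univ), fun l hl => ?_⟩
  rw [← hF l hl, ← hg _ (Finset.mem_image_of_mem b hl)]
  rfl

variable {n : ℕ} {G : SimpleGraph (Fin n)} {v : Fin n} {σ : Equiv.Perm (Fin n)} {D : ℕ}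

lemma IsRAut.mem_words {e : Equiv.Perm (List ℕ)} (he : IsRAut (ValidTd (D + 1)) e) {R : ℕ}
    {l : List ℕ} : e l ∈ words D R ↔ l ∈ words D R := by
  rw [TreeEntropy.mem_words, TreeEntropy.mem_words, he.valid, he.length]

lemma pos_mul_inv (hG : ∀ v, (G.neighborSet v).ncard = D + 1) {R : ℕ} {e : Equiv.Perm (List ℕ)}
    (he : IsRAut (ValidTd (D + 1)) e) {π : Equiv.Perm (Fin n)}
    (hπ : ∀ l ∈ words D R, π (pos G v σ l).1 = (pos G v σ (e l)).1) :
    ∀ l, l ∈ words D R → pos G v (σ * π⁻¹) l = pos G v σ (e l)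
  | [], _ => by rw [he.nil]; rfl
  | i :: l, hl => by
    have hil := (mem_words.1 hl).1
    have hR := (mem_words.1 hl).2
    simp only [List.length_cons] at hR
    have hl' := (validTd_cons.1 hil).2
    have hw' : l ∈ words D R := mem_words.2 ⟨hl', by omega⟩
    have ih := pos_mul_inv hG he hπ l hw'
    obtain ⟨j, hj⟩ := he.cons i l
    have hjv : ValidTd (D + 1) (j :: e l) := hj ▸ (he.valid _).2 hil
    have hel : ValidTd (D + 1) (e l) := (he.valid _).2 hl'
    have hS : nbr G (pos G v σ (e l)) = (nbr G (pos G v σ l)).image π := by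
      ext u
      rw [Finset.mem_image]
      constructor
      · intro hu
        obtain ⟨a, ha, rfl⟩ := exists_cons_of_mem_nbr hG hel hu
        obtain ⟨q, hq⟩ : ∃ q, e q = a :: e l := ⟨e.symm _, e.apply_symm_apply _⟩
        cases q with
        | nil => rw [he.nil] at hq; simp at hq
        | cons b q =>
          obtain ⟨b', hb'⟩ := he.cons b q
          rw [hb', List.cons.injEq] at hq
          obtain rfl := e.injective hq.2
          obtain rfl := hq.1
          have hbv : ValidTd (D + 1) (b :: q) := (he.valid _).1 (hb' ▸ ha)
          exact ⟨_, (pos_spec hG q b hbv).1, by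
            rw [hπ _ (mem_words.2 ⟨hbv, by simpa using hR⟩), hb']⟩
      · rintro ⟨w, hw, rfl⟩
        obtain ⟨a, ha, rfl⟩ := exists_cons_of_mem_nbr hG hl' hw
        rw [hπ _ (mem_words.2 ⟨ha, by simpa using hR⟩)]
        obtain ⟨b, hb⟩ := he.cons a l
        rw [hb]
        exact (pos_spec hG _ b (hb ▸ (he.valid _).2 ha)).1
    have hrank : ∀ u, rank (σ * π⁻¹) ((nbr G (pos G v σ l)).image π) (π u)
        = rank σ (nbr G (pos G v σ l)) u := by
      intro u
      unfold rank
      rw [Finset.filter_image, Finset.card_image_of_injective _ π.injective]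
      simp
    rw [hj]
    change (sel _ _ _ _, _) = (sel _ _ _ _, _)
    rw [ih]
    refine Prod.ext ?_ rfl
    refine Eq.trans (b := (pos G v σ (j :: e l)).1) ?_ rfl
    refine sel_eq (pos_spec hG _ j hjv).1 ?_
    rw [← hj, ← hπ _ hl, hS, hrank, (pos_spec hG l i hil).2]

lemma card_encL_pos_le {M : Type} (hG : ∀ v, (G.neighborSet v).ncard = D + 1) {k R : ℕ}
    (hk : k + 1 ≤ R) (hi : ∀ σ, Set.InjOn (fun l => (pos G v σ l).1) (words D R)) (f : Fin n → M)
    {y y' : M × (Fin (D + 1) → Br M D k)} (h : REqv k y y') :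
    (Finset.univ.filter fun σ : Equiv.Perm (Fin n) =>
      encL D k (fun l => f (pos G v σ l).1) = y).card ≤
    (Finset.univ.filter fun σ : Equiv.Perm (Fin n) =>
      encL D k (fun l => f (pos G v σ l).1) = y').card := by
  obtain ⟨e, he, hy⟩ := h.exists_aut
  let b : Equiv.Perm (Fin n) → List ℕ → Fin n := fun σ l =>
    if l ∈ words D R then (pos G v σ l).1 else v
  let Q : (List ℕ → Fin n) → Equiv.Perm (Fin n) := fun b =>
    if h : ∃ π : Equiv.Perm (Fin n), ∀ l ∈ words D R, π (b l) = b (e l) then h.choose else 1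
  have hb : ∀ σ, ∀ l ∈ words D R, b σ l = (pos G v σ l).1 := fun σ l hl => if_pos hl
  have hQ : ∀ σ, ∀ l ∈ words D R, Q (b σ) (pos G v σ l).1 = (pos G v σ (e l)).1 := by
    intro σ l hl
    have hex : ∃ π : Equiv.Perm (Fin n), ∀ l ∈ words D R, π (b σ l) = b σ (e l) := by
      refine exists_perm_extend (b' := fun l => b σ (e l)) ?_ ?_
      · intro l hl l' hl' h
        rw [hb σ l hl, hb σ l' hl'] at h
        exact hi σ hl hl' h
      · intro l hl l' hl' h
        have h1 := he.mem_words.2 (Finset.mem_coe.1 hl)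
        have h2 := he.mem_words.2 (Finset.mem_coe.1 hl')
        simp only [hb σ _ h1, hb σ _ h2] at h
        exact e.injective (hi σ h1 h2 h)
    have h1 : Q (b σ) = hex.choose := dif_pos hex
    rw [h1, ← hb σ l hl, hex.choose_spec l hl, hb σ _ (he.mem_words.2 hl)]
  have hT := fun σ => pos_mul_inv hG he (hQ σ)
  refine Finset.card_le_card_of_injOn (fun σ => σ * (Q (b σ))⁻¹) ?_ ?_
  · intro σ hσ
    simp only [Finset.coe_filter, Finset.mem_univ, true_and, Set.mem_ofPred_eq] at hσ ⊢
    rw [← hy _ hσ, encL_inj_iff]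
    intro w hw hwk
    rw [hT σ w (mem_words.2 ⟨hw, by omega⟩)]
    rfl
  · intro σ _ σ' _ h
    simp only at h
    have hbb : b σ = b σ' := by
      funext l
      by_cases hl : l ∈ words D R
      · obtain ⟨q, rfl⟩ := e.surjective l
        have hq := he.mem_words.1 hl
        rw [hb σ _ hl, hb σ' _ hl, ← hT σ q hq, ← hT σ' q hq, h]
      · exact (if_neg hl).trans (if_neg hl).symm
    rw [hbb] at h
    exact mul_right_cancel h

end Orbit
/-! ### The metric of rooted colored graphs and the Lévy-Prokhorov distance -/

section LevyProkhorovFinite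

variable {Ω : Type*} [PseudoMetricSpace Ω] [MeasurableSpace Ω]

lemma levyProkhorovDist_le_of_atoms [OpensMeasurableSpace Ω] (μ ν : Measure Ω)
    [IsProbabilityMeasure μ] [IsProbabilityMeasure ν] {Y : Type*} [Fintype Y] (φ : Y → Ω) (hφ : Function.Injective φ)
    (hm : ∀ y, MeasurableSet {φ y}) (p : Y → ℝ)
    (hp : ∀ B, MeasurableSet B → μ.real B = ∑ y with φ y ∈ B, p y) {ε : ℝ} (hε : 0 ≤ ε)
    (h : ∀ y, p y - ε ≤ ν.real {φ y}) :
    levyProkhorovDist μ ν ≤ Fintype.card Y * ε := by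
  refine levyProkhorovDist_le_of_forall_le μ ν (by positivity) fun δ B hδ hB => ?_
  have hδ0 : 0 < δ := lt_of_le_of_lt (by positivity) hδ
  have h1 : μ.real B ≤ ν.real B + Fintype.card Y * ε := by
    rw [hp B hB]
    have h2 : ∑ y with φ y ∈ B, ν.real {φ y} ≤ ν.real B := by
      have h3 := measureReal_biUnion_finset (μ := ν)
        (s := Finset.univ.filter fun y => φ y ∈ B) (f := fun y => {φ y})
        (fun y _ y' _ hy => by
          simpa [Function.onFun] using fun e => hy (hφ e))
        (fun y _ => hm y)
      rw [← h3]
      refine measureReal_mono (Set.iUnion₂_subset fun y hy => ?_)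
      simpa using hy
    calc ∑ y with φ y ∈ B, p y ≤ ∑ y with φ y ∈ B, (ν.real {φ y} + ε) :=
          Finset.sum_le_sum fun y _ => by linarith [h y]
      _ = ∑ y with φ y ∈ B, ν.real {φ y} +
          ((Finset.univ.filter fun y => φ y ∈ B).card : ℝ) * ε := by
            rw [Finset.sum_add_distrib, Finset.sum_const, nsmul_eq_mul]
      _ ≤ _ := add_le_add h2 (mul_le_mul_of_nonneg_right
            (by exact_mod_cast Finset.card_le_univ _) hε)
  have h4 : μ.real B ≤ ν.real (Metric.thickening δ B) + δ :=
    h1.trans (add_le_add (measureReal_mono (Metric.self_subset_thickening hδ0 B)) hδ.le)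
  rw [← ofReal_measureReal (μ := μ), ← ofReal_measureReal (μ := ν),
    ← ENNReal.ofReal_add measureReal_nonneg hδ0.le]
  exact ENNReal.ofReal_le_ofReal h4

lemma measureReal_le_of_levyProkhorovDist_lt (μ ν : Measure Ω)
    [IsProbabilityMeasure μ] [IsProbabilityMeasure ν] {ε : ℝ} (h : levyProkhorovDist μ ν < ε)
    {B : Set Ω} (hB : MeasurableSet B) :
    ν.real B ≤ μ.real (Metric.thickening ε B) + ε := by
  have h0 : 0 < ε := lt_of_le_of_lt ENNReal.toReal_nonneg h
  have h1 : levyProkhorovEDist μ ν < ENNReal.ofReal ε :=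
    (ENNReal.lt_ofReal_iff_toReal_lt (levyProkhorovEDist_ne_top μ ν)).2 h
  have h2 := right_measure_le_of_levyProkhorovEDist_lt h1 hB
  rw [ENNReal.toReal_ofReal h0.le, ← ofReal_measureReal (μ := μ), ← ofReal_measureReal (μ := ν),
    ← ENNReal.ofReal_add measureReal_nonneg h0.le] at h2
  exact (ENNReal.ofReal_le_ofReal_iff (by positivity)).1 h2

end LevyProkhorovFinite

section RCGMetric

variable {M : Type*}

lemma resS_resS {r R : ℕ} (h : r ≤ R) (g : RCG M) : resS r (resS R g) = resS r g := by
  ext1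
  · funext l
    simp only [resS]
    split_ifs <;> first | rfl | omega
  · funext p
    simp only [resS]
    split_ifs <;> first | rfl | omega

lemma resS_mono {r R : ℕ} (h : r ≤ R) {g g' : RCG M} (hg : resS R g = resS R g') :
    resS r g = resS r g' := by
  rw [← resS_resS h g, hg, resS_resS h]

lemma dist_eq_tsum (g g' : RCG M) :
    dist g g' = ∑' r : ℕ, if resS r g = resS r g' then (0 : ℝ) else (2 : ℝ)⁻¹ ^ r := rfl

lemma summable_dist (g g' : RCG M) :
    Summable fun r : ℕ => if resS r g = resS r g' then (0 : ℝ) else (2 : ℝ)⁻¹ ^ r := by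
  refine Summable.of_nonneg_of_le (fun r => ?_) (fun r => ?_)
    (summable_geometric_of_lt_one (by norm_num) (by norm_num : (2 : ℝ)⁻¹ < 1))
  · split_ifs <;> positivity
  · split_ifs
    · positivity
    · exact le_rfl

lemma resS_eq_of_dist_lt {r : ℕ} {g g' : RCG M} (h : dist g g' < (2 : ℝ)⁻¹ ^ r) :
    resS r g = resS r g' := by
  by_contra hne
  rw [dist_eq_tsum] at h
  refine absurd h (not_lt.2 ?_)
  have := (summable_dist g g').le_tsum r (fun j _ => by split_ifs <;> positivity)
  rwa [if_neg hne] at this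

lemma dist_le_of_resS_eq {r : ℕ} {g g' : RCG M} (h : resS r g = resS r g') :
    dist g g' ≤ (2 : ℝ)⁻¹ ^ r := by
  have hs := summable_dist g g'
  rw [dist_eq_tsum, ← hs.sum_add_tsum_nat_add (r + 1), Finset.sum_eq_zero, zero_add]
  · have hgeo : Summable fun i : ℕ => (2 : ℝ)⁻¹ ^ (i + (r + 1)) :=
      (summable_nat_add_iff (r + 1)).2
        (summable_geometric_of_lt_one (by norm_num) (by norm_num : (2 : ℝ)⁻¹ < 1))
    refine (Summable.tsum_le_tsum (fun i => ?_) ((summable_nat_add_iff (r + 1)).2 hs) hgeo).trans ?_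
    · split_ifs
      · positivity
      · exact le_rfl
    · simp_rw [pow_add]
      rw [tsum_mul_right, tsum_geometric_of_lt_one (by norm_num) (by norm_num)]
      norm_num
      rw [mul_comm, mul_assoc]
      norm_num
  · intro i hi
    exact if_pos (resS_mono (by simpa [Nat.lt_succ_iff] using hi) h)

lemma measurable_resS (r : ℕ) : Measurable (resS r : RCG M → RCG M) := by
  refine Continuous.measurable (Metric.continuous_iff.2 fun b ε hε => ⟨(2 : ℝ)⁻¹ ^ r,
    by positivity, fun a ha => ?_⟩)
  rw [resS_eq_of_dist_lt ha, dist_self]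
  exact hε

lemma measurableSet_singleton_rcg (g : RCG M) : MeasurableSet {g} :=
  isClosed_singleton.measurableSet

lemma mem_of_mem_thickening_resS {r : ℕ} {ε : ℝ} (hε : ε ≤ (2 : ℝ)⁻¹ ^ r) {B : Set (RCG M)}
    (hB : ∀ g ∈ B, resS r g = g) {g : RCG M} (hg : resS r g = g)
    (h : g ∈ Metric.thickening ε B) : g ∈ B := by
  obtain ⟨g', hg', hd⟩ := Metric.mem_thickening_iff.1 h
  have := resS_eq_of_dist_lt (hd.trans_le hε)
  rw [hg, hB g' hg'] at this
  exact this ▸ hg'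

end RCGMetric

section TreeLaw

variable {M : Type} {D : ℕ}

lemma resS_iotaTd_iff (k : ℕ) (x x' : TdVertex (D + 1) → M) :
    resS (k + 1) (iotaTd (D + 1) x) = resS (k + 1) (iotaTd (D + 1) x') ↔
      obsL D k x = obsL D k x' := by
  rw [obsL_inj_iff]
  constructor
  · rintro h ⟨l, hl⟩ hv
    have h1 := congrFun (congrArg RCG.col h) l
    have hv' : l.length ≤ k + 1 := hv
    simpa only [resS, hv', if_true, iotaTd, dif_pos hl, Option.some.injEq] using h1
  · intro h
    ext1
    · funext l
      by_cases hk : l.length ≤ k + 1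
      · by_cases hl : ValidTd (D + 1) l
        · simp only [resS, hk, if_true, iotaTd, dif_pos hl]
          rw [h ⟨l, hl⟩ hk]
        · simp only [resS, iotaTd, dif_neg hl]
      · simp only [resS, hk, if_false]
    · rfl

lemma br_surjective : ∀ (k : ℕ) (b : Br M D k), ∃ Y : List ℕ → M, br D k Y = b
  | 0, b => ⟨fun _ => b, rfl⟩
  | k + 1, b => by
    choose Y hY using fun i => br_surjective k (b.2 i)
    refine ⟨fun w => match w.getLast? with
      | none => b.1
      | some a => if h : a - 1 < D then Y ⟨a - 1, h⟩ w.dropLast else b.1, ?_⟩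
    refine Prod.ext rfl (funext fun i => ?_)
    rw [← hY i]
    change br D k _ = _
    congr 1
    funext w
    simp

lemma encL_surjective (k : ℕ) (y : M × (Fin (D + 1) → Br M D k)) :
    ∃ Y : List ℕ → M, encL D k Y = y := by
  choose Y hY using fun i => br_surjective k (y.2 i)
  refine ⟨fun w => match w.getLast? with
    | none => y.1
    | some a => if h : a - 1 < D + 1 then Y ⟨a - 1, h⟩ w.dropLast else y.1, ?_⟩
  refine Prod.ext rfl (funext fun i => ?_)
  rw [← hY i]
  change br D k _ = _
  congr 1
  funext w
  simpa using fun h => absurd i.2 (by omega)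

lemma encL_eq_obsL (k : ℕ) (Y : List ℕ → M) :
    encL D k Y = obsL D k (fun v : TdVertex (D + 1) => Y v.1) :=
  (encL_inj_iff k _ _).2 fun _ hw _ => (extX_of_valid (fun v : TdVertex (D + 1) => Y v.1) hw).symm

/-- The ball of the tree described by `y`. -/
def ballOf {k : ℕ} (y : M × (Fin (D + 1) → Br M D k)) : RCG M :=
  resS (k + 1) (iotaTd (D + 1) fun v => (encL_surjective k y).choose v.1)

lemma resS_iotaTd (k : ℕ) (x : TdVertex (D + 1) → M) :
    resS (k + 1) (iotaTd (D + 1) x) = ballOf (obsL D k x) := by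
  rw [ballOf, resS_iotaTd_iff, ← encL_eq_obsL]
  exact (encL_surjective k (obsL D k x)).choose_spec.symm

lemma ballOf_injective (k : ℕ) :
    Function.Injective (ballOf : M × (Fin (D + 1) → Br M D k) → RCG M) := by
  intro y y' h
  rw [ballOf, ballOf, resS_iotaTd_iff, ← encL_eq_obsL, ← encL_eq_obsL,
    (encL_surjective k y).choose_spec, (encL_surjective k y').choose_spec] at h
  exact h

lemma resS_ballOf {k : ℕ} (y : M × (Fin (D + 1) → Br M D k)) :
    resS (k + 1) (ballOf y) = ballOf y := resS_resS le_rfl _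

variable [Fintype M] [MeasurableSpace M] [DiscreteMeasurableSpace M]

lemma measurable_iotaTd : Measurable (iotaTd (D + 1) : (TdVertex (D + 1) → M) → RCG M) := by
  refine measurable_of_isOpen fun U hU => ?_
  have h : iotaTd (D + 1) ⁻¹' U = ⋃ k : ℕ, ⋃ y ∈ {y : M × (Fin (D + 1) → Br M D k) |
      ∀ x, obsL D k x = y → iotaTd (D + 1) x ∈ U}, obsL D k ⁻¹' {y} := by
    ext x
    simp only [Set.mem_preimage, Set.mem_iUnion, Set.mem_singleton_iff, exists_prop]
    constructor
    · intro hx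
      obtain ⟨ε, hε, hb⟩ := Metric.isOpen_iff.1 hU _ hx
      obtain ⟨k, hk⟩ := exists_pow_lt_of_lt_one hε (by norm_num : (2 : ℝ)⁻¹ < 1)
      refine ⟨k, obsL D k x, fun x' hx' => hb ?_, rfl⟩
      refine lt_of_le_of_lt (dist_le_of_resS_eq ((resS_iotaTd_iff k x' x).2 hx')) (lt_trans ?_ hk)
      exact pow_lt_pow_right_of_lt_one₀ (by norm_num) (by norm_num) (by omega)
    · rintro ⟨k, y, hy, hx⟩
      exact hy x hx
  rw [h]
  exact MeasurableSet.iUnion fun k => MeasurableSet.biUnion (Set.to_countable _)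
    fun y _ => measurableSet_obsL k y

lemma real_map_lawTd (μ : Measure (TdVertex (D + 1) → M)) [IsProbabilityMeasure μ] (k : ℕ)
    {B : Set (RCG M)} (hB : MeasurableSet B) :
    ((lawTd (D + 1) μ).map (resS (k + 1))).real B =
      ∑ y with ballOf y ∈ B, pmass μ (obsL D k) y := by
  rw [lawTd, measureReal_def, Measure.map_apply (measurable_resS _) hB,
    Measure.map_apply measurable_iotaTd (measurable_resS _ hB), ← measureReal_def]
  have h : iotaTd (D + 1) ⁻¹' (resS (k + 1) ⁻¹' B) =
      ⋃ y ∈ Finset.univ.filter fun y : M × (Fin (D + 1) → Br M D k) => ballOf y ∈ B,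
        obsL D k ⁻¹' {y} := by
    ext x
    simp [resS_iotaTd]
  rw [h, measureReal_biUnion_finset]
  · rfl
  · intro y _ y' _ hy
    exact Set.disjoint_left.2 fun x hx hx' => hy (hx.symm.trans hx')
  · exact fun y _ => measurableSet_obsL k y

lemma isProbabilityMeasure_map_lawTd (μ : Measure (TdVertex (D + 1) → M)) [IsProbabilityMeasure μ]
    (r : ℕ) : IsProbabilityMeasure ((lawTd (D + 1) μ).map (resS r)) := by
  have : IsProbabilityMeasure (lawTd (D + 1) μ) :=
    Measure.isProbabilityMeasure_map measurable_iotaTd.aemeasurable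
  exact Measure.isProbabilityMeasure_map (measurable_resS r).aemeasurable

end TreeLaw

section GraphLaw

variable {M : Type*} {n : ℕ} (G : SimpleGraph (Fin n)) (f : Fin n → M)

lemma isProbabilityMeasure_distrG (hn : n ≠ 0) : IsProbabilityMeasure (distrG G f) := by
  have h1 : ∀ v, distrAt G f v Set.univ = 1 := by
    intro v
    simp [distrAt, Fintype.card_perm]
    exact ENNReal.inv_mul_cancel (by exact_mod_cast n.factorial_ne_zero) (by simp)
  constructor
  simp [distrG, h1]
  exact ENNReal.inv_mul_cancel (by exact_mod_cast hn) (by simp)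

/-- The probability that the search from `v` finds a graph in `B`. -/
def searchProb (r : ℕ) (v : Fin n) (B : Set (RCG M)) : ℝ :=
  (Finset.univ.filter fun σ => resS r (bfsRCG G f v σ) ∈ B).card / (n.factorial : ℝ)

lemma real_map_distrG (r : ℕ) {B : Set (RCG M)} (hB : MeasurableSet B) :
    ((distrG G f).map (resS r)).real B = (∑ v, searchProb G f r v B) / n := by
  rw [measureReal_def, Measure.map_apply (measurable_resS _) hB]
  have hB' := measurable_resS r hB
  have h1 : ∀ v, distrAt G f v (resS r ⁻¹' B) = ENNReal.ofReal (searchProb G f r v B) := by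
    intro v
    rw [searchProb, ENNReal.ofReal_div_of_pos (by positivity), ENNReal.ofReal_natCast,
      ENNReal.ofReal_natCast, distrAt]
    simp only [Measure.smul_apply, Measure.finsetSum_apply, smul_eq_mul,
      Measure.dirac_apply' _ hB', Set.indicator_apply, Set.mem_preimage, Pi.one_apply]
    rw [Finset.sum_boole, mul_comm, div_eq_mul_inv]
  have h0 : ∀ v, 0 ≤ searchProb G f r v B := fun v => by unfold searchProb; positivity
  rw [distrG]
  simp only [Measure.smul_apply, Measure.finsetSum_apply, smul_eq_mul, h1]
  rw [← ENNReal.ofReal_sum_of_nonneg (fun v _ => h0 v), ENNReal.toReal_mul,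
    ENNReal.toReal_ofReal (Finset.sum_nonneg fun v _ => h0 v), ENNReal.toReal_inv,
    ENNReal.toReal_natCast]
  ring

end GraphLaw
/-! ### Local statistics of a colored graph and counts of vertex types -/

section LocalStatistics

variable {M : Type} {D k : ℕ}

/-- The class of a vertex type up to permutations of the ports. -/
def clV (a : VType M D k) : Set (VType M D k) := Set.range fun s => portPerm s a

lemma clV_eq_iff {a b : VType M D k} : clV a = clV b ↔ ∃ s, b = portPerm s a := by
  constructor
  · intro h
    have : b ∈ clV b := ⟨1, rfl⟩
    rw [← h] at this
    obtain ⟨s, hs⟩ := this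
    exact ⟨s, hs.symm⟩
  · rintro ⟨s, rfl⟩
    refine Set.Subset.antisymm ?_ ?_
    · rintro _ ⟨t, rfl⟩
      refine ⟨s⁻¹ * t, ?_⟩
      refine Prod.ext rfl (funext fun i => ?_)
      change a.2 (s ((s⁻¹ * t) i)) = a.2 (t i)
      simp
    · rintro _ ⟨t, rfl⟩
      exact ⟨s * t, rfl⟩

lemma clV_toV_iff {y y' : M × (Fin (D + 1) → Br M D k)} :
    clV (toV y) = clV (toV y') ↔ REqv k y y' := by
  rw [eq_comm, clV_eq_iff]
  constructor
  · rintro ⟨s, hs⟩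
    have h1 : y.1 = y'.1 := congrArg (fun a : VType M D k => a.1) hs
    refine ⟨h1, s, fun i => ucl_eq.1 ?_⟩
    exact congrFun (congrArg (fun a : VType M D k => a.2) hs) i
  · rintro ⟨h, s, hs⟩
    exact ⟨s, Prod.ext h (funext fun i => ucl_eq.2 (hs i))⟩

/-- The balls whose root has a given type. -/
def ballsOf (c : Set (VType M D k)) : Set (RCG M) := ballOf '' {y | clV (toV y) = c}

variable {n : ℕ} {m : Equiv.Perm (Fin n × Fin (D + 1))}

lemma clV_typeOf_of_search (hm : IsSimp m) {f : Fin n → M} {v : Fin n} {σ : Equiv.Perm (Fin n)}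
    {y : M × (Fin (D + 1) → Br M D k)}
    (h : resS (k + 1) (bfsRCG (graphOf m hm) f v σ) = ballOf y) :
    clV (toV y) = clV (typeOf k f m v) := by
  obtain ⟨β, hβ, hf⟩ := exists_cov_of_resS_eq (graphOf_regular hm) h
  obtain ⟨s, hs⟩ := hβ.exists_portPerm f
  have h1 : encL D k (fun l => f (β l)) = y := by
    rw [← (encL_surjective k y).choose_spec, encL_inj_iff]
    exact fun w hw hk => hf w hw hk
  rw [h1] at hs
  rw [eq_comm, clV_eq_iff]
  exact ⟨s, hs⟩

lemma searchProb_le_ite (G : SimpleGraph (Fin n)) (f : Fin n → M) (r : ℕ) (v : Fin n)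
    (B : Set (RCG M)) {p : Prop} (h : ∀ σ, resS r (bfsRCG G f v σ) ∈ B → p) :
    searchProb G f r v B ≤ if p then 1 else 0 := by
  have hn : (0 : ℝ) < n.factorial := by exact_mod_cast n.factorial_pos
  unfold searchProb
  split_ifs with hp
  · rw [div_le_one hn]
    have := Finset.card_filter_le (Finset.univ : Finset (Equiv.Perm (Fin n)))
      (fun σ => resS r (bfsRCG G f v σ) ∈ B)
    rw [Finset.card_univ, Fintype.card_perm, Fintype.card_fin] at this
    exact_mod_cast this
  · rw [Finset.filter_false_of_mem (fun σ _ hσ => hp (h σ hσ))]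
    simp

variable [Fintype M] [MeasurableSpace M] [DiscreteMeasurableSpace M]

lemma push_clV_lawV {μ : Measure (TdVertex (D + 1) → M)} (hμ : μ ∈ InvMeas (D + 1) M)
    (c : Set (VType M D k)) :
    push clV (lawV D k μ) c = ∑ y with clV (toV y) = c, pmass μ (obsL D k) y := by
  rw [lawV_eq_push hμ, push_push]
  rfl

theorem near_typeOf_of_mem_FSet {μ : Measure (TdVertex (D + 1) → M)}
    (hμ : μ ∈ InvMeas (D + 1) M) (hn : n ≠ 0) (hm : IsSimp m) {f : Fin n → M} {ε ε' : ℝ}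
    (hf : f ∈ FSet (D + 1) μ (k + 1) ε (graphOf m hm)) (hε : ε < ε')
    (hε' : ε' ≤ (2 : ℝ)⁻¹ ^ (k + 1)) :
    Near clV (lawV D k μ) ε' (typeOf k f m) := by
  intro c
  have := hμ.1
  have h1 := isProbabilityMeasure_distrG (graphOf m hm) f hn
  have h2 := Measure.isProbabilityMeasure_map (μ := distrG (graphOf m hm) f)
    (measurable_resS (k + 1)).aemeasurable
  have h3 := isProbabilityMeasure_map_lawTd μ (k + 1)
  have hfin : (ballsOf c).Finite := (Set.toFinite _).image _
  have hmeas : MeasurableSet (ballsOf c) := hfin.measurableSet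
  have hlt := measureReal_le_of_levyProkhorovDist_lt _ _ (lt_of_le_of_lt hf hε) hmeas
  have hth : MeasurableSet (Metric.thickening ε' (ballsOf c)) := Metric.isOpen_thickening.measurableSet
  rw [real_map_lawTd μ k hmeas, real_map_distrG _ _ _ hth] at hlt
  have hpush : push clV (lawV D k μ) c = ∑ y with ballOf y ∈ ballsOf c, pmass μ (obsL D k) y := by
    rw [push_clV_lawV hμ]
    refine Finset.sum_congr (Finset.filter_congr fun y _ => ?_) fun _ _ => rfl
    exact ((ballOf_injective k).mem_set_image (s := {y | clV (toV y) = c})).symm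
  rw [← hpush] at hlt
  have hsum : ∑ v, searchProb (graphOf m hm) f (k + 1) v (Metric.thickening ε' (ballsOf c)) ≤
      cnt (clV ∘ typeOf k f m) c := by
    rw [cnt, Finset.card_filter, Nat.cast_sum]
    refine Finset.sum_le_sum fun v _ => ?_
    refine (searchProb_le_ite _ _ _ _ _ (p := clV (typeOf k f m v) = c) fun σ hσ => ?_).trans ?_
    · obtain ⟨y, hy, hy'⟩ := mem_of_mem_thickening_resS hε'
        (by rintro _ ⟨y, _, rfl⟩; exact resS_ballOf y) (resS_resS le_rfl _) hσ
      rw [← clV_typeOf_of_search hm hy'.symm]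
      exact hy
    · split_ifs <;> simp_all
  have hn' : (0 : ℝ) < n := by exact_mod_cast Nat.pos_of_ne_zero hn
  rw [Fintype.card_fin]
  have h5 := div_le_div_of_nonneg_right hsum hn'.le
  have h6 : push clV (lawV D k μ) c - ε' ≤ (cnt (clV ∘ typeOf k f m) c : ℝ) / n := by linarith
  rw [le_div_iff₀ hn'] at h6
  linarith

lemma searchProb_of_good (hm : IsSimp m) (f : Fin n → M) {v : Fin n} (hv : v ∉ badV (k + 2) m)
    (y : M × (Fin (D + 1) → Br M D k)) (hy : clV (typeOf k f m v) = clV (toV y)) :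
    ((Finset.univ.filter fun y' => clV (toV y') = clV (toV y)).card : ℝ) *
      searchProb (graphOf m hm) f (k + 1) v {ballOf y} = 1 := by
  have hG := graphOf_regular hm
  have hi : ∀ σ, Set.InjOn (fun l => (pos (graphOf m hm) v σ l).1) (words D (k + 2)) := fun σ =>
    (cov_walk hm v (k + 2)).injOn (cov_pos hG v σ _) (by rwa [mem_badV, not_not] at hv)
  have hres : ∀ σ, resS (k + 1) (bfsRCG (graphOf m hm) f v σ) =
      ballOf (encL D k fun l => f (pos (graphOf m hm) v σ l).1) := by
    intro σ
    rw [resS_bfsRCG hG (hi σ) f, resS_iotaTd]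
    exact congrArg ballOf (encL_eq_obsL k fun l => f (pos (graphOf m hm) v σ l).1).symm
  let N := fun y' : M × (Fin (D + 1) → Br M D k) => (Finset.univ.filter fun σ =>
    encL D k (fun l => f (pos (graphOf m hm) v σ l).1) = y').card
  have hN : ∀ y', clV (toV y') = clV (toV y) → N y' = N y := fun y' h =>
    le_antisymm (card_encL_pos_le hG (by omega) hi f (clV_toV_iff.1 h))
      (card_encL_pos_le hG (by omega) hi f (clV_toV_iff.1 h.symm))
  have hsum : ∑ y' with clV (toV y') = clV (toV y), N y' = n.factorial := by
    have h1 := Finset.card_eq_sum_card_fiberwise (s := (Finset.univ : Finset (Equiv.Perm (Fin n))))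
      (t := Finset.univ.filter fun y' => clV (toV y') = clV (toV y))
      (f := fun σ => encL D k (fun l => f (pos (graphOf m hm) v σ l).1)) (fun σ _ => by
        simp only [Finset.coe_filter, Finset.mem_univ, true_and, Set.mem_ofPred_eq]
        rw [← hy]
        exact clV_typeOf_of_search hm (hres σ))
    rw [Finset.card_univ, Fintype.card_perm, Fintype.card_fin] at h1
    exact h1.symm
  rw [Finset.sum_congr rfl fun y' hy' => hN y' (Finset.mem_filter.1 hy').2, Finset.sum_const,
    smul_eq_mul] at hsum
  have hp : searchProb (graphOf m hm) f (k + 1) v {ballOf y} = (N y : ℝ) / n.factorial := by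
    unfold searchProb
    congr 2
    refine congrArg _ (Finset.filter_congr fun σ _ => ?_)
    rw [hres, Set.mem_singleton_iff, (ballOf_injective k).eq_iff]
  rw [hp, ← mul_div_assoc]
  have hn : (n.factorial : ℝ) ≠ 0 := by exact_mod_cast n.factorial_ne_zero
  rw [div_eq_one_iff_eq hn]
  exact_mod_cast hsum

theorem mem_FSet_of_emp_typeOf {μ : Measure (TdVertex (D + 1) → M)}
    (hμ : μ ∈ InvMeas (D + 1) M) (hn : n ≠ 0) (hm : IsSimp m) {f : Fin n → M} {ε δ : ℝ} {C : ℕ}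
    (hε : 0 ≤ ε) (hbad : (badV (k + 2) m).card ≤ C)
    (hemp : ∀ b, |emp (typeOf k f m) b - lawV D k μ b| ≤ ε)
    (hδ : Fintype.card (M × (Fin (D + 1) → Br M D k)) *
      (Fintype.card (VType M D k) * ε + C / n) ≤ δ) :
    f ∈ FSet (D + 1) μ (k + 1) δ (graphOf m hm) := by
  have := hμ.1
  have h1 := isProbabilityMeasure_distrG (graphOf m hm) f hn
  have h2 := Measure.isProbabilityMeasure_map (μ := distrG (graphOf m hm) f)
    (measurable_resS (k + 1)).aemeasurable
  have h3 := isProbabilityMeasure_map_lawTd μ (k + 1)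
  have hn' : (0 : ℝ) < n := by exact_mod_cast Nat.pos_of_ne_zero hn
  change levyProkhorovDist _ _ ≤ δ
  rw [levyProkhorovDist_comm]
  refine le_trans ?_ hδ
  refine levyProkhorovDist_le_of_atoms _ _ ballOf (ballOf_injective k)
    (fun y => measurableSet_singleton_rcg _) (pmass μ (obsL D k))
    (fun B hB => real_map_lawTd μ k hB) (by positivity) fun y => ?_
  rw [real_map_distrG _ _ _ (measurableSet_singleton_rcg _)]
  set c := clV (toV y)
  set N : ℝ := ((Finset.univ.filter fun y' => clV (toV y') = c).card : ℝ) with hNdef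
  have hN : 1 ≤ N := by
    rw [hNdef]
    exact_mod_cast Finset.card_pos.2 ⟨y, by simp [c]⟩
  have hpush : push clV (lawV D k μ) c = N * pmass μ (obsL D k) y := by
    rw [push_clV_lawV hμ, Finset.sum_congr rfl fun y' hy' =>
      pmass_obsL_REqv hμ (clV_toV_iff.1 (Finset.mem_filter.1 hy').2), Finset.sum_const,
      nsmul_eq_mul]
  have hcnt : (cnt (clV ∘ typeOf k f m) c : ℝ) / n = push clV (emp (typeOf k f m)) c := by
    have hA : (cnt (clV ∘ typeOf k f m) c : ℝ) =
        ∑ v, (fun b => if clV b = c then (1 : ℝ) else 0) (typeOf k f m v) := by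
      rw [cnt, Finset.card_filter, Nat.cast_sum]
      refine Finset.sum_congr rfl fun v _ => ?_
      by_cases h : clV (typeOf k f m v) = c <;> simp [h]
    rw [hA, sum_comp_eq_cnt (typeOf k f m) (fun b => if clV b = c then (1 : ℝ) else 0), push, Finset.sum_filter, Finset.sum_div]
    refine Finset.sum_congr rfl fun b _ => ?_
    rw [emp, Fintype.card_fin]
    split_ifs <;> simp
  have hclose : push clV (lawV D k μ) c - Fintype.card (VType M D k) * ε ≤
      push clV (emp (typeOf k f m)) c := by
    have h4 : push clV (lawV D k μ) c - push clV (emp (typeOf k f m)) c ≤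
        ∑ b : VType M D k, ε := by
      rw [push, push, ← Finset.sum_sub_distrib]
      refine (Finset.sum_le_sum (g := fun _ => ε) fun b _ => ?_).trans
        (Finset.sum_le_sum_of_subset_of_nonneg (Finset.subset_univ _) fun _ _ _ => hε)
      have := abs_le.1 (hemp b)
      linarith
    rw [Finset.sum_const, nsmul_eq_mul, Finset.card_univ] at h4
    linarith
  have hS : (cnt (clV ∘ typeOf k f m) c : ℝ) - C ≤
      N * ∑ v, searchProb (graphOf m hm) f (k + 1) v {ballOf y} := by
    have h5 : (Finset.univ.filter fun v => (clV ∘ typeOf k f m) v = c).card ≤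
        ((Finset.univ.filter fun v => (clV ∘ typeOf k f m) v = c) \ badV (k + 2) m).card + C := by
      have := Finset.le_card_sdiff (badV (k + 2) m)
        (Finset.univ.filter fun v => (clV ∘ typeOf k f m) v = c)
      omega
    have h6 : (cnt (clV ∘ typeOf k f m) c : ℝ) ≤
        ((Finset.univ.filter fun v => (clV ∘ typeOf k f m) v = c) \ badV (k + 2) m).card + C := by
      exact_mod_cast h5
    have h7 : (((Finset.univ.filter fun v => (clV ∘ typeOf k f m) v = c) \
        badV (k + 2) m).card : ℝ) ≤
        ∑ v, N * searchProb (graphOf m hm) f (k + 1) v {ballOf y} := by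
      rw [Finset.card_eq_sum_ones, Nat.cast_sum]
      refine (Finset.sum_le_sum fun v hv => ?_).trans
        (Finset.sum_le_sum_of_subset_of_nonneg (Finset.subset_univ _) fun _ _ _ => ?_)
      · obtain ⟨hv1, hv2⟩ := Finset.mem_sdiff.1 hv
        rw [Nat.cast_one]
        exact (searchProb_of_good hm f hv2 y (Finset.mem_filter.1 hv1).2).ge
      · unfold searchProb
        positivity
    rw [Finset.mul_sum]
    linarith
  set S := ∑ v, searchProb (graphOf m hm) f (k + 1) v {ballOf y}
  have h8 := div_le_div_of_nonneg_right hS hn'.le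
  rw [sub_div, hcnt, mul_div_assoc] at h8
  have hC : 0 ≤ (C : ℝ) / n := by positivity
  have hE : 0 ≤ (Fintype.card (VType M D k) : ℝ) * ε := by positivity
  have h9 : N * (pmass μ (obsL D k) y - S / n) ≤ Fintype.card (VType M D k) * ε + C / n := by
    rw [mul_sub, ← hpush]
    linarith
  by_contra hlt
  push Not at hlt
  have h10 : Fintype.card (VType M D k) * ε + C / n < pmass μ (obsL D k) y - S / n := by linarith
  nlinarith

end LocalStatistics

/-! ### Counting colored graphs through half-edge matchings -/

section Counting

lemma mats_nonempty {H : Type*} [Fintype H] (h : Even (Fintype.card H)) : (mats H).Nonempty := by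
  obtain ⟨q, hq⟩ := h
  have e : H ≃ Fin q × Bool := Fintype.equivOfCardEq (by simp [hq, mul_two])
  refine ⟨e.trans (((Equiv.refl _).prodCongr Equiv.boolNot).trans e.symm), ?_⟩
  simp only [mats, Finset.mem_filter, Finset.mem_univ, true_and, IsMat]
  refine ⟨fun h => e.injective (by ext <;> simp), fun h h' => ?_⟩
  have := congrArg (fun x => (e x).2) h'
  simp at this

variable {D k n : ℕ}

lemma card_simple_le (n D : ℕ) :
    {m : Equiv.Perm (Fin n × Fin (D + 1)) | IsSimp m}.ncard
      ≤ (mats (Fin n × Fin (D + 1))).card := by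
  rw [← Set.ncard_coe_finset]
  refine Set.ncard_le_ncard (fun m hm => ?_) (Set.toFinite _)
  simpa [mats] using (isSimp_iff.1 hm).1

lemma exists_card_mats_le (D : ℕ) : ∃ b n₀ : ℕ, ∀ n ≥ n₀,
    (mats (Fin n × Fin (D + 1))).card ≤ 2 * (((n * (D + 1)) ^ 2) ^ b *
      {m : Equiv.Perm (Fin n × Fin (D + 1)) | IsSimp m}.ncard) := by
  obtain ⟨b, C, n₀, h⟩ := card_cons_le_card_simple D 1 le_rfl one_pos
  refine ⟨b, n₀, fun n hn => ?_⟩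
  have := h n hn (K := Unit) id (fun _ => ()) (fun t => Or.inr ?_)
  · refine le_trans (Finset.card_le_card fun m hm => ?_) (this.trans ?_)
    · simpa [mem_cons, mats] using hm
    · gcongr
      rw [← Set.ncard_coe_finset]
      refine Set.ncard_le_ncard (fun m hm => ?_) (Set.toFinite _)
      obtain ⟨h1, h2, -⟩ := mem_fewBad.1 hm
      exact isSimp_iff.2 ⟨(mem_cons.1 h1).1, h2⟩
  · have : cnt (fun _ : Fin n × Fin (D + 1) => ()) t = n * (D + 1) := by
      simp [cnt]
    rw [this]
    push_cast
    nlinarith [n.cast_nonneg (α := ℝ), D.cast_nonneg (α := ℝ)]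

variable {M : Type} [Fintype M] [MeasurableSpace M]

/-- The pairs of a simple matching of half-edges and a coloring whose colored graph has
statistics close to `μ`. -/
def matPairs (D n r : ℕ) (μ : Measure (TdVertex (D + 1) → M)) (ε : ℝ) :
    Set (Equiv.Perm (Fin n × Fin (D + 1)) × (Fin n → M)) :=
  {mf | ∃ hm : IsSimp mf.1, mf.2 ∈ FSet (D + 1) μ r ε (graphOf mf.1 hm)}

lemma ncard_regularGraphs_mul (n D : ℕ) :
    (regularGraphs (D + 1) n).ncard * (D + 1).factorial ^ n =
      {m : Equiv.Perm (Fin n × Fin (D + 1)) | IsSimp m}.ncard := by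
  have h := ncard_graph_mul (X := Fin n) (D := D) (F := Unit) (fun _ _ => True)
  rw [Fintype.card_fin] at h
  have inj : ∀ Y : Type, Function.Injective fun y : Y => (y, ()) := fun Y a b h =>
    (Prod.mk.inj h).1
  rw [← Set.ncard_image_of_injective _ (inj _), ← Set.ncard_image_of_injective
    {m : Equiv.Perm (Fin n × Fin (D + 1)) | IsSimp m} (inj _)]
  convert h using 3
  · ext ⟨G, u⟩
    simp [regularGraphs]
  · ext ⟨m, u⟩
    simp

lemma ncard_GnPairs_mul (μ : Measure (TdVertex (D + 1) → M)) (r : ℕ) (ε : ℝ) :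
    (GnPairs (D + 1) μ r ε n).ncard * (D + 1).factorial ^ n = (matPairs D n r μ ε).ncard := by
  have h := ncard_graph_mul (X := Fin n) (D := D) (F := Fin n → M)
    (fun G f => f ∈ FSet (D + 1) μ r ε G)
  rwa [Fintype.card_fin] at h

lemma card_ratio_eq (μ : Measure (TdVertex (D + 1) → M)) (r : ℕ) (ε : ℝ) :
    ((GnPairs (D + 1) μ r ε n).ncard : ℝ) / (regularGraphs (D + 1) n).ncard =
      (matPairs D n r μ ε).ncard /
        {m : Equiv.Perm (Fin n × Fin (D + 1)) | IsSimp m}.ncard := by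
  rw [← ncard_GnPairs_mul, ← ncard_regularGraphs_mul]
  push_cast
  rw [mul_div_mul_right]
  positivity

lemma two_mul_pow_le_exp (b N : ℕ) (hN : 0 < N) :
    (2 : ℝ) * ((N : ℝ) ^ 2) ^ b ≤ Real.exp ((1 + 2 * b) * errN N) := by
  have hN' : (0 : ℝ) < N := by exact_mod_cast hN
  rw [← Real.log_le_iff_le_exp (by positivity), Real.log_mul (by norm_num) (by positivity),
    Real.log_pow, Real.log_pow, errN]
  have h1 : Real.log 2 ≤ 1 := by linarith [Real.log_two_lt_d9]
  have h2 : Real.log N ≤ Real.log (N + 1) := Real.log_le_log hN' (by linarith)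
  have h3 : 0 ≤ Real.log ((N : ℝ) + 1) := Real.log_nonneg (by linarith)
  have h4 : (b : ℝ) * Real.log N ≤ b * Real.log (N + 1) := by gcongr
  push_cast
  nlinarith [b.cast_nonneg (α := ℝ)]

variable [DiscreteMeasurableSpace M] {μ : Measure (TdVertex (D + 1) → M)}

lemma cnt_kap_eq_of_clV {a b : VType M D k} (h : clV a = clV b) (t : UBr M D k × UBr M D k) :
    cnt (fun i => kap i a) t = cnt (fun i => kap i b) t := by
  obtain ⟨s, rfl⟩ := clV_eq_iff.1 h
  have : (fun i => kap i (portPerm s a)) = (fun i => kap i a) ∘ s := by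
    funext i
    exact kap_perm s i a
  rw [this, cnt_comp_perm]

lemma lawV_eq_of_clV (hμ : μ ∈ InvMeas (D + 1) M) {a b : VType M D k} (h : clV a = clV b) :
    lawV D k μ a = lawV D k μ b := by
  obtain ⟨s, rfl⟩ := clV_eq_iff.1 h
  exact (lawV_portPerm hμ s a).symm

lemma card_matPairs_le (hμ : μ ∈ InvMeas (D + 1) M) (hn : n ≠ 0) {ε ε' B : ℝ} (hε : ε < ε')
    (hε' : ε' ≤ (2 : ℝ)⁻¹ ^ (k + 1))
    (hB : ∀ a : Fin n → VType M D k, Near clV (lawV D k μ) ε' a →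
      ((cons Prod.swap (kapA kap a)).card : ℝ) ≤ B) :
    ((matPairs D n (k + 1) μ ε).ncard : ℝ) ≤
      (Finset.univ.filter fun a : Fin n → VType M D k => Near clV (lawV D k μ) ε' a).card * B := by
  set T := Finset.univ.filter fun a : Fin n → VType M D k => Near clV (lawV D k μ) ε' a with hT
  have h1 : (matPairs D n (k + 1) μ ε).ncard ≤
      (T.sigma fun a => cons Prod.swap (kapA kap a)).card := by
    rw [← Set.ncard_coe_finset]
    refine Set.ncard_le_ncard_of_injOn (fun mf => ⟨typeOf k mf.2 mf.1, mf.1⟩) ?_ ?_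
    · rintro ⟨m, f⟩ ⟨hm, hf⟩
      simp only [Finset.coe_sigma, Set.mem_sigma_iff, Finset.mem_coe, hT, Finset.mem_filter,
        Finset.mem_univ, true_and]
      exact ⟨near_typeOf_of_mem_FSet hμ hn hm hf hε hε', mem_cons_typeOf k f (isSimp_iff.1 hm).1⟩
    · rintro ⟨m, f⟩ - ⟨m', f'⟩ - h
      simp only [Sigma.mk.injEq, heq_eq_eq] at h
      refine Prod.ext h.2 (funext fun v => ?_)
      exact congrArg (fun a => (a v).1) h.1
  rw [Finset.card_sigma] at h1
  calc ((matPairs D n (k + 1) μ ε).ncard : ℝ)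
      ≤ ∑ a ∈ T, ((cons Prod.swap (kapA kap a)).card : ℝ) := by exact_mod_cast h1
    _ ≤ ∑ a ∈ T, B := Finset.sum_le_sum fun a ha => hB a (Finset.mem_filter.1 ha).2
    _ = T.card * B := by simp

lemma le_card_matPairs (hμ : μ ∈ InvMeas (D + 1) M) (hn : n ≠ 0) {ε ε' : ℝ} {B C : ℕ}
    (hε' : 0 ≤ ε') (hε : Fintype.card (M × (Fin (D + 1) → Br M D k)) *
      (Fintype.card (VType M D k) * ε' + C / n) ≤ ε)
    {a : Fin n → VType M D k} (ha : ∀ b, |emp a b - lawV D k μ b| ≤ ε')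
    (hB : ∀ a' ∈ tclass a, B ≤ (fewBad Prod.swap (kapA kap a') (k + 2) 0 C).card) :
    (tclass a).card * B ≤ (matPairs D n (k + 1) μ ε).ncard := by
  have h1 : ((tclass a).sigma fun a' => fewBad Prod.swap (kapA kap a') (k + 2) 0 C).card ≤
      (matPairs D n (k + 1) μ ε).ncard := by
    rw [← Set.ncard_coe_finset]
    refine Set.ncard_le_ncard_of_injOn (fun am => (am.2, fun v => (am.1 v).1)) ?_ ?_
      (Set.toFinite _)
    · rintro ⟨a', m⟩ h
      simp only [Finset.coe_sigma, Set.mem_sigma_iff, Finset.mem_coe, mem_fewBad] at h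
      obtain ⟨h1, h2, h3, h4⟩ := h
      refine ⟨isSimp_iff.2 ⟨(mem_cons.1 h2).1, h3⟩, ?_⟩
      refine mem_FSet_of_emp_typeOf hμ hn _ hε' h4 (fun b => ?_) hε
      rw [← eq_typeOf h2, emp, ← mem_tclass.1 h1 b]
      exact ha b
    · rintro ⟨a', m⟩ h ⟨a'', m'⟩ h' heq
      simp only [Finset.coe_sigma, Set.mem_sigma_iff, Finset.mem_coe, mem_fewBad] at h h'
      simp only [Prod.mk.injEq] at heq
      obtain ⟨rfl, h2⟩ := heq
      have : a' = a'' := by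
        rw [eq_typeOf h.2.1, eq_typeOf h'.2.1, h2]
      rw [this]
  rw [Finset.card_sigma] at h1
  refine le_trans ?_ h1
  rw [← smul_eq_mul, ← Finset.sum_const]
  exact Finset.sum_le_sum hB

end Counting

/-! ### Bounds for the expected number of colorings -/

section AnnealedBounds

lemma Bm_one_const {M : Type} {D : ℕ} (f : Unit → M) :
    ∀ (k : ℕ) (h h' : Unit × Fin (D + 1)), Bm f 1 k h = Bm f 1 k h'
  | 0, _, _ => rfl
  | k + 1, _, _ => Prod.ext rfl (funext fun _ => Bm_one_const f k _ _)

lemma exists_loop_type {M : Type} [Nonempty M] (D k : ℕ) :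
    ∃ (a : VType M D k) (t : UBr M D k × UBr M D k), (∀ i, kap i a = t) ∧ t.swap = t := by
  obtain ⟨x⟩ := ‹Nonempty M›
  have h := kapA_typeOf (D := D) k (fun _ : Unit => x) 1 fun _ => rfl
  refine ⟨typeOf k (fun _ => x) 1 (), (ucl (Bm (fun _ => x) 1 k ((), 0)),
    ucl (Bm (fun _ => x) 1 k ((), 0))), fun i => (h ((), i)).trans ?_, rfl⟩
  exact Prod.ext (congrArg ucl (Bm_one_const _ k _ _)) (congrArg ucl (Bm_one_const _ k _ _))

lemma nonempty_of_mem_InvMeas {M : Type} [MeasurableSpace M] {D : ℕ}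
    {μ : Measure (TdVertex (D + 1) → M)} (hμ : μ ∈ InvMeas (D + 1) M) : Nonempty M := by
  have := hμ.1
  obtain ⟨x⟩ := nonempty_of_isProbabilityMeasure μ
  exact ⟨x (rootTd _)⟩

variable {M : Type} [Fintype M] [MeasurableSpace M] [DiscreteMeasurableSpace M] {D k : ℕ}
  {μ : Measure (TdVertex (D + 1) → M)}

theorem exists_card_ratio_le (hD : 1 ≤ D) (hμ : μ ∈ InvMeas (D + 1) M) {δ : ℝ} (hδ : 0 < δ) :
    ∃ ε₀ > 0, ∃ A : ℝ, ∃ n₀ : ℕ, ∀ ε < ε₀, ∀ n ≥ n₀,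
      ((GnPairs (D + 1) μ (k + 1) ε n).ncard : ℝ) / (regularGraphs (D + 1) n).ncard ≤
        Real.exp (n * (SigmaR (D + 1) (k + 1) μ + δ) + A * errN (n * (D + 1))) := by
  set δ' := δ / (1 + (D + 1) / 2) with hδ'
  have hδ'0 : 0 < δ' := by positivity
  have hδ'' : δ' + (D + 1) / 2 * δ' = δ := by
    rw [hδ']
    field_simp
  obtain ⟨ε₁, hε₁, h₁⟩ := exists_card_near_le (cl := clV) (lawV_nonneg (D := D) (k := k) (μ := μ))
    (sum_lawV hμ) (fun b b' h => lawV_eq_of_clV hμ h) hδ'0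
  obtain ⟨η, hη, h₂⟩ := exists_Hf_near (lawK D k μ) hδ'0
  obtain ⟨b, n₀, h₃⟩ := exists_card_mats_le D
  set S := (Fintype.card (Set (VType M D k)) : ℝ) with hS
  have hS0 : 0 < S := by
    rw [hS]
    exact_mod_cast Fintype.card_pos
  set ε₀ := min (min ε₁ (η / S ^ 2)) ((2 : ℝ)⁻¹ ^ (k + 1)) with hε₀
  have hε₀0 : 0 < ε₀ := by positivity
  refine ⟨ε₀, hε₀0, Fintype.card (UBr M D k × UBr M D k) + (1 + 2 * b), max n₀ 1,
    fun ε hε n hn => ?_⟩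
  have hn0 : 0 < n := by omega
  have hn' : n ≠ 0 := hn0.ne'
  have hcard : Fintype.card (Fin n × Fin (D + 1)) = n * (D + 1) := by simp
  have hH : 0 < Fintype.card (Fin n × Fin (D + 1)) := by rw [hcard]; positivity
  rw [card_ratio_eq]
  set s := {m : Equiv.Perm (Fin n × Fin (D + 1)) | IsSimp m}.ncard
  set E := errN (n * (D + 1)) with hE
  have hmats : ((mats (Fin n × Fin (D + 1))).card : ℝ) ≤ Real.exp ((1 + 2 * b) * E) * s := by
    refine le_trans (b := 2 * (((n * (D + 1) : ℕ) : ℝ) ^ 2) ^ b * s) ?_ ?_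
    · have := h₃ n (by omega)
      rw [mul_assoc]
      exact_mod_cast this
    · gcongr
      exact two_mul_pow_le_exp b _ (by positivity)
  have hcons : ∀ a : Fin n → VType M D k, Near clV (lawV D k μ) ε₀ a →
      ((cons Prod.swap (kapA kap a)).card : ℝ) ≤ (mats (Fin n × Fin (D + 1))).card * Real.exp
        (-(n * (D + 1) / 2 * (Hf (lawK D k μ) - δ')) +
          Fintype.card (UBr M D k × UBr M D k) * E) := by
    intro a ha
    refine (card_cons_le Prod.swap_swap (kapA kap a) hH).trans ?_
    rw [hcard]
    have hclose := h₂ (emp (kapA kap a)) fun t => by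
      refine (abs_emp_kapA_sub_le (sum_lawV hμ) hε₀0.le ha (fun b b' h => cnt_kap_eq_of_clV h)
        (push_kap hμ) (by simpa using hn0) (by omega) t).trans ?_
      have : ε₀ ≤ η / S ^ 2 := (min_le_left _ _).trans (min_le_right _ _)
      exact (le_div_iff₀ (by positivity)).1 this
    have := (abs_le.1 hclose).1
    push_cast
    gcongr
    linarith
  have hmain := card_matPairs_le hμ hn' hε (min_le_right _ _) hcons
  have hnear : ((Finset.univ.filter fun a : Fin n → VType M D k =>
      Near clV (lawV D k μ) ε₀ a).card : ℝ) ≤ Real.exp (n * (Hf (lawV D k μ) + δ')) := by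
    refine le_trans ?_ (h₁ n)
    gcongr with a
    intro ha c
    have : ε₀ ≤ ε₁ := (min_le_left _ _).trans (min_le_left _ _)
    refine le_trans ?_ (ha c)
    gcongr
  refine div_le_of_le_mul₀ (by positivity) (by positivity) (hmain.trans ?_)
  calc _ ≤ Real.exp (n * (Hf (lawV D k μ) + δ')) * ((Real.exp ((1 + 2 * b) * E) * s) * Real.exp
        (-(n * (D + 1) / 2 * (Hf (lawK D k μ) - δ')) +
          Fintype.card (UBr M D k × UBr M D k) * E)) := by gcongr
    _ = _ := by
      rw [mul_right_comm (Real.exp _) _ (Real.exp _), ← mul_assoc, ← Real.exp_add, ← Real.exp_add,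
        sigmaR_eq hD hμ, ← hδ'']
      congr 2
      ring

lemma near_id_of_emp {A X : Type*} [Fintype A] [Fintype X] {P : A → ℝ} {ε : ℝ} {a : X → A}
    (hX : 0 < Fintype.card X) (h : ∀ b, |emp a b - P b| ≤ ε) : Near id P ε a := by
  intro b
  have h1 := (abs_le.1 (h b)).1
  have h2 : push id P b = P b := by simp [push, Finset.sum_filter]
  rw [h2, mul_comm, ← le_div_iff₀ (by exact_mod_cast hX)]
  change P b - ε ≤ emp a b
  linarith

lemma cnt_kapA_of_mem_tclass {A K X : Type*} [Fintype A] [Fintype K] [Fintype X] {e : ℕ}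
    (kp : Fin e → A → K) {a a' : X → A} (h : a' ∈ tclass a) (t : K) :
    cnt (kapA kp a') t = cnt (kapA kp a) t := by
  rw [cnt_kapA, cnt_kapA]
  have h1 := sum_comp_eq_cnt a' fun b => (cnt (fun i => kp i b) t : ℝ)
  have h2 := sum_comp_eq_cnt a fun b => (cnt (fun i => kp i b) t : ℝ)
  simp only [← mem_tclass.1 h] at h1
  exact_mod_cast h1.trans h2.symm

theorem exists_le_card_ratio (hD : 1 ≤ D) (hμ : μ ∈ InvMeas (D + 1) M) {ε δ : ℝ} (hε : 0 < ε)
    (hδ : 0 < δ) :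
    ∃ A : ℝ, ∃ n₀ : ℕ, ∀ n ≥ n₀, Even (n * (D + 1)) →
      Real.exp (n * (SigmaR (D + 1) (k + 1) μ - δ) - A * errN (n * (D + 1))) ≤
        ((GnPairs (D + 1) μ (k + 1) ε n).ncard : ℝ) / (regularGraphs (D + 1) n).ncard := by
  have := nonempty_of_mem_InvMeas hμ
  set δ' := δ / (1 + (D + 1) / 2) with hδ'
  have hδ'0 : 0 < δ' := by positivity
  have hδ'' : δ' + (D + 1) / 2 * δ' = δ := by
    rw [hδ']
    field_simp
  obtain ⟨η₁, hη₁, h₁⟩ := exists_Hf_near (lawV D k μ) hδ'0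
  obtain ⟨η₂, hη₂, h₂⟩ := exists_Hf_near (lawK D k μ) hδ'0
  obtain ⟨a₀, t₀, ha₀, ht₀⟩ := exists_loop_type (M := M) D k
  set V := (Fintype.card (VType M D k) : ℝ) with hV
  set L := (Fintype.card (M × (Fin (D + 1) → Br M D k)) : ℝ) with hL
  have : Nonempty (VType M D k) := ⟨a₀⟩
  have hV0 : 0 < V := by
    rw [hV]
    exact_mod_cast Fintype.card_pos
  have hL0 : 0 < L := by
    rw [hL]
    have : Nonempty (M × (Fin (D + 1) → Br M D k)) := ⟨(a₀.1, fun i => urep (a₀.2 i))⟩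
    exact_mod_cast Fintype.card_pos
  set ε₁ := min (min η₁ (η₂ / V ^ 2)) (ε / (2 * L * V)) with hε₁
  have hε₁0 : 0 < ε₁ := by positivity
  obtain ⟨ρ, hρ, n₁, h₃⟩ := exists_good_sequence (lawV_nonneg (D := D) (k := k) (μ := μ))
    (sum_lawV hμ) (push_kap hμ) (Prod.swap_swap : Function.Involutive Prod.swap) (by omega)
    (lawK_swap hD hμ) a₀ t₀ ha₀ ht₀ hε₁0
  obtain ⟨b, C, n₂, h₄⟩ := card_cons_le_card_simple D (k + 2) (by omega) hρ
  refine ⟨Fintype.card (VType M D k) + (Fintype.card (UBr M D k × UBr M D k) + 1) + (1 + 2 * b),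
    max (max n₁ n₂) (Nat.ceil (2 * L * C / ε) + 1), fun n hn hev => ?_⟩
  have hn0 : 0 < n := by omega
  have hnR : (0 : ℝ) < n := by exact_mod_cast hn0
  have hn' : n ≠ 0 := hn0.ne'
  have hnC : 2 * L * C / ε ≤ n := (Nat.le_ceil _).trans (Nat.cast_le.2 (by omega))
  have hcard : Fintype.card (Fin n × Fin (D + 1)) = n * (D + 1) := by simp
  have hH : 0 < Fintype.card (Fin n × Fin (D + 1)) := by rw [hcard]; positivity
  obtain ⟨a, ha, hκ⟩ := h₃ n (by omega) hev
  rw [card_ratio_eq]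
  set s := {m : Equiv.Perm (Fin n × Fin (D + 1)) | IsSimp m}.ncard with hs
  set E := errN (n * (D + 1)) with hE
  set m₀ := ((mats (Fin n × Fin (D + 1))).card : ℝ) with hm₀
  have hm₀0 : 0 < m₀ := by
    rw [hm₀]
    exact_mod_cast Finset.card_pos.2 (mats_nonempty (by rwa [hcard]))
  have hsm : (s : ℝ) ≤ m₀ := by
    rw [hm₀]
    exact_mod_cast card_simple_le n D
  set P := Hf (lawV D k μ) with hP
  set Q := Hf (lawK D k μ) with hQ
  set F := (Fintype.card (UBr M D k × UBr M D k) : ℝ) with hF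
  set x := m₀ * Real.exp (-(n * (D + 1) / 2 * (Q + δ')) - (F + 1) * E - (1 + 2 * b) * E) with hx
  have hx0 : 0 < x := by positivity
  have hempV : ∀ b, |emp a b - lawV D k μ b| ≤ η₁ := fun b =>
    (ha b).trans ((min_le_left _ _).trans (min_le_left _ _))
  have hempK : ∀ t, |emp (kapA kap a) t - lawK D k μ t| ≤ η₂ := fun t => by
    refine (abs_emp_kapA_sub_le (sum_lawV hμ) hε₁0.le
      (near_id_of_emp (by simpa using hn0) ha) (fun b b' h => by simp_all)
      (push_kap hμ) (by simpa using hn0) (by omega) t).trans ?_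
    have : ε₁ ≤ η₂ / V ^ 2 := (min_le_left _ _).trans (min_le_right _ _)
    exact (le_div_iff₀ (by positivity)).1 this
  have htclass : Real.exp (n * (P - δ') - V * E) ≤ (tclass a).card := by
    have hpos : (0 : ℝ) < (tclass a).card := by
      exact_mod_cast Finset.card_pos.2 ⟨a, by simp [mem_tclass]⟩
    rw [← Real.le_log_iff_exp_le hpos, log_card_typeClass, Fintype.card_fin]
    have h5 := (mlog_bounds (cnt a) hn0 (by rw [sum_cnt, Fintype.card_fin])).1
    have h6 : (fun b => (cnt a b : ℝ) / n) = emp a := by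
      funext b
      simp [emp]
    rw [h6] at h5
    refine le_trans ?_ h5
    have h7 := (abs_le.1 (h₁ _ hempV)).1
    have h8 : errN n ≤ E := errN_mono (Nat.le_mul_of_pos_right n (by omega))
    gcongr
    linarith
  have hB : ∀ a' ∈ tclass a,
      Nat.ceil x ≤ (fewBad Prod.swap (kapA kap a') (k + 2) 0 C).card := by
    intro a' ha'
    have hcnt := cnt_kapA_of_mem_tclass (kap (M := M) (D := D) (k := k)) ha'
    have h5 := h₄ n (by omega) Prod.swap (kapA kap a') fun t => by
      rw [hcnt]
      exact (hκ t).2.2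
    have h6 := card_cons_ge (Prod.swap_swap : Function.Involutive Prod.swap) (kapA kap a') hH
      (fun t => by rw [hcnt, hcnt]; exact (hκ t).2.1) (fun t => by rw [hcnt]; exact (hκ t).1)
    have h7 : emp (kapA kap a') = emp (kapA kap a) := by
      funext t
      rw [emp, emp, hcnt]
    have h8 := (abs_le.1 (h₂ _ hempK)).2
    rw [h7, hcard] at h6
    have h9 : ((cons Prod.swap (kapA kap a')).card : ℝ) ≤ Real.exp ((1 + 2 * b) * E) *
        (fewBad Prod.swap (kapA kap a') (k + 2) 0 C).card := by
      refine le_trans (b := 2 * (((n * (D + 1) : ℕ) : ℝ) ^ 2) ^ b *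
        (fewBad Prod.swap (kapA kap a') (k + 2) 0 C).card) ?_ ?_
      · rw [mul_assoc]
        exact_mod_cast h5
      · gcongr
        exact two_mul_pow_le_exp b _ (by positivity)
    refine Nat.ceil_le.2 (le_of_mul_le_mul_left ?_ (Real.exp_pos ((1 + 2 * b) * E)))
    refine le_trans ?_ (h6.trans h9)
    rw [hx, mul_left_comm, ← Real.exp_add]
    gcongr
    push_cast
    have h10 : (n : ℝ) * (D + 1) / 2 * Hf (emp (kapA kap a)) ≤ n * (D + 1) / 2 * (Q + δ') := by
      gcongr
      linarith
    linarith
  have hmain : (tclass a).card * Nat.ceil x ≤ (matPairs D n (k + 1) μ ε).ncard := by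
    refine le_card_matPairs hμ hn' hε₁0.le ?_ ha hB
    have h5 : ε₁ ≤ ε / (2 * L * V) := min_le_right _ _
    have h6 : L * (V * ε₁) ≤ ε / 2 := by
      rw [le_div_iff₀ (by positivity)] at h5
      linarith
    have h7 : L * (C / n) ≤ ε / 2 := by
      rw [div_le_iff₀ hε] at hnC
      rw [← mul_div_assoc, div_le_iff₀ hnR]
      linarith
    rw [mul_add]
    linarith
  have hmain' : Real.exp (n * (P - δ') - V * E) * x ≤ (matPairs D n (k + 1) μ ε).ncard := by
    refine le_trans ?_ (Nat.cast_le.2 hmain)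
    push_cast
    gcongr
    exact Nat.le_ceil x
  have hs0 : (0 : ℝ) < s := by
    have h5 : (0 : ℝ) < (matPairs D n (k + 1) μ ε).ncard := lt_of_lt_of_le (by positivity) hmain'
    obtain ⟨⟨m, f⟩, hm, -⟩ := (Set.ncard_pos (Set.toFinite _)).1 (Nat.cast_pos.1 h5)
    exact Nat.cast_pos.2 ((Set.ncard_pos (Set.toFinite _)).2 ⟨m, hm⟩)
  rw [le_div_iff₀ hs0]
  calc _ ≤ Real.exp (n * (SigmaR (D + 1) (k + 1) μ - δ) - (V + (F + 1) + (1 + 2 * b)) * E) * m₀ := by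
        gcongr
    _ = Real.exp (n * (P - δ') - V * E) * x := by
      rw [hx, mul_left_comm, ← Real.exp_add, mul_comm, sigmaR_eq hD hμ, ← hδ'']
      congr 2
      ring
    _ ≤ _ := hmain'

end AnnealedBounds

/-! ### The limits -/

section Limits

lemma elog_le {x y : ℝ} (h : x ≤ Real.exp y) : elog x ≤ y := by
  unfold elog
  split_ifs with hx
  · exact bot_le
  · exact EReal.coe_le_coe_iff.2 ((Real.log_le_iff_le_exp (not_le.1 hx)).2 h)

lemma le_elog {x y : ℝ} (h : Real.exp y ≤ x) : (y : EReal) ≤ elog x := by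
  have hx := (Real.exp_pos y).trans_le h
  rw [elog, if_neg (not_le.2 hx)]
  exact EReal.coe_le_coe_iff.2 ((Real.le_log_iff_exp_le hx).2 h)

lemma tendsto_errN_div (A : ℝ) (e : ℕ) (he : 0 < e) :
    Tendsto (fun n : ℕ => A * errN (n * e) / n) atTop (𝓝 0) := by
  have h1 : Tendsto (fun x : ℝ => Real.log x / x) atTop (𝓝 0) := by
    simpa using Real.isLittleO_log_id_atTop.tendsto_div_nhds_zero
  have hN : Tendsto (fun n : ℕ => (n : ℝ) * e + 1) atTop atTop :=
    tendsto_atTop_add_const_right _ _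
      (tendsto_natCast_atTop_atTop.atTop_mul_const (by exact_mod_cast he))
  have h2 : Tendsto (fun n : ℕ => ((n : ℝ) * e + 1) / n) atTop (𝓝 e) := by
    have := (tendsto_inv_atTop_zero.comp (tendsto_natCast_atTop_atTop (R := ℝ))).const_add (e : ℝ)
    simp only [add_zero] at this
    refine this.congr' ?_
    filter_upwards [eventually_gt_atTop 0] with n hn
    have : (n : ℝ) ≠ 0 := by exact_mod_cast hn.ne'
    simp only [Function.comp_apply]
    field_simp
  have h3 := (((h1.comp hN).mul h2).add (tendsto_inv_atTop_zero.comp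
    (tendsto_natCast_atTop_atTop (R := ℝ)))).const_mul A
  simp only [zero_mul, add_zero, mul_zero] at h3
  refine h3.congr fun n => ?_
  simp only [Function.comp_apply, errN]
  push_cast
  have : (n : ℝ) * e + 1 ≠ 0 := by positivity
  field_simp
  ring

lemma goodFilter_neBot (d : ℕ) : (goodFilter d).NeBot := by
  refine Filter.inf_principal_neBot_iff.2 fun U hU => ?_
  obtain ⟨n, hn⟩ := mem_atTop_sets.1 hU
  refine ⟨2 * (n + d + 1), hn _ (by omega), by omega, ?_⟩
  rw [mul_assoc]
  exact even_two_mul _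

lemma eventually_goodFilter {d n₀ : ℕ} {p : ℕ → Prop}
    (h : ∀ n ≥ n₀, Even (n * d) → p n) : ∀ᶠ n in goodFilter d, p n := by
  refine Filter.eventually_inf_principal.2 ?_
  filter_upwards [eventually_ge_atTop n₀] with n hn hg
  exact h n hn hg.2

lemma goodFilter_le (d : ℕ) : goodFilter d ≤ atTop := inf_le_left

variable {M : Type} [Fintype M] [MeasurableSpace M] [DiscreteMeasurableSpace M] {D k : ℕ}
  {μ : Measure (TdVertex (D + 1) → M)}

lemma exists_limsup_le (hD : 1 ≤ D) (hμ : μ ∈ InvMeas (D + 1) M) {δ : ℝ} (hδ : 0 < δ) :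
    ∃ ε₀ > 0, ∀ ε < ε₀, (goodFilter (D + 1)).limsup (fun n => SigmaN (D + 1) μ (k + 1) ε n) ≤
      ((SigmaR (D + 1) (k + 1) μ + δ : ℝ) : EReal) := by
  obtain ⟨ε₀, hε₀, A, n₀, h⟩ := exists_card_ratio_le (k := k) hD hμ (half_pos hδ)
  refine ⟨ε₀, hε₀, fun ε hε => limsup_le_of_le (by isBoundedDefault) ?_⟩
  have h1 : ∀ᶠ n in goodFilter (D + 1), A * errN (n * (D + 1)) / n ≤ δ / 2 :=
    ((tendsto_errN_div A (D + 1) (by omega)).mono_left (goodFilter_le _)).eventually_le_const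
      (half_pos hδ)
  filter_upwards [h1, eventually_goodFilter (d := D + 1) (n₀ := max n₀ 1) fun n hn _ =>
    And.intro (by omega : 0 < n) (h ε hε n (by omega))] with n hn ⟨hn0, hn1⟩
  have hnR : (0 : ℝ) < n := by exact_mod_cast hn0
  refine (mul_le_mul_of_nonneg_left (elog_le hn1)
    (EReal.coe_nonneg.2 (inv_nonneg.2 hnR.le))).trans ?_
  rw [← EReal.coe_mul, EReal.coe_le_coe_iff, mul_add, inv_mul_cancel_left₀ hnR.ne', inv_mul_eq_div]
  linarith

lemma le_liminf_SigmaN (hD : 1 ≤ D) (hμ : μ ∈ InvMeas (D + 1) M) {ε : ℝ} (hε : 0 < ε) :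
    ((SigmaR (D + 1) (k + 1) μ : ℝ) : EReal) ≤
      (goodFilter (D + 1)).liminf (fun n => SigmaN (D + 1) μ (k + 1) ε n) := by
  refine EReal.ge_of_forall_gt_iff_ge.1 fun z hz => ?_
  rw [EReal.coe_lt_coe_iff] at hz
  set δ := SigmaR (D + 1) (k + 1) μ - z with hδ
  have hδ0 : 0 < δ := sub_pos.2 hz
  obtain ⟨A, n₀, h⟩ := exists_le_card_ratio (k := k) hD hμ hε (half_pos hδ0)
  refine le_liminf_of_le (by isBoundedDefault) ?_
  have h1 : ∀ᶠ n in goodFilter (D + 1), A * errN (n * (D + 1)) / n ≤ δ / 2 :=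
    ((tendsto_errN_div A (D + 1) (by omega)).mono_left (goodFilter_le _)).eventually_le_const
      (half_pos hδ0)
  filter_upwards [h1, eventually_goodFilter (d := D + 1) (n₀ := max n₀ 1) fun n hn he =>
    And.intro (by omega : 0 < n) (h n (by omega) he)] with n hn ⟨hn0, hn1⟩
  have hnR : (0 : ℝ) < n := by exact_mod_cast hn0
  refine le_trans ?_ (mul_le_mul_of_nonneg_left (le_elog hn1)
    (EReal.coe_nonneg.2 (inv_nonneg.2 hnR.le)))
  rw [← EReal.coe_mul, EReal.coe_le_coe_iff, mul_sub, inv_mul_cancel_left₀ hnR.ne', inv_mul_eq_div]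
  linarith

theorem tendsto_liminf_limsup_SigmaN (hD : 1 ≤ D) (hμ : μ ∈ InvMeas (D + 1) M) :
    Tendsto (fun ε => (goodFilter (D + 1)).liminf (fun n => SigmaN (D + 1) μ (k + 1) ε n))
      (𝓝[>] 0) (𝓝 ((SigmaR (D + 1) (k + 1) μ : ℝ) : EReal)) ∧
    Tendsto (fun ε => (goodFilter (D + 1)).limsup (fun n => SigmaN (D + 1) μ (k + 1) ε n))
      (𝓝[>] 0) (𝓝 ((SigmaR (D + 1) (k + 1) μ : ℝ) : EReal)) := by
  have := goodFilter_neBot (D + 1)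
  have hle : ∀ ε, (goodFilter (D + 1)).liminf (fun n => SigmaN (D + 1) μ (k + 1) ε n) ≤
      (goodFilter (D + 1)).limsup (fun n => SigmaN (D + 1) μ (k + 1) ε n) := fun ε =>
    liminf_le_limsup
  have hup : ∀ b > ((SigmaR (D + 1) (k + 1) μ : ℝ) : EReal), ∀ᶠ ε in 𝓝[>] (0 : ℝ),
      (goodFilter (D + 1)).limsup (fun n => SigmaN (D + 1) μ (k + 1) ε n) < b := by
    intro b hb
    obtain ⟨z, hz, hzb⟩ := EReal.lt_iff_exists_real_btwn.1 hb
    rw [EReal.coe_lt_coe_iff] at hz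
    obtain ⟨ε₀, hε₀, h⟩ := exists_limsup_le (k := k) hD hμ (sub_pos.2 hz)
    rw [add_sub_cancel] at h
    filter_upwards [nhdsWithin_le_nhds (eventually_lt_nhds hε₀)] with ε hε
    exact (h ε hε).trans_lt hzb
  have hlow : ∀ b < ((SigmaR (D + 1) (k + 1) μ : ℝ) : EReal), ∀ᶠ ε in 𝓝[>] (0 : ℝ),
      b < (goodFilter (D + 1)).liminf (fun n => SigmaN (D + 1) μ (k + 1) ε n) := by
    intro b hb
    filter_upwards [self_mem_nhdsWithin] with ε hε
    exact hb.trans_le (le_liminf_SigmaN hD hμ hε)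
  exact ⟨tendsto_order.2 ⟨hlow, fun b hb => (hup b hb).mono fun ε h => (hle ε).trans_lt h⟩,
    tendsto_order.2 ⟨fun b hb => (hlow b hb).mono fun ε h => h.trans_le (hle ε), hup⟩⟩

end Limits

/-- Combinatorial characterization of the annealed entropy:
`lim_{ε→0} liminf_n Σ_n(μ,r,ε) = lim_{ε→0} limsup_n Σ_n(μ,r,ε) = Σ_r(μ)`. -/
theorem annealed_entropy_convergence
    (d : ℕ) (hd : 3 ≤ d) (M : Type) [Fintype M] [MeasurableSpace M]
    [DiscreteMeasurableSpace M]
    (μ : Measure (TdVertex d → M)) (hμ : μ ∈ InvMeas d M) (r : ℕ) (hr : 1 ≤ r) :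
    Tendsto (fun ε => (goodFilter d).liminf (fun n => SigmaN d μ r ε n))
      (nhdsWithin 0 (Set.Ioi 0)) (nhds ((SigmaR d r μ : ℝ) : EReal)) ∧
    Tendsto (fun ε => (goodFilter d).limsup (fun n => SigmaN d μ r ε n))
      (nhdsWithin 0 (Set.Ioi 0)) (nhds ((SigmaR d r μ : ℝ) : EReal)) := by
  obtain ⟨D, rfl⟩ : ∃ D, d = D + 1 := ⟨d - 1, by omega⟩
  obtain ⟨k, rfl⟩ : ∃ k, r = k + 1 := ⟨r - 1, by omega⟩
  exact tendsto_liminf_limsup_SigmaN (by omega) hμ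

end TreeEntropy
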